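/- Let $m(\xi,\eta) = \int_{-\infty}^\xi\int_{-\infty}^\eta d\mu(t,s)$ with $\mu$ a finite measure on $\mathbb{R}^2$, and let $B_m$ be the corresponding bilinear Fourier multiplier. Then for all weights $w_1, w_2 \in A_1$, $B_m$ is bounded from $L^1(w_1) \times L^1(w_2)$ into $L^{1/2,\infty}(w_1^{1/2} w_2^{1/2})$. -/

import Mathlib

open MeasureTheory ENNReal Set Filter

noncomputable section

/-- The measure with density `w` with respect to the ambient volume. -/
def wMeasure {α : Type*} [MeasureSpace α] (w : α → ℝ) : Measure α :=
  (volume : Measure α).withDensity fun x => ENNReal.ofReal (w x)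

/-- The weak Lorentz `L^{q,∞}(μ)` quasi-norm. -/
def wLorentz {α E : Type*} [MeasurableSpace α] [Norm E] (q : ℝ) (μ : Measure α)
    (g : α → E) : ℝ≥0∞ :=
  ⨆ (t : ℝ) (_ : 0 < t), ENNReal.ofReal t * μ {x | t < ‖g x‖} ^ (1 / q)

/-- The weak Lorentz `L^{q,∞}(μ)` quasi-norm, for `ℝ≥0∞`-valued functions. -/
def wLorentzE {α : Type*} [MeasurableSpace α] (q : ℝ) (μ : Measure α)
    (g : α → ℝ≥0∞) : ℝ≥0∞ :=
  ⨆ (t : ℝ) (_ : 0 < t), ENNReal.ofReal t * μ {x | ENNReal.ofReal t < g x} ^ (1 / q)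

/-- The Lorentz `L^{p,r}(μ)` quasi-norm (computed via the distribution function). -/
def lorentz {α E : Type*} [MeasurableSpace α] [Norm E] (p r : ℝ) (μ : Measure α)
    (g : α → E) : ℝ≥0∞ :=
  (∫⁻ t in Set.Ioi (0 : ℝ), ENNReal.ofReal (t ^ (r - 1)) * μ {x | t < ‖g x‖} ^ (r / p)) ^ (1 / r)

/-- A weight: a locally integrable, a.e. positive function. -/
def IsWeight {α : Type*} [MeasureSpace α] [TopologicalSpace α] (w : α → ℝ) : Prop :=
  LocallyIntegrable w volume ∧ ∀ᵐ x : α ∂volume, 0 < w x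


/-- The Hardy–Littlewood maximal operator over intervals on `ℝ`. -/
def maxOpR (f : ℝ → ℝ) (x : ℝ) : ℝ≥0∞ :=
  ⨆ (a : ℝ) (b : ℝ) (_ : a < b) (_ : x ∈ Set.Icc a b),
    (∫⁻ y in Set.Icc a b, ENNReal.ofReal |f y|) / volume (Set.Icc a b)

/-- The `A₁` constant on `ℝ`. -/
def A1ConstR (u : ℝ → ℝ) : ℝ≥0∞ :=
  sInf {C : ℝ≥0∞ | ∀ᵐ x : ℝ, maxOpR u x ≤ C * ENNReal.ofReal (u x)}

def MemA1R (u : ℝ → ℝ) : Prop := IsWeight u ∧ A1ConstR u < ⊤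

/-- The restricted `A_q^𝓡` constant on `ℝ`. -/
def AqRConstR (q : ℝ) (w : ℝ → ℝ) : ℝ≥0∞ :=
  ⨆ (a : ℝ) (b : ℝ) (_ : a < b) (E : Set ℝ) (_ : MeasurableSet E)
    (_ : E ⊆ Set.Icc a b) (_ : 0 < volume E),
    volume E / volume (Set.Icc a b) * (wMeasure w (Set.Icc a b) / wMeasure w E) ^ (1 / q)

/-- The Hilbert transform (principal value) of a complex-valued function. -/
def hilbertC (f : ℝ → ℂ) (x : ℝ) : ℂ :=
  limUnder (nhdsWithin 0 (Set.Ioi (0 : ℝ)))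
    fun ε : ℝ => ∫ t in {t : ℝ | ε < |x - t|}, f t / ((x : ℂ) - (t : ℂ))

/-- The Hilbert transform (principal value) of a real-valued function. -/
def hilbertR (f : ℝ → ℝ) (x : ℝ) : ℝ :=
  limUnder (nhdsWithin 0 (Set.Ioi (0 : ℝ)))
    fun ε : ℝ => ∫ t in {t : ℝ | ε < |x - t|}, f t / (x - t)

/-- `e(θ) = exp(iθ)`. -/
def eTerm (θ : ℝ) : ℂ := Complex.exp (Complex.I * θ)

/-- The Fourier transform `f̂(ξ) = ∫ f(x) e^{-2πixξ} dx`. -/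
def FT (f : ℝ → ℂ) (ξ : ℝ) : ℂ := ∫ x : ℝ, eTerm (-(2 * Real.pi * x * ξ)) * f x

/-- `H_r h(x) = ½[h(x) + i e^{2πixr} H(e^{-2πir·}h)(x)]`, the Fourier multiplier with
symbol `χ_{(r,∞)}`. -/
def Hmod (r : ℝ) (f : ℝ → ℂ) (x : ℝ) : ℂ :=
  (1 / 2) * (f x + Complex.I * eTerm (2 * Real.pi * x * r) *
    hilbertC (fun y => eTerm (-(2 * Real.pi * y * r)) * f y) x)

/-- The bounded-variation-type symbol `m(ξ,η) = ∫_{-∞}^ξ∫_{-∞}^η dμ(t,s)`. -/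
def mSymb (μ : Measure (ℝ × ℝ)) (ξ η : ℝ) : ℝ := (μ (Set.Iio ξ ×ˢ Set.Iio η)).toReal

/-- The bilinear Fourier multiplier
`B_m(f,g)(x) = ∫∫ m(ξ,η) f̂(ξ) ĝ(η) e^{2πix(ξ+η)} dξ dη`. -/
def Bm (μ : Measure (ℝ × ℝ)) (f g : ℝ → ℂ) (x : ℝ) : ℂ :=
  ∫ p : ℝ × ℝ, (mSymb μ p.1 p.2 : ℂ) * FT f p.1 * FT g p.2 *
    eTerm (2 * Real.pi * x * (p.1 + p.2))

section

open scoped NNReal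

/-- The open intervals (coded by their endpoints) that are the connected components of `O`. -/
def comps (O : Set ℝ) : Set (ℝ × ℝ) :=
  {p | p.1 < p.2 ∧ Ioo p.1 p.2 ⊆ O ∧ p.1 ∉ O ∧ p.2 ∉ O}

lemma Ioo_subset_of_mem_comps {O : Set ℝ} {p : ℝ × ℝ} (hp : p ∈ comps O) {a b x : ℝ}
    (hab : Ioo a b ⊆ O) (hx : x ∈ Ioo a b) (hxp : x ∈ Ioo p.1 p.2) :
    Ioo a b ⊆ Ioo p.1 p.2 := by
  obtain ⟨-, -, h1, h2⟩ := hp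
  have ha : p.1 ≤ a := by
    by_contra! h
    exact h1 (hab ⟨h, hxp.1.trans hx.2⟩)
  have hb : b ≤ p.2 := by
    by_contra! h
    exact h2 (hab ⟨hx.1.trans hxp.2, h⟩)
  exact Ioo_subset_Ioo ha hb

lemma pairwiseDisjoint_comps (O : Set ℝ) :
    (comps O).PairwiseDisjoint fun p => Ioo p.1 p.2 := by
  intro p hp q hq hpq
  refine Set.disjoint_left.2 fun x hxp hxq => hpq ?_
  have h1 := Ioo_subset_of_mem_comps hp hq.2.1 hxq hxp
  have h2 := Ioo_subset_of_mem_comps hq hp.2.1 hxp hxq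
  have h1' := (Ioo_subset_Ioo_iff hq.1).1 h1
  have h2' := (Ioo_subset_Ioo_iff hp.1).1 h2
  exact Prod.ext (le_antisymm h1'.1 h2'.1) (le_antisymm h2'.2 h1'.2)

lemma countable_comps (O : Set ℝ) : (comps O).Countable :=
  (pairwiseDisjoint_comps O).countable_of_isOpen (fun _ _ => isOpen_Ioo)
    fun _ hp => nonempty_Ioo.2 hp.1

lemma iUnion_comps {O : Set ℝ} (hO : IsOpen O) {α β : ℝ} (hb : O ⊆ Ioo α β) :
    ⋃ p ∈ comps O, Ioo p.1 p.2 = O := by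
  refine subset_antisymm (iUnion₂_subset fun p hp => hp.2.1) fun x hx => ?_
  have hxab := hb hx
  have hc : IsClosed Oᶜ := hO.isClosed_compl
  have hneA : (Oᶜ ∩ Iic x).Nonempty := ⟨α, fun h => (lt_irrefl _ (hb h).1), hxab.1.le⟩
  have hneB : (Oᶜ ∩ Ici x).Nonempty := ⟨β, fun h => (lt_irrefl _ (hb h).2), hxab.2.le⟩
  have bA : BddAbove (Oᶜ ∩ Iic x) := ⟨x, fun y hy => hy.2⟩
  have bB : BddBelow (Oᶜ ∩ Ici x) := ⟨x, fun y hy => hy.2⟩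
  have hA := (hc.inter isClosed_Iic).csSup_mem hneA bA
  have hB := (hc.inter isClosed_Ici).csInf_mem hneB bB
  set a := sSup (Oᶜ ∩ Iic x)
  set b := sInf (Oᶜ ∩ Ici x)
  have hax : a < x := lt_of_le_of_ne hA.2 fun h => hA.1 (h ▸ hx)
  have hxb : x < b := lt_of_le_of_ne hB.2 fun h => hB.1 (h ▸ hx)
  refine mem_iUnion₂.2 ⟨(a, b), ⟨hax.trans hxb, fun y hy => ?_, hA.1, hB.1⟩, hax, hxb⟩
  by_contra hyO
  rcases le_total y x with h | h
  · exact absurd (le_csSup bA ⟨hyO, h⟩) (not_le.2 hy.1)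
  · exact absurd (csInf_le bB ⟨hyO, h⟩) (not_le.2 hy.2)

lemma measure_inter_eq_tsum_comps {O : Set ℝ} (hO : IsOpen O) {α β : ℝ} (hb : O ⊆ Ioo α β)
    (μ : Measure ℝ) {S : Set ℝ} (hS : MeasurableSet S) :
    μ (O ∩ S) = ∑' p : comps O, μ (Ioo p.1.1 p.1.2 ∩ S) := by
  have : O ∩ S = ⋃ p ∈ comps O, Ioo p.1 p.2 ∩ S := by
    rw [← iUnion₂_inter, iUnion_comps hO hb]
  rw [this, measure_biUnion (countable_comps O)
    ((pairwiseDisjoint_comps O).mono_on fun p _ => inter_subset_left)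
    fun p _ => measurableSet_Ioo.inter hS]

/-- The superlevel set `{M g > s}`, where `M` is the uncentred maximal operator over the open
subintervals of `(α, β)`. -/
def lev (α β : ℝ) (g : ℝ → ℝ≥0∞) (s : ℝ≥0∞) : Set ℝ :=
  ⋃ p ∈ {p : ℝ × ℝ | α ≤ p.1 ∧ p.1 < p.2 ∧ p.2 ≤ β ∧
    s * ENNReal.ofReal (p.2 - p.1) < ∫⁻ x in Ioo p.1 p.2, g x}, Ioo p.1 p.2

lemma Ioo_subset_lev {α β a b : ℝ} {g : ℝ → ℝ≥0∞} {s : ℝ≥0∞} (ha : α ≤ a) (hab : a < b)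
    (hb : b ≤ β) (h : s * ENNReal.ofReal (b - a) < ∫⁻ x in Ioo a b, g x) :
    Ioo a b ⊆ lev α β g s :=
  fun _ hx => mem_iUnion₂.2 ⟨(a, b), ⟨ha, hab, hb, h⟩, hx⟩

lemma mem_lev {α β x : ℝ} {g : ℝ → ℝ≥0∞} {s : ℝ≥0∞} :
    x ∈ lev α β g s ↔ ∃ a b, α ≤ a ∧ a < b ∧ b ≤ β ∧
      s * ENNReal.ofReal (b - a) < ∫⁻ x in Ioo a b, g x ∧ x ∈ Ioo a b := by
  simp only [lev, mem_iUnion, mem_ofPred_eq, Prod.exists]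
  constructor
  · rintro ⟨a, b, ⟨h1, h2, h3, h4⟩, h5⟩; exact ⟨a, b, h1, h2, h3, h4, h5⟩
  · rintro ⟨a, b, h1, h2, h3, h4, h5⟩; exact ⟨a, b, ⟨h1, h2, h3, h4⟩, h5⟩

lemma isOpen_lev (α β : ℝ) (g : ℝ → ℝ≥0∞) (s : ℝ≥0∞) : IsOpen (lev α β g s) :=
  isOpen_biUnion fun _ _ => isOpen_Ioo

lemma lev_subset (α β : ℝ) (g : ℝ → ℝ≥0∞) (s : ℝ≥0∞) : lev α β g s ⊆ Ioo α β :=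
  iUnion₂_subset fun _ hp => Ioo_subset_Ioo hp.1 hp.2.2.1

lemma lev_anti {α β : ℝ} {g : ℝ → ℝ≥0∞} {s t : ℝ≥0∞} (h : s ≤ t) :
    lev α β g t ⊆ lev α β g s := by
  intro x hx
  obtain ⟨a, b, h1, h2, h3, h4, h5⟩ := mem_lev.1 hx
  exact mem_lev.2 ⟨a, b, h1, h2, h3, lt_of_le_of_lt (by gcongr) h4, h5⟩

lemma lev_eq_empty {α β : ℝ} {g : ℝ → ℝ≥0∞} {s : ℝ≥0∞} (h : ∀ x, g x ≤ s) :
    lev α β g s = ∅ := by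
  refine eq_empty_of_forall_notMem fun x hx => ?_
  obtain ⟨a, b, -, h2, -, h4, -⟩ := mem_lev.1 hx
  refine absurd h4 (not_lt.2 ?_)
  calc ∫⁻ x in Ioo a b, g x ≤ ∫⁻ _ in Ioo a b, s := lintegral_mono fun x => h x
    _ = s * ENNReal.ofReal (b - a) := by simp

/-- Inside a component the maximal operator may be localized. -/
lemma lev_inter_comp_subset {α β : ℝ} {g : ℝ → ℝ≥0∞} {s t : ℝ≥0∞} (hst : s ≤ t) {p : ℝ × ℝ}
    (hp : p ∈ comps (lev α β g s)) : lev α β g t ∩ Ioo p.1 p.2 ⊆ lev p.1 p.2 g t := by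
  rintro x ⟨hx, hxp⟩
  obtain ⟨a, b, h1, h2, h3, h4, h5⟩ := mem_lev.1 hx
  have hsub := (Ioo_subset_Ioo_iff h2).1 (Ioo_subset_of_mem_comps hp
    ((Ioo_subset_lev h1 h2 h3 h4).trans (lev_anti hst)) h5 hxp)
  exact mem_lev.2 ⟨a, b, hsub.1, h2, hsub.2, h4, h5⟩

lemma endpoints_of_mem_comps_lev {α β : ℝ} {g : ℝ → ℝ≥0∞} {s : ℝ≥0∞} {p : ℝ × ℝ}
    (hp : p ∈ comps (lev α β g s)) : α ≤ p.1 ∧ p.2 ≤ β :=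
  (Ioo_subset_Ioo_iff hp.1).1 (hp.2.1.trans (lev_subset _ _ _ _))

lemma le_of_forall_add_mul {x y c : ℝ≥0∞} (hc : c ≠ ∞)
    {δ : ℝ} (hδ : 0 < δ) (h : ∀ t : ℝ, 0 < t → t < δ → x ≤ y + c * ENNReal.ofReal t) : x ≤ y := by
  have h1 : Tendsto (fun t : ℝ => y + c * ENNReal.ofReal t) (nhdsWithin 0 (Ioi 0)) (nhds y) := by
    have : Tendsto (fun t : ℝ => y + c * ENNReal.ofReal t) (nhdsWithin 0 (Ioi 0))
        (nhds (y + c * ENNReal.ofReal 0)) := by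
      refine Tendsto.const_add _ (ENNReal.Tendsto.const_mul ?_ (Or.inr hc))
      exact (ENNReal.continuous_ofReal.tendsto 0).mono_left nhdsWithin_le_nhds
    simpa using this
  refine ge_of_tendsto h1 ?_
  filter_upwards [Ioo_mem_nhdsGT hδ] with t ht using h t ht.1 ht.2

/-- The mean of `g` over a component of `{M g > s}` is at most `s`. -/
lemma lintegral_comp_lev_le {α β : ℝ} {g : ℝ → ℝ≥0∞} {s : ℝ≥0∞} (hs : s ≠ ∞) {p : ℝ × ℝ}
    (hp : p ∈ comps (lev α β g s)) (hne : p ≠ (α, β)) :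
    ∫⁻ x in Ioo p.1 p.2, g x ≤ s * ENNReal.ofReal (p.2 - p.1) := by
  obtain ⟨h1, h2⟩ := endpoints_of_mem_comps_lev hp
  have hpp := hp.1
  by_cases ha : p.1 = α
  · have hb : p.2 < β := lt_of_le_of_ne h2 fun h => hne (Prod.ext ha h)
    refine le_of_forall_add_mul hs (sub_pos.2 hb) fun t ht htb => ?_
    have hnot : ¬ s * ENNReal.ofReal (p.2 + t - p.1) < ∫⁻ x in Ioo p.1 (p.2 + t), g x :=
      fun h => hp.2.2.2 (Ioo_subset_lev h1 (by linarith) (by linarith) h ⟨hpp, by linarith⟩)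
    calc ∫⁻ x in Ioo p.1 p.2, g x ≤ ∫⁻ x in Ioo p.1 (p.2 + t), g x :=
          lintegral_mono_set (Ioo_subset_Ioo_right (by linarith))
      _ ≤ s * ENNReal.ofReal (p.2 + t - p.1) := not_lt.1 hnot
      _ = _ := by
        rw [← mul_add, ← ENNReal.ofReal_add (by linarith) ht.le]; congr 2; ring
  · have ha' : α < p.1 := lt_of_le_of_ne h1 (Ne.symm ha)
    refine le_of_forall_add_mul hs (sub_pos.2 ha') fun t ht htb => ?_
    have hnot : ¬ s * ENNReal.ofReal (p.2 - (p.1 - t)) < ∫⁻ x in Ioo (p.1 - t) p.2, g x :=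
      fun h => hp.2.2.1 (Ioo_subset_lev (by linarith) (by linarith) h2 h ⟨by linarith, hpp⟩)
    calc ∫⁻ x in Ioo p.1 p.2, g x ≤ ∫⁻ x in Ioo (p.1 - t) p.2, g x :=
          lintegral_mono_set (Ioo_subset_Ioo_left (by linarith))
      _ ≤ s * ENNReal.ofReal (p.2 - (p.1 - t)) := not_lt.1 hnot
      _ = _ := by
        rw [← mul_add, ← ENNReal.ofReal_add (by linarith) ht.le]; congr 2; ring

lemma ae_le_of_notMem_lev {α β : ℝ} {g : ℝ → ℝ≥0∞} (hg : AEMeasurable g)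
    (hfin : ∫⁻ x in Ioo α β, g x ≠ ∞) (s : ℝ≥0∞) :
    ∀ᵐ x, x ∈ Ioo α β → x ∉ lev α β g s → g x ≤ s := by
  have h0 : ∫⁻ x, (Ioo α β).indicator g x ≠ ∞ := by
    rwa [lintegral_indicator measurableSet_Ioo]
  filter_upwards [(IsUnifLocDoublingMeasure.vitaliFamily (volume : Measure ℝ) 1).ae_tendsto_lintegral_div
    (hg.indicator measurableSet_Ioo) h0] with x hx hxI hxl
  have hy : Tendsto (fun r : ℝ => (∫⁻ y in Metric.closedBall x r, (Ioo α β).indicator g y) /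
      volume (Metric.closedBall x r)) (nhdsWithin 0 (Ioi 0)) (nhds (g x)) := by
    have := hx.comp (IsUnifLocDoublingMeasure.tendsto_closedBall_filterAt (K := 1) volume
      (l := nhdsWithin (0 : ℝ) (Ioi 0)) (fun _ => x) (fun r => r) tendsto_id
      (by filter_upwards [self_mem_nhdsWithin] with r hr
          simpa using (le_of_lt hr : (0:ℝ) ≤ r)))
    rwa [indicator_of_mem hxI] at this
  refine le_of_tendsto hy ?_
  have hδ : 0 < min (x - α) (β - x) := lt_min (sub_pos.2 hxI.1) (sub_pos.2 hxI.2)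
  filter_upwards [Ioo_mem_nhdsGT hδ] with r hr
  have hr1 : r < x - α := hr.2.trans_le (min_le_left _ _)
  have hr2 : r < β - x := hr.2.trans_le (min_le_right _ _)
  have hr0 := hr.1
  have hnot : ¬ s * ENNReal.ofReal (x + r - (x - r)) < ∫⁻ x in Ioo (x - r) (x + r), g x :=
    fun h => hxl (Ioo_subset_lev (by linarith) (by linarith) (by linarith) h
      ⟨by linarith, by linarith⟩)
  rw [Real.closedBall_eq_Icc, Real.volume_Icc]
  refine ENNReal.div_le_of_le_mul (le_trans ?_ (not_lt.1 hnot))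
  rw [setLIntegral_congr (Ioo_ae_eq_Icc (a := x - r) (b := x + r)).symm]
  exact lintegral_mono fun y => indicator_le_self' (by simp) y

end

section

open scoped NNReal

/-- The measure with density `U` with respect to Lebesgue measure. -/
abbrev dens (U : ℝ → ℝ≥0∞) : Measure ℝ := (volume : Measure ℝ).withDensity U

/-- `U` is an everywhere positive and finite `A₁` weight with constant at most `C`. -/
structure IsA1 (C : ℝ≥0) (U : ℝ → ℝ≥0∞) : Prop where
  one_le : 1 ≤ C
  measurable : Measurable U
  ne_zero : ∀ x, U x ≠ 0
  ne_top : ∀ x, U x ≠ ∞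
  le : ∀ a b, a < b → ∀ᵐ x, x ∈ Ioo a b →
    ∫⁻ y in Ioo a b, U y ≤ C * ENNReal.ofReal (b - a) * U x

lemma dens_one : dens (fun _ => 1) = volume := withDensity_one

lemma le_inv_mul_of_mul_le_of_ne {s x y : ℝ≥0∞} (hs : s ≠ 0) (hs' : s ≠ ∞) (h : s * x ≤ y) :
    x ≤ s⁻¹ * y := by
  calc x = s⁻¹ * (s * x) := by rw [← mul_assoc, ENNReal.inv_mul_cancel hs hs', one_mul]
    _ ≤ _ := by gcongr

lemma isA1_one : IsA1 1 fun _ => 1 where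
  one_le := le_rfl
  measurable := measurable_const
  ne_zero _ := one_ne_zero
  ne_top _ := ENNReal.one_ne_top
  le a b _ := by simp

namespace IsA1

variable {C : ℝ≥0} {U : ℝ → ℝ≥0∞}

lemma dens_apply (hU : IsA1 C U) (f : ℝ → ℝ≥0∞) {S : Set ℝ} (hS : MeasurableSet S) :
    ∫⁻ x in S, f x ∂dens U = ∫⁻ x in S, f x * U x := by
  rw [setLIntegral_withDensity_eq_setLIntegral_mul_non_measurable _ hU.measurable _ hS
    (ae_of_all _ fun x => (hU.ne_top x).lt_top)]
  simp [mul_comm]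

lemma dens_set (U : ℝ → ℝ≥0∞) {S : Set ℝ} (hS : MeasurableSet S) :
    dens U S = ∫⁻ x in S, U x := withDensity_apply _ hS

lemma dens_Ioo_ne_top (hU : IsA1 C U) (a b : ℝ) : dens U (Ioo a b) ≠ ∞ := by
  rcases le_or_gt b a with hab | hab
  · simp [Ioo_eq_empty (not_lt.2 hab)]
  have h1 := hU.le a b hab
  have h2 : ∃ x, x ∈ Ioo a b ∧ ∫⁻ y in Ioo a b, U y ≤ C * ENNReal.ofReal (b - a) * U x := by
    by_contra! h
    have : volume (Ioo a b) = 0 := by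
      refine measure_mono_null (fun x hx => ?_) h1
      simp only [mem_compl_iff, Set.mem_ofPred_eq, Classical.not_imp, not_le]
      exact ⟨hx, h x hx⟩
    rw [Real.volume_Ioo] at this
    simp at this; linarith
  obtain ⟨x, -, hx⟩ := h2
  rw [dens_set U measurableSet_Ioo]
  refine ne_top_of_le_ne_top ?_ hx
  exact ENNReal.mul_ne_top (ENNReal.mul_ne_top (by simp) (by simp)) (hU.ne_top x)

lemma lintegral_mul_le (hU : IsA1 C U) {a b : ℝ} (hab : a < b) (f : ℝ → ℝ≥0∞) :
    dens U (Ioo a b) * ∫⁻ x in Ioo a b, f x ≤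
      C * ENNReal.ofReal (b - a) * ∫⁻ x in Ioo a b, f x * U x := by
  have hfin := hU.dens_Ioo_ne_top a b
  rw [← lintegral_const_mul' _ _ hfin, ← lintegral_const_mul' _ _
    (ENNReal.mul_ne_top (by simp) (by simp))]
  refine lintegral_mono_ae ?_
  rw [ae_restrict_iff' measurableSet_Ioo]
  filter_upwards [hU.le a b hab] with x hx hxI
  rw [dens_set U measurableSet_Ioo]
  calc _ ≤ C * ENNReal.ofReal (b - a) * U x * f x := by gcongr; exact hx hxI
    _ = _ := by ring

lemma dens_ne_zero (hU : IsA1 C U) {a b : ℝ} (hab : a < b) : dens U (Ioo a b) ≠ 0 := by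
  rw [dens_set U measurableSet_Ioo]
  intro h
  rw [lintegral_eq_zero_iff hU.measurable] at h
  have h3 : ∀ᵐ x, x ∉ Ioo a b := by
    have := (ae_restrict_iff' measurableSet_Ioo).1 h
    filter_upwards [this] with x hx hxI
    exact hU.ne_zero x (hx hxI)
  have h4 : volume (Ioo a b) = 0 := by
    exact measure_mono_null (fun x hx => not_not.2 hx) (ae_iff.1 h3)
  rw [Real.volume_Ioo] at h4
  simp at h4; linarith

lemma dens_mul_volume_le (hU : IsA1 C U) {a b : ℝ} (hab : a < b) {A : Set ℝ}
    (hA : MeasurableSet A) (hAs : A ⊆ Ioo a b) :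
    dens U (Ioo a b) * volume A ≤ C * ENNReal.ofReal (b - a) * dens U A := by
  have := hU.lintegral_mul_le hab (A.indicator 1)
  have h1 : ∫⁻ x in Ioo a b, A.indicator 1 x = volume A := by
    rw [lintegral_indicator_one hA, Measure.restrict_apply hA, inter_eq_left.2 hAs]
  have h2 : ∫⁻ x in Ioo a b, A.indicator 1 x * U x = dens U A := by
    rw [dens_set U hA, ← inter_eq_left.2 hAs, ← Measure.restrict_restrict hA,
      ← lintegral_indicator hA]
    congr 1 with x
    by_cases hx : x ∈ A <;> simp [hx, inter_eq_left.2 hAs]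
  rwa [h1, h2] at this

/-- Removing at most half of an interval keeps a fixed proportion of the weight. -/
lemma dens_le_diff (hU : IsA1 C U) {a b : ℝ} (hab : a < b) {A : Set ℝ}
    (hA : MeasurableSet A) (h : 2 * volume (Ioo a b ∩ A) ≤ ENNReal.ofReal (b - a)) :
    dens U (Ioo a b) ≤ 2 * C * dens U (Ioo a b \ A) := by
  have h1 := hU.dens_mul_volume_le hab (measurableSet_Ioo.diff hA) sdiff_subset
  have hpos : ENNReal.ofReal (b - a) ≠ 0 := by simpa using hab
  have h2 : ENNReal.ofReal (b - a) ≤ 2 * volume (Ioo a b \ A) := by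
    have h3 : volume (Ioo a b ∩ A) + volume (Ioo a b \ A) = ENNReal.ofReal (b - a) := by
      rw [measure_inter_add_sdiff _ hA, Real.volume_Ioo]
    set x := volume (Ioo a b ∩ A)
    have hx : x ≠ ∞ := by
      refine ne_top_of_le_ne_top (b := ENNReal.ofReal (b - a)) ENNReal.ofReal_ne_top ?_
      rw [← h3]; exact le_self_add
    rw [← h3] at h ⊢
    rw [two_mul, ENNReal.add_le_add_iff_left hx] at h
    rw [two_mul]; gcongr
  have h4 : ENNReal.ofReal (b - a) * dens U (Ioo a b) ≤
      ENNReal.ofReal (b - a) * (2 * C * dens U (Ioo a b \ A)) := by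
    calc _ ≤ 2 * volume (Ioo a b \ A) * dens U (Ioo a b) := by gcongr
      _ = 2 * (dens U (Ioo a b) * volume (Ioo a b \ A)) := by ring
      _ ≤ 2 * (C * ENNReal.ofReal (b - a) * dens U (Ioo a b \ A)) := by gcongr
      _ = _ := by ring
  exact (ENNReal.mul_le_mul_iff_right hpos ENNReal.ofReal_ne_top).1 h4

/-- The contraction factor attached to an `A₁` constant. -/
def _root_.contr (C : ℝ≥0) : ℝ≥0 := 1 - (2 * C)⁻¹

lemma dens_inter_le (hU : IsA1 C U) {a b : ℝ} (hab : a < b) {A : Set ℝ}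
    (hA : MeasurableSet A) (h : 2 * volume (Ioo a b ∩ A) ≤ ENNReal.ofReal (b - a)) :
    dens U (Ioo a b ∩ A) ≤ contr C * dens U (Ioo a b) := by
  have h1 := hU.dens_le_diff hab hA h
  have h2 := measure_inter_add_sdiff (μ := dens U) (Ioo a b) hA
  have hf := hU.dens_Ioo_ne_top a b
  have hf1 : dens U (Ioo a b ∩ A) ≠ ∞ := ne_top_of_le_ne_top hf (measure_mono inter_subset_left)
  have hf2 : dens U (Ioo a b \ A) ≠ ∞ := ne_top_of_le_ne_top hf (measure_mono sdiff_subset)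
  lift dens U (Ioo a b) to ℝ≥0 using hf with X
  lift dens U (Ioo a b ∩ A) to ℝ≥0 using hf1 with Y
  lift dens U (Ioo a b \ A) to ℝ≥0 using hf2 with Z
  norm_cast at *
  have hC : (0:ℝ) < 2 * C := by
    have : (1:ℝ) ≤ C := by exact_mod_cast hU.one_le
    linarith
  have hle : (2 * C)⁻¹ ≤ (1 : ℝ≥0) := by
    refine inv_le_one_of_one_le₀ ?_
    have := hU.one_le
    calc (1:ℝ≥0) ≤ C := this
      _ ≤ 2 * C := by rw [two_mul]; exact le_self_add
  rw [← NNReal.coe_le_coe, contr]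
  push_cast [NNReal.coe_sub hle]
  rw [← NNReal.coe_le_coe] at h1
  push_cast at h1
  have h3 : (Y:ℝ) + Z = X := by exact_mod_cast h2
  have h4 : (2 * (C:ℝ))⁻¹ * X ≤ Z := by
    rw [inv_mul_le_iff₀ hC]; exact h1
  linarith

end IsA1

lemma contr_lt_one {C : ℝ≥0} (h : 1 ≤ C) : contr C < 1 := by
  refine tsub_lt_self one_pos ?_
  have : 0 < C := one_pos.trans_le h
  positivity

/-- Vitali covering estimate: if the `U`-mass of every interval of a family inside `(α, β)` is
controlled by the mass of `H`, so is the `U`-mass of the union. -/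
lemma IsA1.dens_biUnion_le {C : ℝ≥0} {U : ℝ → ℝ≥0∞} (hU : IsA1 C U) {α β : ℝ}
    {F : Set (ℝ × ℝ)} (H : ℝ → ℝ≥0∞) (hF : ∀ p ∈ F, α ≤ p.1 ∧ p.1 < p.2 ∧ p.2 ≤ β)
    (hH : ∀ p ∈ F, dens U (Ioo p.1 p.2) ≤ ∫⁻ x in Ioo p.1 p.2, H x) :
    dens U (⋃ p ∈ F, Ioo p.1 p.2) ≤ 6 * C * ∫⁻ x in Ioo α β, H x := by
  obtain ⟨G, hGF, hdis, hcov⟩ := Vitali.exists_disjoint_subfamily_covering_enlargement_closedBall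
    F (fun p => (p.1 + p.2) / 2) (fun p => (p.2 - p.1) / 2) ((β - α) / 2)
    (fun p hp => by have := hF p hp; linarith) 5 (by norm_num)
  simp only [Real.closedBall_eq_Icc] at hdis hcov
  have hsub : ∀ p : ℝ × ℝ, Ioo p.1 p.2 ⊆
      Icc ((p.1 + p.2) / 2 - (p.2 - p.1) / 2) ((p.1 + p.2) / 2 + (p.2 - p.1) / 2) := by
    intro p x hx
    constructor <;> linarith [hx.1, hx.2]
  have hdis' : G.PairwiseDisjoint fun p => Ioo p.1 p.2 :=
    hdis.mono fun p => hsub p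
  have hcount : G.Countable := hdis'.countable_of_isOpen (fun _ _ => isOpen_Ioo)
    fun p hp => nonempty_Ioo.2 (hF p (hGF hp)).2.1
  set B : ℝ × ℝ → Set ℝ := fun p =>
    Ioo ((p.1 + p.2) / 2 - 6 * ((p.2 - p.1) / 2)) ((p.1 + p.2) / 2 + 6 * ((p.2 - p.1) / 2))
  have hcov' : (⋃ p ∈ F, Ioo p.1 p.2) ⊆ ⋃ p ∈ G, B p := by
    refine iUnion₂_subset fun p hp x hx => ?_
    obtain ⟨q, hq, hpq⟩ := hcov p hp
    have h1 := hpq (hsub p hx)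
    have h2 := (hF q (hGF hq)).2.1
    refine mem_iUnion₂.2 ⟨q, hq, ?_, ?_⟩ <;> simp only [mem_Icc] at h1 <;> linarith [h1.1, h1.2]
  have hB : ∀ p ∈ G, dens U (B p) ≤ 6 * C * ∫⁻ x in Ioo p.1 p.2, H x := by
    intro p hp
    obtain ⟨-, h2, -⟩ := hF p (hGF hp)
    have h3 := hU.dens_mul_volume_le (a := (p.1 + p.2) / 2 - 6 * ((p.2 - p.1) / 2))
      (b := (p.1 + p.2) / 2 + 6 * ((p.2 - p.1) / 2)) (by linarith)
      (measurableSet_Ioo (a := p.1) (b := p.2)) (Ioo_subset_Ioo (by linarith) (by linarith))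
    have h4 : (p.1 + p.2) / 2 + 6 * ((p.2 - p.1) / 2) - ((p.1 + p.2) / 2 - 6 * ((p.2 - p.1) / 2))
        = 6 * (p.2 - p.1) := by ring
    rw [h4, Real.volume_Ioo, ENNReal.ofReal_mul (by norm_num)] at h3
    have hpos : ENNReal.ofReal (p.2 - p.1) ≠ 0 := by simpa using h2
    refine le_trans ?_ (mul_le_mul_right (hH p (hGF hp)) (6 * C : ℝ≥0∞))
    refine (ENNReal.mul_le_mul_iff_right hpos ENNReal.ofReal_ne_top).1 ?_
    calc _ = _ := mul_comm _ _
      _ ≤ _ := h3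
      _ = _ := by simp; ring
  calc dens U (⋃ p ∈ F, Ioo p.1 p.2) ≤ dens U (⋃ p ∈ G, B p) := measure_mono hcov'
    _ ≤ ∑' p : G, dens U (B p) := measure_biUnion_le _ hcount _
    _ ≤ ∑' p : G, 6 * C * ∫⁻ x in Ioo p.1.1 p.1.2, H x := ENNReal.tsum_le_tsum fun p => hB p p.2
    _ = 6 * C * ∑' p : G, ∫⁻ x in Ioo p.1.1 p.1.2, H x := ENNReal.tsum_mul_left
    _ = 6 * C * ∫⁻ x in ⋃ p ∈ G, Ioo p.1 p.2, H x := by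
      rw [lintegral_biUnion hcount (fun _ _ => measurableSet_Ioo) hdis']
    _ ≤ _ := by
      gcongr
      exact iUnion₂_subset fun p hp => Ioo_subset_Ioo (hF p (hGF hp)).1 (hF p (hGF hp)).2.2

/-- Weak type `(1, 1)` of the maximal operator. -/
lemma mul_volume_lev_le (α β : ℝ) (g : ℝ → ℝ≥0∞) {s : ℝ≥0∞} (hs : s ≠ 0) (hs' : s ≠ ∞) :
    s * volume (lev α β g s) ≤ 6 * ∫⁻ x in Ioo α β, g x := by
  have h := isA1_one.dens_biUnion_le (α := α) (β := β) (F := {p : ℝ × ℝ | α ≤ p.1 ∧ p.1 < p.2 ∧ p.2 ≤ β ∧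
    s * ENNReal.ofReal (p.2 - p.1) < ∫⁻ x in Ioo p.1 p.2, g x}) (fun x => s⁻¹ * g x)
    (fun p hp => ⟨hp.1, hp.2.1, hp.2.2.1⟩) (fun p hp => by
      rw [lintegral_const_mul' _ _ (ENNReal.inv_ne_top.2 hs), dens_one, Real.volume_Ioo]
      exact le_inv_mul_of_mul_le_of_ne hs hs' hp.2.2.2.le)
  rw [lintegral_const_mul' _ _ (ENNReal.inv_ne_top.2 hs), dens_one] at h
  calc s * volume (lev α β g s) ≤ s * (6 * (1 : ℝ≥0) * (s⁻¹ * ∫⁻ x in Ioo α β, g x)) := by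
        gcongr; exact h
    _ = (s * s⁻¹) * (6 * ∫⁻ x in Ioo α β, g x) := by simp; ring
    _ = _ := by rw [ENNReal.mul_inv_cancel hs hs', one_mul]

/-- The mean of a function over a component of a level set tested against an `A₁` weight. -/
lemma IsA1.mul_dens_comp_le {C : ℝ≥0} {U : ℝ → ℝ≥0∞} (hU : IsA1 C U) {α β : ℝ}
    {f : ℝ → ℝ≥0∞} {s : ℝ≥0∞} (hs : s ≠ 0) (hs' : s ≠ ∞) {p : ℝ × ℝ}
    (hp : p ∈ comps (lev α β f s)) :
    s * dens U (Ioo p.1 p.2) ≤ 6 * C ^ 2 * ∫⁻ x in Ioo p.1 p.2, f x * U x := by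
  set F : Set (ℝ × ℝ) := {q : ℝ × ℝ | p.1 ≤ q.1 ∧ q.1 < q.2 ∧ q.2 ≤ p.2 ∧
    s * ENNReal.ofReal (q.2 - q.1) < ∫⁻ x in Ioo q.1 q.2, f x} with hF
  have hcov : Ioo p.1 p.2 ⊆ ⋃ q ∈ F, Ioo q.1 q.2 := fun x hx =>
    lev_inter_comp_subset le_rfl hp ⟨hp.2.1 hx, hx⟩
  have hc : (C * s⁻¹ : ℝ≥0∞) ≠ ∞ := ENNReal.mul_ne_top (by simp) (ENNReal.inv_ne_top.2 hs)
  have h := hU.dens_biUnion_le (α := p.1) (β := p.2) (F := F) (fun x => C * s⁻¹ * (f x * U x))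
    (fun p hp => ⟨hp.1, hp.2.1, hp.2.2.1⟩) (fun q hq => by
      obtain ⟨-, hq1, -, hq2⟩ := hq
      rw [lintegral_const_mul' _ _ hc, mul_comm (C : ℝ≥0∞), mul_assoc]
      refine le_inv_mul_of_mul_le_of_ne hs hs' ?_
      have hpos : ENNReal.ofReal (q.2 - q.1) ≠ 0 := by simpa using hq1
      refine (ENNReal.mul_le_mul_iff_right hpos ENNReal.ofReal_ne_top).1 ?_
      calc _ = dens U (Ioo q.1 q.2) * (s * ENNReal.ofReal (q.2 - q.1)) := by ring
        _ ≤ dens U (Ioo q.1 q.2) * ∫⁻ x in Ioo q.1 q.2, f x := by gcongr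
        _ ≤ _ := hU.lintegral_mul_le hq1 f
        _ = _ := by ring)
  rw [lintegral_const_mul' _ _ hc] at h
  calc s * dens U (Ioo p.1 p.2) ≤ s * (6 * C * (C * s⁻¹ * ∫⁻ x in Ioo p.1 p.2, f x * U x)) := by
        gcongr; exact (measure_mono hcov).trans h
    _ = (s * s⁻¹) * (6 * C ^ 2 * ∫⁻ x in Ioo p.1 p.2, f x * U x) := by ring
    _ = _ := by rw [ENNReal.mul_inv_cancel hs hs', one_mul]

/-- Passing to a sixteen times higher level contracts the mass of the level set of an `A₁`
weight. -/
lemma IsA1.dens_lev_le {C : ℝ≥0} {U : ℝ → ℝ≥0∞} (hU : IsA1 C U) {a b : ℝ} {t : ℝ≥0∞}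
    (h0 : t ≠ 0) (ht : t ≠ ∞) (hm : dens U (Ioo a b) ≤ t * ENNReal.ofReal (b - a)) :
    dens U (lev a b U (16 * t)) ≤ contr C * dens U (lev a b U t) := by
  have hle : t ≤ 16 * t := le_mul_of_one_le_left (by simp) (by norm_num)
  have hsub : lev a b U t ∩ lev a b U (16 * t) = lev a b U (16 * t) :=
    inter_eq_right.2 (lev_anti hle)
  have h0' : 16 * t ≠ 0 := mul_ne_zero (by norm_num) h0
  have ht' : 16 * t ≠ ∞ := ENNReal.mul_ne_top (by norm_num) ht
  have hD := measure_inter_eq_tsum_comps (isOpen_lev a b U t) (lev_subset a b U t) (dens U)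
    MeasurableSet.univ
  simp only [inter_univ] at hD
  rw [← hsub, measure_inter_eq_tsum_comps (isOpen_lev a b U t) (lev_subset a b U t) (dens U)
    (isOpen_lev _ _ _ _).measurableSet, hD, ← ENNReal.tsum_mul_left]
  refine ENNReal.tsum_le_tsum ?_
  rintro ⟨p, hp⟩
  have hmean : ∫⁻ x in Ioo p.1 p.2, U x ≤ t * ENNReal.ofReal (p.2 - p.1) := by
    by_cases hne : p = (a, b)
    · rw [hne, ← dens_set U measurableSet_Ioo]; exact hm
    · exact lintegral_comp_lev_le ht hp hne
  refine hU.dens_inter_le hp.1 (isOpen_lev _ _ _ _).measurableSet ?_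
  have hw := mul_volume_lev_le p.1 p.2 U h0' ht'
  have hsub2 : volume (Ioo p.1 p.2 ∩ lev a b U (16 * t)) ≤ volume (lev p.1 p.2 U (16 * t)) := by
    rw [inter_comm]; exact measure_mono (lev_inter_comp_subset hle hp)
  refine (ENNReal.mul_le_mul_iff_right h0' ht').1 ?_
  calc 16 * t * (2 * volume (Ioo p.1 p.2 ∩ lev a b U (16 * t)))
      ≤ 16 * t * (2 * volume (lev p.1 p.2 U (16 * t))) := by gcongr
    _ = 2 * (16 * t * volume (lev p.1 p.2 U (16 * t))) := by ring
    _ ≤ 2 * (6 * (t * ENNReal.ofReal (p.2 - p.1))) := by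
        exact mul_le_mul_right (hw.trans (mul_le_mul_right hmean _)) _
    _ = 12 * (t * ENNReal.ofReal (p.2 - p.1)) := by ring
    _ ≤ 16 * (t * ENNReal.ofReal (p.2 - p.1)) := by gcongr; norm_num
    _ = _ := by ring

/-- Quantitative `A_∞` property of an `A₁` weight. -/
lemma IsA1.dens_inter_le_of_volume_le {C : ℝ≥0} {U : ℝ → ℝ≥0∞} (hU : IsA1 C U) {a b : ℝ}
    (hab : a < b) {E : Set ℝ} (hE : MeasurableSet E) {η : ℝ≥0∞}
    (h : volume (Ioo a b ∩ E) ≤ η * ENNReal.ofReal (b - a)) (j : ℕ) :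
    dens U (Ioo a b ∩ E) ≤ ((contr C : ℝ≥0∞) ^ j + 16 ^ j * η) * dens U (Ioo a b) := by
  have hpos : ENNReal.ofReal (b - a) ≠ 0 := by simpa using hab
  obtain ⟨s, hs0, hst, hsm⟩ : ∃ s : ℝ≥0∞, s ≠ 0 ∧ s ≠ ∞ ∧
      s * ENNReal.ofReal (b - a) = dens U (Ioo a b) :=
    ⟨dens U (Ioo a b) / ENNReal.ofReal (b - a),
      ENNReal.div_ne_zero.2 ⟨hU.dens_ne_zero hab, ENNReal.ofReal_ne_top⟩,
      ENNReal.div_ne_top (hU.dens_Ioo_ne_top a b) hpos,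
      ENNReal.div_mul_cancel hpos ENNReal.ofReal_ne_top⟩
  have hDj : ∀ j : ℕ, dens U (lev a b U (16 ^ j * s)) ≤
      (contr C : ℝ≥0∞) ^ j * dens U (Ioo a b) := by
    intro j
    induction j with
    | zero =>
      rw [pow_zero, pow_zero, one_mul, one_mul]
      exact measure_mono (lev_subset _ _ _ _)
    | succ j ih =>
      rw [pow_succ', mul_assoc, pow_succ', mul_assoc]
      refine (hU.dens_lev_le (mul_ne_zero (by simp) hs0) (ENNReal.mul_ne_top (by simp) hst)
        ?_).trans (by gcongr)
      rw [mul_assoc, hsm]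
      exact le_mul_of_one_le_left zero_le (one_le_pow₀ (by norm_num))
  have hDm : MeasurableSet (lev a b U (16 ^ j * s)) := (isOpen_lev _ _ _ _).measurableSet
  have hfin : ∫⁻ x in Ioo a b, U x ≠ ∞ := by
    rw [← dens_set U measurableSet_Ioo]; exact hU.dens_Ioo_ne_top a b
  have hrest : dens U ((Ioo a b ∩ E) \ lev a b U (16 ^ j * s)) ≤
      16 ^ j * s * volume (Ioo a b ∩ E) := by
    have hm := (measurableSet_Ioo (a := a) (b := b)).inter hE |>.diff hDm
    rw [dens_set U hm]
    calc ∫⁻ x in (Ioo a b ∩ E) \ lev a b U (16 ^ j * s), U x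
        ≤ ∫⁻ x in (Ioo a b ∩ E) \ lev a b U (16 ^ j * s), 16 ^ j * s := by
          refine lintegral_mono_ae ?_
          rw [ae_restrict_iff' hm]
          filter_upwards [ae_le_of_notMem_lev hU.measurable.aemeasurable hfin (16 ^ j * s)]
            with x hx hx2
          exact hx hx2.1.1 hx2.2
      _ = 16 ^ j * s * volume ((Ioo a b ∩ E) \ lev a b U (16 ^ j * s)) := by
          rw [setLIntegral_const]
      _ ≤ _ := by gcongr; exact sdiff_subset
  calc dens U (Ioo a b ∩ E) = dens U (Ioo a b ∩ E ∩ lev a b U (16 ^ j * s)) +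
        dens U ((Ioo a b ∩ E) \ lev a b U (16 ^ j * s)) :=
        (measure_inter_add_sdiff _ hDm).symm
    _ ≤ (contr C : ℝ≥0∞) ^ j * dens U (Ioo a b) + 16 ^ j * s * (η * ENNReal.ofReal (b - a)) :=
        add_le_add ((measure_mono inter_subset_right).trans (hDj j)) (hrest.trans (by gcongr))
    _ = (contr C : ℝ≥0∞) ^ j * dens U (Ioo a b) + 16 ^ j * η * (s * ENNReal.ofReal (b - a)) := by
        ring
    _ = _ := by rw [hsm]; ring

end

section

open scoped NNReal

/-- Integer powers of `256`. -/
def pz (n : ℤ) : ℝ≥0∞ := 256 ^ n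

lemma pz_add (m n : ℤ) : pz (m + n) = pz m * pz n :=
  ENNReal.zpow_add (by norm_num) (by norm_num) m n

lemma pz_ne_zero (n : ℤ) : pz n ≠ 0 := (ENNReal.zpow_pos (by norm_num) (by norm_num) n).ne'

lemma pz_ne_top (n : ℤ) : pz n ≠ ∞ := (ENNReal.zpow_lt_top (by norm_num) (by norm_num) n).ne

lemma pz_zero : pz 0 = 1 := zpow_zero _

lemma pz_mono {m n : ℤ} (h : m ≤ n) : pz m ≤ pz n := ENNReal.zpow_le_of_le (by norm_num) h

lemma pz_natCast (n : ℕ) : pz n = 256 ^ n := zpow_natCast _ _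

lemma pz_mul_pz_neg (n : ℤ) : pz n * pz (-n) = 1 := by
  rw [← pz_add, add_neg_cancel, pz_zero]

lemma exists_pz_mul {x y : ℝ≥0∞} (hx : x ≠ 0) (hx' : x ≠ ∞) (hy : y ≠ 0) (hy' : y ≠ ∞) :
    ∃ n, pz n * y < x ∧ x ≤ pz (n + 1) * y := by
  obtain ⟨n, h1, h2⟩ := ENNReal.exists_mem_Ioc_zpow (x := x / y) (y := 256)
    (ENNReal.div_ne_zero.2 ⟨hx, hy'⟩) (ENNReal.div_ne_top hx' hy) (by norm_num) (by norm_num)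
  exact ⟨n, (ENNReal.lt_div_iff_mul_lt (Or.inl hy) (Or.inl hy')).1 h1,
    (ENNReal.div_le_iff hy hy').1 h2⟩

/-- The set where `N / U` lies in `(256 ^ k, 256 ^ (k + 1)]`. -/
def strat (U N : ℝ → ℝ≥0∞) (k : ℤ) : Set ℝ :=
  {x | pz k * U x < N x} ∩ {x | N x ≤ pz (k + 1) * U x}

/-- The stratified set `⋃ k, strat k ∩ O (k + n)`. -/
def lay (U N : ℝ → ℝ≥0∞) (O : ℤ → Set ℝ) (n : ℤ) : Set ℝ := ⋃ k, strat U N k ∩ O (k + n)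

section

variable {Cu Cn : ℝ≥0} {U N : ℝ → ℝ≥0∞}

lemma measurableSet_strat (hU : Measurable U) (hN : Measurable N) (k : ℤ) :
    MeasurableSet (strat U N k) :=
  (measurableSet_lt (hU.const_mul _) hN).inter (measurableSet_le hN (hU.const_mul _))

lemma pairwise_disjoint_strat :
    Pairwise (Function.onFun Disjoint (strat U N)) := by
  have key : ∀ k l, k < l → Disjoint (strat U N k) (strat U N l) := by
    intro k l hkl
    refine Set.disjoint_left.2 fun x hx hy => ?_
    have h1 : N x ≤ pz l * U x := hx.2.trans (mul_le_mul_left (pz_mono (by omega)) _)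
    exact absurd hy.1 (not_lt.2 h1)
  intro k l hkl
  rcases lt_or_gt_of_ne hkl with h | h
  · exact key k l h
  · exact (key l k h).symm

lemma exists_mem_strat (hU : IsA1 Cu U) (hN : IsA1 Cn N) (x : ℝ) : ∃ k, x ∈ strat U N k :=
  exists_pz_mul (hN.ne_zero x) (hN.ne_top x) (hU.ne_zero x) (hU.ne_top x)

lemma dens_le_of_subset {c : ℝ≥0∞} {S : Set ℝ} (hS : MeasurableSet S) (hc : c ≠ ∞)
    (h : ∀ x ∈ S, N x ≤ c * U x) : dens N S ≤ c * dens U S := by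
  rw [IsA1.dens_set _ hS, IsA1.dens_set _ hS, ← lintegral_const_mul' _ _ hc]
  exact setLIntegral_mono' hS h

lemma measure_lay (hU : IsA1 Cu U) (hN : IsA1 Cn N) (ν : Measure ℝ) {O : ℤ → Set ℝ}
    (hO : ∀ k, IsOpen (O k)) (n : ℤ) : ν (lay U N O n) = ∑' k, ν (strat U N k ∩ O (k + n)) :=
  measure_iUnion (fun _ _ hij => (pairwise_disjoint_strat hij).mono inter_subset_left
    inter_subset_left) fun k => (measurableSet_strat hU.measurable hN.measurable k).inter
      (hO _).measurableSet

lemma measurableSet_lay (hU : IsA1 Cu U) (hN : IsA1 Cn N) {O : ℤ → Set ℝ}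
    (hO : ∀ k, IsOpen (O k)) (n : ℤ) : MeasurableSet (lay U N O n) :=
  .iUnion fun k => (measurableSet_strat hU.measurable hN.measurable k).inter (hO _).measurableSet

/-- Most of the `N`-mass of an interval sits where `N / U` is comparable to its mean. -/
lemma dens_le_sum_strat (hU : IsA1 Cu U) (hN : IsA1 Cn N) {c d : ℝ} (hcd : c < d) {m : ℤ}
    {a : ℕ} (ha1 : 4 * (Cn : ℝ≥0∞) ≤ pz a) (ha2 : 2 * (Cu : ℝ≥0∞) ≤ pz a)
    (h1 : pz m * dens U (Ioo c d) ≤ dens N (Ioo c d))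
    (h2 : dens N (Ioo c d) ≤ pz (m + 1) * dens U (Ioo c d)) :
    dens N (Ioo c d) ≤ 4 * Cn * ∑ j ∈ Finset.Icc (-a : ℤ) a,
      dens N (Ioo c d ∩ strat U N (m + j)) := by
  set J := Ioo c d
  have hJm : MeasurableSet J := measurableSet_Ioo
  set Hi : Set ℝ := {x | pz (m + a + 1) * U x < N x} with hHi
  have hHim : MeasurableSet Hi := measurableSet_lt (hU.measurable.const_mul _) hN.measurable
  set Lw : Set ℝ := {x | N x ≤ pz (m - a) * U x} with hLw
  have hLwm : MeasurableSet Lw := measurableSet_le hN.measurable (hU.measurable.const_mul _)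
  have hu0 : dens U J ≠ 0 := hU.dens_ne_zero hcd
  have hut : dens U J ≠ ∞ := hU.dens_Ioo_ne_top c d
  have hnt : dens N J ≠ ∞ := hN.dens_Ioo_ne_top c d
  have hhi : pz a * dens U (J ∩ Hi) ≤ dens U J := by
    refine (ENNReal.mul_le_mul_iff_right (pz_ne_zero (m + 1)) (pz_ne_top (m + 1))).1 ?_
    rw [← mul_assoc, ← pz_add]
    calc pz (m + 1 + a) * dens U (J ∩ Hi) ≤ dens N (J ∩ Hi) := by
          rw [IsA1.dens_set _ (hJm.inter hHim), IsA1.dens_set _ (hJm.inter hHim),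
            ← lintegral_const_mul' _ _ (pz_ne_top _)]
          refine setLIntegral_mono' (hJm.inter hHim) fun x hx => ?_
          have h4 : pz (m + a + 1) * U x < N x := hx.2
          have h4 := h4.le
          rwa [show m + 1 + (a : ℤ) = m + a + 1 by ring]
      _ ≤ dens N J := measure_mono inter_subset_left
      _ ≤ _ := h2
  have hvol : 2 * volume (J ∩ Hi) ≤ ENNReal.ofReal (d - c) := by
    have h3 := hU.dens_mul_volume_le hcd (hJm.inter hHim) inter_subset_left
    have hC0 : (Cu : ℝ≥0∞) ≠ 0 := by
      have := one_pos.trans_le hU.one_le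
      simpa using this.ne'
    refine (ENNReal.mul_le_mul_iff_right (mul_ne_zero hC0 hu0)
      (ENNReal.mul_ne_top (by simp) hut)).1 ?_
    calc Cu * dens U J * (2 * volume (J ∩ Hi)) = 2 * Cu * (dens U J * volume (J ∩ Hi)) := by ring
      _ ≤ pz a * (Cu * ENNReal.ofReal (d - c) * dens U (J ∩ Hi)) := by gcongr
      _ = Cu * ENNReal.ofReal (d - c) * (pz a * dens U (J ∩ Hi)) := by ring
      _ ≤ Cu * ENNReal.ofReal (d - c) * dens U J := by gcongr
      _ = _ := by ring
  have hkey := hN.dens_le_diff hcd hHim hvol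
  have hlow : pz a * dens N (J ∩ Lw) ≤ dens N J := by
    refine le_trans ?_ h1
    calc pz a * dens N (J ∩ Lw) ≤ pz a * (pz (m - a) * dens U (J ∩ Lw)) := by
          gcongr
          exact dens_le_of_subset (hJm.inter hLwm) (pz_ne_top _) fun x hx => hx.2
      _ = pz m * dens U (J ∩ Lw) := by rw [← mul_assoc, ← pz_add]; congr 2; ring
      _ ≤ _ := by gcongr; exact inter_subset_left
  set S := ∑ j ∈ Finset.Icc (-a : ℤ) a, dens N (J ∩ strat U N (m + j))
  have hcover : dens N (J \ Hi) ≤ dens N (J ∩ Lw) + S := by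
    have hsub : J \ Hi ⊆ (J ∩ Lw) ∪ ⋃ j ∈ Finset.Icc (-a : ℤ) a, J ∩ strat U N (m + j) := by
      rintro x ⟨hxJ, hxH⟩
      by_cases hxL : x ∈ Lw
      · exact Or.inl ⟨hxJ, hxL⟩
      right
      obtain ⟨k, hk⟩ := exists_mem_strat hU hN x
      have hk1 : k ≤ m + a := by
        by_contra! h
        refine hxH (show pz (m + a + 1) * U x < N x from lt_of_le_of_lt ?_ hk.1)
        exact mul_le_mul_left (pz_mono (by omega)) _
      have hk2 : m - a ≤ k := by
        by_contra! h
        refine hxL (show N x ≤ pz (m - a) * U x from hk.2.trans ?_)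
        exact mul_le_mul_left (pz_mono (by omega)) _
      refine mem_iUnion₂.2 ⟨k - m, Finset.mem_Icc.2 ⟨by omega, by omega⟩, hxJ, ?_⟩
      rwa [add_sub_cancel]
    refine (measure_mono hsub).trans ((measure_union_le _ _).trans ?_)
    gcongr
    exact measure_biUnion_finset_le _ _
  have hfin : dens N J + dens N J ≤ dens N J + 4 * Cn * S := by
    calc dens N J + dens N J ≤ 2 * Cn * dens N (J \ Hi) + 2 * Cn * dens N (J \ Hi) := by gcongr
      _ = 4 * Cn * dens N (J \ Hi) := by ring
      _ ≤ 4 * Cn * (dens N (J ∩ Lw) + S) := by gcongr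
      _ = 4 * Cn * dens N (J ∩ Lw) + 4 * Cn * S := by ring
      _ ≤ pz a * dens N (J ∩ Lw) + 4 * Cn * S := by gcongr
      _ ≤ _ := by gcongr
  exact (ENNReal.add_le_add_iff_left hnt).1 hfin

/-- The `A_∞` gain used below. -/
def gain (Cu Cn : ℝ≥0) (n : ℕ) : ℝ≥0∞ :=
  (contr Cu : ℝ≥0∞) ^ n + 16 ^ n * (Cn * pz (1 - n))

/-- Where `N / U` is much smaller than its mean there is little `N`-mass. -/
lemma dens_inter_strat_le (hU : IsA1 Cu U) (hN : IsA1 Cn N) {c d : ℝ} (hcd : c < d) {k : ℤ}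
    (n : ℕ) (h1 : pz (k + n) * dens U (Ioo c d) ≤ dens N (Ioo c d)) :
    dens N (Ioo c d ∩ strat U N k) ≤ pz (1 - n) * gain Cu Cn n * dens N (Ioo c d) := by
  set J := Ioo c d
  have hJm : MeasurableSet J := measurableSet_Ioo
  have hEm := measurableSet_strat hU.measurable hN.measurable k
  have hn0 : dens N J ≠ 0 := hN.dens_ne_zero hcd
  have hnt : dens N J ≠ ∞ := hN.dens_Ioo_ne_top c d
  have h2 : dens N (J ∩ strat U N k) ≤ pz (k + 1) * dens U (J ∩ strat U N k) :=
    dens_le_of_subset (hJm.inter hEm) (pz_ne_top _) fun x hx => hx.2.2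
  have h3 : pz (k + 1) * dens U J ≤ pz (1 - n) * dens N J := by
    calc pz (k + 1) * dens U J = pz (1 - n) * (pz (k + n) * dens U J) := by
          rw [← mul_assoc, ← pz_add]; congr 2; ring
      _ ≤ _ := by gcongr
  have hvol : volume (J ∩ strat U N k) ≤ Cn * pz (1 - n) * ENNReal.ofReal (d - c) := by
    refine (ENNReal.mul_le_mul_iff_right hn0 hnt).1 ?_
    calc dens N J * volume (J ∩ strat U N k)
        ≤ Cn * ENNReal.ofReal (d - c) * dens N (J ∩ strat U N k) :=
          hN.dens_mul_volume_le hcd (hJm.inter hEm) inter_subset_left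
      _ ≤ Cn * ENNReal.ofReal (d - c) * (pz (k + 1) * dens U J) := by
          gcongr; exact h2.trans (by gcongr; exact inter_subset_left)
      _ ≤ Cn * ENNReal.ofReal (d - c) * (pz (1 - n) * dens N J) := by gcongr
      _ = _ := by ring
  calc dens N (J ∩ strat U N k) ≤ pz (k + 1) * dens U (J ∩ strat U N k) := h2
    _ ≤ pz (k + 1) * (gain Cu Cn n * dens U J) := by
        gcongr; exact hU.dens_inter_le_of_volume_le hcd hEm hvol n
    _ = gain Cu Cn n * (pz (k + 1) * dens U J) := by ring
    _ ≤ gain Cu Cn n * (pz (1 - n) * dens N J) := by gcongr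
    _ = _ := by ring

lemma tsum_pz_neg_ne_top : ∑' n : ℕ, pz (-((n : ℤ) + 1)) ≠ ∞ := by
  have h : ∀ n : ℕ, pz (-((n : ℤ) + 1)) ≤ (256⁻¹ : ℝ≥0∞) ^ n := fun n => by
    rw [← ENNReal.inv_pow, ← zpow_natCast, ← ENNReal.zpow_neg]
    exact pz_mono (by omega)
  refine ne_top_of_le_ne_top ?_ (ENNReal.tsum_le_tsum h)
  rw [ENNReal.tsum_geometric]
  exact ENNReal.inv_ne_top.2 (tsub_pos_of_lt (ENNReal.inv_lt_one.2 (by norm_num))).ne'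

lemma tsum_gain_ne_top (hCu : 1 ≤ Cu) : ∑' n, gain Cu Cn n ≠ ∞ := by
  have h : ∀ n : ℕ, (16 : ℝ≥0∞) ^ n * (Cn * pz (1 - n)) = Cn * pz 1 * (16 * 256⁻¹) ^ n := by
    intro n
    rw [sub_eq_add_neg, pz_add, mul_pow, ← ENNReal.inv_pow]
    rw [pz, pz, ENNReal.zpow_neg, zpow_natCast]
    ring
  simp only [gain, h]
  rw [ENNReal.tsum_add, ENNReal.tsum_mul_left, ENNReal.tsum_geometric, ENNReal.tsum_geometric]
  have h1 : (contr Cu : ℝ≥0∞) < 1 := by exact_mod_cast contr_lt_one hCu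
  have h2 : (16 * 256⁻¹ : ℝ≥0∞) < 1 := by
    rw [← div_eq_mul_inv]
    exact ENNReal.div_lt_of_lt_mul (by norm_num)
  refine ENNReal.add_ne_top.2 ⟨?_, ENNReal.mul_ne_top (ENNReal.mul_ne_top (by simp)
    (pz_ne_top 1)) ?_⟩
  · exact ENNReal.inv_ne_top.2 (tsub_pos_of_lt h1).ne'
  · exact ENNReal.inv_ne_top.2 (tsub_pos_of_lt h2).ne'

/-- The weights used in the summation over the strata. -/
def theta (Cu Cn : ℝ≥0) (L : ℕ) (ω : ℝ≥0∞) (n : ℤ) : ℝ≥0∞ :=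
  if n < L then ω else pz (1 - n) * gain Cu Cn n.toNat

lemma tsum_theta (Cu Cn : ℝ≥0) (L : ℕ) (ω : ℝ≥0∞) :
    ∑' n, theta Cu Cn L ω n * pz n =
      pz 1 * (∑' i, gain Cu Cn (i + L)) + ω * pz L * ∑' n : ℕ, pz (-((n : ℤ) + 1)) := by
  rw [← (Equiv.addRight (L : ℤ)).tsum_eq, tsum_of_nat_of_neg_add_one ENNReal.summable
    ENNReal.summable, ← ENNReal.tsum_mul_left, ← ENNReal.tsum_mul_left]
  congr 1
  · congr 1 with i
    change theta Cu Cn L ω (i + L) * pz (i + L) = _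
    rw [theta, if_neg (by omega), show ((i : ℤ) + L).toNat = i + L by omega, mul_right_comm, ← pz_add]
    congr 2; ring
  · congr 1 with i
    change theta Cu Cn L ω (-(i + 1) + L) * pz (-(i + 1) + L) = _
    rw [theta, if_pos (by omega), mul_assoc, ← pz_add]
    congr 2

lemma exists_theta (hCu : 1 ≤ Cu) {M : ℝ≥0∞} (hM : M ≠ ∞) :
    ∃ (L : ℕ) (ω : ℝ≥0∞), 0 < ω ∧ M * ∑' n, theta Cu Cn L ω n * pz n ≤ 2⁻¹ := by
  have h1 := ENNReal.Tendsto.const_mul (ENNReal.tendsto_sum_nat_add _ (tsum_gain_ne_top (Cn := Cn) hCu))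
    (Or.inr (ENNReal.mul_ne_top hM (pz_ne_top 1)))
  rw [mul_zero] at h1
  obtain ⟨L, hL⟩ := (h1.eventually_le_const (show (0 : ℝ≥0∞) < 4⁻¹ by simp)).exists
  set G := M * (pz L * ∑' n : ℕ, pz (-((n : ℤ) + 1)))
  have hG : G ≠ ∞ := ENNReal.mul_ne_top hM (ENNReal.mul_ne_top (pz_ne_top _) tsum_pz_neg_ne_top)
  refine ⟨L, 4⁻¹ * (G + 1)⁻¹, ?_, ?_⟩
  · refine ENNReal.mul_pos (by simp) (ENNReal.inv_ne_zero.2 (by simp [hG]))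
  · rw [tsum_theta, mul_add]
    have h4 : (4⁻¹ : ℝ≥0∞) + 4⁻¹ = 2⁻¹ := by
      rw [← two_mul, show (4 : ℝ≥0∞) = 2 * 2 by norm_num, ENNReal.mul_inv (by simp) (by simp),
        ← mul_assoc, ENNReal.mul_inv_cancel (by simp) (by simp), one_mul]
    rw [← h4]
    refine add_le_add ?_ ?_
    · rw [← mul_assoc]; exact hL
    · calc M * (4⁻¹ * (G + 1)⁻¹ * pz L * ∑' n : ℕ, pz (-((n : ℤ) + 1)))
          = 4⁻¹ * ((G + 1)⁻¹ * G) := by simp only [G]; ring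
        _ ≤ 4⁻¹ * ((G + 1)⁻¹ * (G + 1)) := by gcongr; exact le_self_add
        _ ≤ 4⁻¹ * 1 := by gcongr; exact ENNReal.inv_mul_le_one _
        _ = 4⁻¹ := mul_one _

lemma dens_lay_zero_le (hU : IsA1 Cu U) (hN : IsA1 Cn N) {a L : ℕ} {ω : ℝ≥0∞}
    (ha1 : 4 * (Cn : ℝ≥0∞) ≤ pz a) (ha2 : 2 * (Cu : ℝ≥0∞) ≤ pz a)
    {α β : ℝ} {O : ℤ → Set ℝ} {Z : Set ℝ} (hO : ∀ k, IsOpen (O k)) (hOs : ∀ k, O k ⊆ Ioo α β)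
    (hanti : Antitone O) (hZ : MeasurableSet Z)
    (hyp : ∀ k, ∀ p ∈ comps (O k), dens N (Ioo p.1 p.2) ≤ pz (k + L + 1) * dens U (Ioo p.1 p.2) →
      dens N (Ioo p.1 p.2 ∩ ((strat U N (k + 1) ∩ O (k + 1)) \ Z)) ≤ ω * dens N (Ioo p.1 p.2))
    {K : ℝ≥0∞} (hK : ∀ n, pz n * dens N (lay U N O n) ≤ K) :
    dens N (lay U N O 0) ≤ dens N Z +
      4 * Cn * ((Finset.Icc (-a : ℤ) a).card * pz (a + 1)) *
        (∑' n, theta Cu Cn L ω n * pz n) * K := by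
  have hE := measurableSet_strat hU.measurable hN.measurable
  have hSm : ∀ k, MeasurableSet ((strat U N k ∩ O k) \ Z) :=
    fun k => ((hE k).inter (hO k).measurableSet).diff hZ
  have step : ∀ k, ∀ p ∈ comps (O (k - 1)),
      dens N (Ioo p.1 p.2 ∩ ((strat U N k ∩ O k) \ Z)) ≤
        ∑' n, theta Cu Cn L ω n * (4 * Cn * ∑ j ∈ Finset.Icc (-a : ℤ) a,
          dens N (Ioo p.1 p.2 ∩ strat U N (k + n + j))) := by
    intro k p hp
    have hcd := hp.1
    obtain ⟨m, hm1, hm2⟩ := exists_pz_mul (hN.dens_ne_zero hcd) (hN.dens_Ioo_ne_top p.1 p.2)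
      (hU.dens_ne_zero hcd) (hU.dens_Ioo_ne_top p.1 p.2)
    refine le_trans ?_ (ENNReal.le_tsum (m - k))
    have hG := dens_le_sum_strat hU hN hcd ha1 ha2 hm1.le hm2
    rw [show k + (m - k) = m by ring]
    refine le_trans ?_ (mul_le_mul_right hG _)
    rw [theta]
    split_ifs with hL
    · have := hyp (k - 1) p hp (hm2.trans (mul_le_mul_left (pz_mono (by omega)) _))
      rwa [sub_add_cancel] at this
    · obtain ⟨n, hn⟩ := Int.eq_ofNat_of_zero_le (show 0 ≤ m - k by omega)
      rw [hn, Int.toNat_natCast]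
      refine le_trans (measure_mono (inter_subset_inter_right _ fun x hx => hx.1.1))
        (dens_inter_strat_le hU hN hcd n ?_)
      rw [← hn, show k + (m - k) = m by ring]
      exact hm1.le
  have hcomp : ∀ k, dens N ((strat U N k ∩ O k) \ Z) ≤
      ∑' n, theta Cu Cn L ω n * (4 * Cn * ∑ j ∈ Finset.Icc (-a : ℤ) a,
          dens N (O (k - 1) ∩ strat U N (k + n + j))) := by
    intro k
    have hsub : (strat U N k ∩ O k) \ Z = O (k - 1) ∩ ((strat U N k ∩ O k) \ Z) :=
      (inter_eq_right.2 fun x hx => hanti (show k - 1 ≤ k by omega) hx.1.2).symm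
    rw [hsub, measure_inter_eq_tsum_comps (hO _) (hOs _) _ (hSm k)]
    refine (ENNReal.tsum_le_tsum fun p : comps (O (k - 1)) => step k p.1 p.2).trans ?_
    rw [ENNReal.tsum_comm]
    refine ENNReal.tsum_le_tsum fun n => ?_
    rw [ENNReal.tsum_mul_left, ENNReal.tsum_mul_left, Summable.tsum_finsetSum fun _ _ =>
      ENNReal.summable]
    refine mul_le_mul_right (mul_le_mul_right (Finset.sum_le_sum fun j _ => ?_) _) _
    rw [measure_inter_eq_tsum_comps (hO _) (hOs _) _ (hE _)]
  have hsumk : ∀ n, ∀ j ∈ Finset.Icc (-a : ℤ) a,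
      ∑' k, dens N (O (k - 1) ∩ strat U N (k + n + j)) ≤ pz n * pz (a + 1) * K := by
    intro n j hj
    have h1 : ∑' k, dens N (O (k - 1) ∩ strat U N (k + n + j)) =
        dens N (lay U N O (-1 - n - j)) := by
      rw [measure_lay hU hN _ hO, ← (Equiv.addRight (n + j)).tsum_eq
        (fun k => dens N (strat U N k ∩ O (k + (-1 - n - j))))]
      congr 1 with k
      simp only [Equiv.coe_addRight]
      rw [inter_comm, add_assoc, show k + (n + j) + (-1 - n - j) = k - 1 by ring]
    rw [h1]
    have h2 : dens N (lay U N O (-1 - n - j)) =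
        pz (1 + n + j) * (pz (-1 - n - j) * dens N (lay U N O (-1 - n - j))) := by
      rw [← mul_assoc, ← pz_add, show 1 + n + j + (-1 - n - j) = 0 by ring, pz_zero, one_mul]
    rw [h2, ← pz_add]
    refine mul_le_mul' (pz_mono ?_) (hK _)
    have := (Finset.mem_Icc.1 hj).2
    omega
  calc dens N (lay U N O 0) ≤ dens N (Z ∪ ⋃ k, (strat U N k ∩ O k) \ Z) := by
        refine measure_mono fun x hx => ?_
        by_cases hxZ : x ∈ Z
        · exact Or.inl hxZ
        · obtain ⟨k, hk⟩ := mem_iUnion.1 hx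
          rw [add_zero] at hk
          exact Or.inr (mem_iUnion.2 ⟨k, hk, hxZ⟩)
    _ ≤ dens N Z + ∑' k, dens N ((strat U N k ∩ O k) \ Z) :=
        (measure_union_le _ _).trans (add_le_add le_rfl (measure_iUnion_le _))
    _ ≤ dens N Z + ∑' k, ∑' n, theta Cu Cn L ω n * (4 * Cn * ∑ j ∈ Finset.Icc (-a : ℤ) a,
          dens N (O (k - 1) ∩ strat U N (k + n + j))) := by
        gcongr; exact hcomp _
    _ = dens N Z + ∑' n, theta Cu Cn L ω n * (4 * Cn * ∑ j ∈ Finset.Icc (-a : ℤ) a,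
          ∑' k, dens N (O (k - 1) ∩ strat U N (k + n + j))) := by
        rw [ENNReal.tsum_comm]
        congr 2 with n
        rw [ENNReal.tsum_mul_left, ENNReal.tsum_mul_left, Summable.tsum_finsetSum fun _ _ =>
          ENNReal.summable]
    _ ≤ dens N Z + ∑' n, theta Cu Cn L ω n * (4 * Cn * ∑ j ∈ Finset.Icc (-a : ℤ) a,
          pz n * pz (a + 1) * K) := by
        gcongr with n j hj
        exact hsumk n j hj
    _ = dens N Z + ∑' n, 4 * Cn * ((Finset.Icc (-a : ℤ) a).card * pz (a + 1)) * K *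
          (theta Cu Cn L ω n * pz n) := by
        congr 2 with n
        rw [Finset.sum_const, nsmul_eq_mul]
        ring
    _ = _ := by rw [ENNReal.tsum_mul_left]; ring

lemma exists_natCast_le_pz {c : ℝ≥0∞} (hc : c ≠ ∞) : ∃ a : ℕ, c ≤ pz a := by
  obtain ⟨n, hn⟩ := ENNReal.exists_nat_gt hc
  refine ⟨n, hn.le.trans ?_⟩
  rw [pz_natCast]
  exact_mod_cast (Nat.lt_pow_self (by norm_num : 1 < 256)).le

/-- The stratified covering argument: a bound for the stratified level sets follows from a bound
for exceptional sets `Z n`, outside of which every component on which the mean of `N / U` is not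
large satisfies a good-`λ` inequality. -/
theorem exists_stratified_good_lambda (hCu : 1 ≤ Cu) (Cn : ℝ≥0) :
    ∃ (L : ℕ) (ω : ℝ≥0∞), 0 < ω ∧ ∀ (U N : ℝ → ℝ≥0∞), IsA1 Cu U → IsA1 Cn N →
      ∀ (α β : ℝ) (O Z : ℤ → Set ℝ) (k₀ : ℤ), (∀ k, IsOpen (O k)) → (∀ k, O k ⊆ Ioo α β) →
      Antitone O → (∀ k, k₀ ≤ k → O k = ∅) → (∀ n, MeasurableSet (Z n)) →
      (∀ n k, ∀ p ∈ comps (O (k + n)),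
        dens N (Ioo p.1 p.2) ≤ pz (k + L + 1) * dens U (Ioo p.1 p.2) →
        dens N (Ioo p.1 p.2 ∩ ((strat U N (k + 1) ∩ O (k + 1 + n)) \ Z n)) ≤
          ω * dens N (Ioo p.1 p.2)) →
      ∀ B, (∀ n, pz n * dens N (Z n) ≤ B) → ∀ n, pz n * dens N (lay U N O n) ≤ 2 * B := by
  obtain ⟨a₁, ha₁⟩ := exists_natCast_le_pz (c := 4 * (Cn : ℝ≥0∞))
    (ENNReal.mul_ne_top (by simp) (by simp))
  obtain ⟨a₂, ha₂⟩ := exists_natCast_le_pz (c := 2 * (Cu : ℝ≥0∞))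
    (ENNReal.mul_ne_top (by simp) (by simp))
  set a := max a₁ a₂
  have ha1 : 4 * (Cn : ℝ≥0∞) ≤ pz a :=
    ha₁.trans (pz_mono (by exact_mod_cast le_max_left a₁ a₂))
  have ha2 : 2 * (Cu : ℝ≥0∞) ≤ pz a :=
    ha₂.trans (pz_mono (by exact_mod_cast le_max_right a₁ a₂))
  obtain ⟨L, ω, hω, hLω⟩ := exists_theta (Cn := Cn) hCu
    (M := 4 * Cn * ((Finset.Icc (-a : ℤ) a).card * pz (a + 1)))
    (ENNReal.mul_ne_top (ENNReal.mul_ne_top (by simp) (by simp))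
      (ENNReal.mul_ne_top (by simp) (pz_ne_top _)))
  refine ⟨L, ω, hω, ?_⟩
  intro U N hU hN α β O Z k₀ hO hOs hanti hk₀ hZ hyp B hB
  set K : ℝ≥0∞ := ⨆ n, pz n * dens N (lay U N O n)
  have hE := measurableSet_strat hU.measurable hN.measurable
  have hKt : K ≠ ∞ := by
    refine ne_top_of_le_ne_top (b := pz k₀ * dens U (Ioo α β))
      (ENNReal.mul_ne_top (pz_ne_top _) (hU.dens_Ioo_ne_top _ _)) (iSup_le fun n => ?_)
    rw [measure_lay hU hN _ hO, ← ENNReal.tsum_mul_left]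
    have h1 : ∀ k, pz n * dens N (strat U N k ∩ O (k + n)) ≤
        pz k₀ * dens U (Ioo α β ∩ strat U N k) := by
      intro k
      rcases le_or_gt k₀ (k + n) with h | h
      · simp [hk₀ _ h]
      · have h2 := dens_le_of_subset (U := U) (N := N) ((hE k).inter (hO (k + n)).measurableSet)
          (pz_ne_top (k + 1)) fun x hx => hx.1.2
        calc pz n * dens N (strat U N k ∩ O (k + n))
            ≤ pz n * (pz (k + 1) * dens U (strat U N k ∩ O (k + n))) := by gcongr
          _ = pz (n + (k + 1)) * dens U (strat U N k ∩ O (k + n)) := by rw [← mul_assoc, ← pz_add]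
          _ ≤ _ := by
            refine mul_le_mul' (pz_mono (by omega)) (measure_mono fun x hx => ⟨hOs _ hx.2, hx.1⟩)
    refine (ENNReal.tsum_le_tsum h1).trans ?_
    rw [ENNReal.tsum_mul_left]
    gcongr
    rw [← measure_iUnion (fun _ _ hij => (pairwise_disjoint_strat hij).mono
      inter_subset_right inter_subset_right) fun k => measurableSet_Ioo.inter (hE k)]
    exact measure_mono (iUnion_subset fun k => inter_subset_left)
  have hmain : ∀ n, pz n * dens N (lay U N O n) ≤ B + 2⁻¹ * K := by
    intro n
    have hlay : ∀ m, lay U N (fun k => O (k + n)) m = lay U N O (m + n) := fun m => by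
      simp only [lay, add_assoc]
    have h := dens_lay_zero_le hU hN ha1 ha2 (O := fun k => O (k + n)) (Z := Z n) (L := L) (ω := ω)
      (fun k => hO _) (fun k => hOs _) (fun i j hij => hanti (by omega)) (hZ n) (hyp n)
      (K := pz (-n) * K) (fun m => by
        rw [hlay]
        calc pz m * dens N (lay U N O (m + n))
            = pz (-n) * (pz (m + n) * dens N (lay U N O (m + n))) := by
              rw [← mul_assoc, ← pz_add]; congr 2; ring
          _ ≤ _ := by
            gcongr; exact le_iSup (fun n => pz n * dens N (lay U N O n)) (m + n))
    rw [hlay, zero_add] at h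
    calc pz n * dens N (lay U N O n) ≤ pz n * (dens N (Z n) + 2⁻¹ * (pz (-n) * K)) := by
          gcongr; exact h.trans (by gcongr)
      _ = pz n * dens N (Z n) + 2⁻¹ * (pz n * pz (-n)) * K := by ring
      _ ≤ _ := by rw [pz_mul_pz_neg, mul_one]; gcongr; exact hB n
  have hK2 : K ≤ 2 * B := by
    have h1 : K ≤ B + 2⁻¹ * K := iSup_le hmain
    have h2 : 2⁻¹ * K + 2⁻¹ * K = K := by rw [← add_mul, ENNReal.inv_two_add_inv_two, one_mul]
    have h3 : 2⁻¹ * K ≤ B := by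
      have h4 : 2⁻¹ * K ≠ ∞ := ENNReal.mul_ne_top (by simp) hKt
      refine (ENNReal.add_le_add_iff_right h4).1 ?_
      rwa [h2]
    rw [← h2, two_mul]
    exact add_le_add h3 h3
  exact fun n => (le_iSup (fun n => pz n * dens N (lay U N O n)) n).trans hK2

end

end

section

open scoped NNReal

/-- Mixed weak type inequality for the maximal operator, in stratified form. -/
theorem exists_lay_maximal_le {Cu : ℝ≥0} (hCu : 1 ≤ Cu) (Cn : ℝ≥0) :
    ∃ C : ℝ≥0∞, C ≠ ∞ ∧ ∀ (U N f : ℝ → ℝ≥0∞), IsA1 Cu U → IsA1 Cn N → ∀ (α β : ℝ) (k₀ : ℤ),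
      (∀ x, f x ≤ pz k₀) → ∀ n, pz n * dens N (lay U N (fun k => lev α β f (pz k)) n) ≤
        C * ∫⁻ x in Ioo α β, f x * U x := by
  obtain ⟨L, ω, -, h⟩ := exists_stratified_good_lambda hCu Cn
  set c : ℝ≥0∞ := pz (L + 1) * (6 * Cu ^ 2) with hc
  have hct : c ≠ ∞ := ENNReal.mul_ne_top (pz_ne_top _) (ENNReal.mul_ne_top (by simp) (by simp))
  refine ⟨2 * (6 * Cn * c), ENNReal.mul_ne_top (by simp) (ENNReal.mul_ne_top
    (ENNReal.mul_ne_top (by simp) (by simp)) hct), ?_⟩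
  intro U N f hU hN α β k₀ hf
  set F : ℤ → Set (ℝ × ℝ) := fun n => {p | ∃ k, p ∈ comps (lev α β f (pz (k + n))) ∧
    dens N (Ioo p.1 p.2) ≤ pz (k + L + 1) * dens U (Ioo p.1 p.2)} with hF
  have hbound : ∀ n, dens N (⋃ p ∈ F n, Ioo p.1 p.2) ≤
      6 * Cn * ∫⁻ x in Ioo α β, pz (-n) * c * (f x * U x) := by
    intro n
    refine hN.dens_biUnion_le _ ?_ ?_
    · rintro p ⟨k, hp, -⟩
      exact ⟨(endpoints_of_mem_comps_lev hp).1, hp.1, (endpoints_of_mem_comps_lev hp).2⟩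
    · rintro p ⟨k, hp, hpk⟩
      rw [lintegral_const_mul' _ _ (ENNReal.mul_ne_top (pz_ne_top _) hct)]
      have h1 := hU.mul_dens_comp_le (pz_ne_zero _) (pz_ne_top _) hp
      calc dens N (Ioo p.1 p.2) ≤ pz (k + L + 1) * dens U (Ioo p.1 p.2) := hpk
        _ = pz (L + 1 - n) * (pz (k + n) * dens U (Ioo p.1 p.2)) := by
          rw [← mul_assoc, ← pz_add]; congr 2; ring
        _ ≤ pz (L + 1 - n) * (6 * Cu ^ 2 * ∫⁻ x in Ioo p.1 p.2, f x * U x) := by gcongr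
        _ = _ := by rw [sub_eq_add_neg, pz_add, hc]; ring
  intro n
  refine (h U N hU hN α β (fun k => lev α β f (pz k)) (fun n => ⋃ p ∈ F n, Ioo p.1 p.2) k₀
    (fun k => isOpen_lev _ _ _ _) (fun k => lev_subset _ _ _ _)
    (fun i j hij => lev_anti (pz_mono hij))
    (fun k hk => lev_eq_empty fun x => (hf x).trans (pz_mono hk))
    (fun n => (isOpen_biUnion fun _ _ => isOpen_Ioo).measurableSet) ?_
    (6 * Cn * (c * ∫⁻ x in Ioo α β, f x * U x)) ?_ n).trans (le_of_eq (by ring))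
  · intro n k p hp hpk
    have : Ioo p.1 p.2 ∩ ((strat U N (k + 1) ∩ lev α β f (pz (k + 1 + n))) \
        ⋃ p ∈ F n, Ioo p.1 p.2) = ∅ :=
      eq_empty_of_forall_notMem fun x hx => hx.2.2 (mem_iUnion₂.2 ⟨p, ⟨k, hp, hpk⟩, hx.1⟩)
    rw [this, measure_empty]
    exact zero_le
  · intro n
    refine (mul_le_mul_right (hbound n) _).trans (le_of_eq ?_)
    rw [lintegral_const_mul' _ _ (ENNReal.mul_ne_top (pz_ne_top _) hct)]
    calc _ = (pz n * pz (-n)) * (6 * Cn * (c * ∫⁻ x in Ioo α β, f x * U x)) := by ring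
      _ = _ := by rw [pz_mul_pz_neg, one_mul]

end

section

open scoped NNReal

/-- The kernel `∫_0^∞ e^{-εt} e^{2πizt} dt = (ε - 2πiz)⁻¹`. -/
def cauchyK (ε z : ℝ) : ℂ := ((ε : ℂ) - 2 * Real.pi * z * Complex.I)⁻¹

lemma sub_mul_I_ne_zero {ε : ℝ} (hε : 0 < ε) (z : ℝ) :
    (ε : ℂ) - 2 * Real.pi * z * Complex.I ≠ 0 := by
  intro h
  have := congrArg Complex.re h
  simp at this
  exact hε.ne' this

lemma continuous_cauchyK {ε : ℝ} (hε : 0 < ε) : Continuous (cauchyK ε) :=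
  Continuous.inv₀ (by fun_prop) (sub_mul_I_ne_zero hε)

lemma norm_cauchyK_sq (ε z : ℝ) :
    ‖cauchyK ε z‖ ^ 2 = (ε ^ 2 + (2 * Real.pi * z) ^ 2)⁻¹ := by
  rw [cauchyK, norm_inv, inv_pow, ← Complex.normSq_eq_norm_sq, Complex.normSq_apply]
  simp
  ring

lemma norm_cauchyK_le {ε : ℝ} (hε : 0 < ε) (z : ℝ) : ‖cauchyK ε z‖ ≤ ε⁻¹ := by
  refine le_of_sq_le_sq ?_ (by positivity)
  rw [norm_cauchyK_sq, inv_pow]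
  gcongr
  nlinarith [sq_nonneg (2 * Real.pi * z)]

lemma norm_cauchyK_le_abs (ε : ℝ) {z : ℝ} (hz : z ≠ 0) :
    ‖cauchyK ε z‖ ≤ (2 * Real.pi * |z|)⁻¹ := by
  have := Real.pi_pos
  refine le_of_sq_le_sq ?_ (by positivity)
  rw [norm_cauchyK_sq, inv_pow, mul_pow _ |z|, sq_abs, ← mul_pow]
  have : 0 < (2 * Real.pi * z) ^ 2 := by positivity
  gcongr
  nlinarith [sq_nonneg ε]

lemma norm_cauchyK_anti {ε ε' : ℝ} (hε : 0 < ε) (h : ε ≤ ε') (z : ℝ) :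
    ‖cauchyK ε' z‖ ≤ ‖cauchyK ε z‖ := by
  refine le_of_sq_le_sq ?_ (norm_nonneg _)
  rw [norm_cauchyK_sq, norm_cauchyK_sq]
  gcongr

lemma norm_cauchyK_sub_le {ε : ℝ} (hε : 0 < ε) {z z' : ℝ} (hz : z ≠ 0) (hz' : z' ≠ 0) :
    ‖cauchyK ε z - cauchyK ε z'‖ ≤ |z - z'| / (|z| * |z'|) := by
  have h1 : cauchyK ε z - cauchyK ε z' =
      cauchyK ε z * cauchyK ε z' * (2 * Real.pi * (z - z' : ℝ) * Complex.I) := by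
    simp only [cauchyK]
    rw [inv_sub_inv (sub_mul_I_ne_zero hε z) (sub_mul_I_ne_zero hε z'), div_eq_mul_inv, mul_inv]
    push_cast
    ring
  have hpi := Real.pi_gt_three
  have hz1 : 0 < |z| := abs_pos.2 hz
  have hz2 : 0 < |z'| := abs_pos.2 hz'
  rw [h1, norm_mul, norm_mul]
  have h2 : ‖(2 * Real.pi * (z - z' : ℝ) * Complex.I : ℂ)‖ = 2 * Real.pi * |z - z'| := by
    rw [norm_mul, norm_mul, norm_mul, Complex.norm_real, Complex.norm_real, Complex.norm_I]
    simp [abs_of_pos Real.pi_pos]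
  rw [h2]
  calc ‖cauchyK ε z‖ * ‖cauchyK ε z'‖ * (2 * Real.pi * |z - z'|)
      ≤ (2 * Real.pi * |z|)⁻¹ * (2 * Real.pi * |z'|)⁻¹ * (2 * Real.pi * |z - z'|) := by
        gcongr
        · exact norm_cauchyK_le_abs ε hz
        · exact norm_cauchyK_le_abs ε hz'
    _ = (2 * Real.pi)⁻¹ * (|z - z'| / (|z| * |z'|)) := by field_simp
    _ ≤ 1 * (|z - z'| / (|z| * |z'|)) := by
        gcongr
        exact inv_le_one_of_one_le₀ (by linarith)
    _ = _ := one_mul _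

lemma integrable_norm_cauchyK_sq {ε : ℝ} (hε : 0 < ε) :
    Integrable fun z => ‖cauchyK ε z‖ ^ 2 := by
  have h := (integrable_inv_one_add_sq.comp_mul_left' (R := 2 * Real.pi / ε)
    (by have := Real.pi_pos; positivity)).const_mul ((ε ^ 2)⁻¹)
  refine h.congr (ae_of_all _ fun z => ?_)
  simp only [norm_cauchyK_sq]
  rw [← mul_inv]
  congr 1
  field_simp

lemma integrable_conj_mul_cauchyK {ε : ℝ} (hε : 0 < ε) (y y' : ℝ) :
    Integrable fun x => (starRingEnd ℂ) (cauchyK ε (x - y)) * cauchyK ε (x - y') := by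
  have h := ((integrable_norm_cauchyK_sq hε).comp_sub_right y).add
    ((integrable_norm_cauchyK_sq hε).comp_sub_right y')
  have hc := continuous_cauchyK hε
  refine h.mono' (by fun_prop) (ae_of_all _ fun x => ?_)
  rw [norm_mul, RCLike.norm_conj]
  simp only [Pi.add_apply]
  nlinarith [sq_nonneg (‖cauchyK ε (x - y)‖ - ‖cauchyK ε (x - y')‖),
    sq_nonneg (‖cauchyK ε (x - y)‖), sq_nonneg (‖cauchyK ε (x - y')‖)]

lemma conj_cauchyK (ε z : ℝ) : (starRingEnd ℂ) (cauchyK ε z) = cauchyK ε (-z) := by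
  simp [cauchyK, map_inv₀, Complex.conj_ofNat]

lemma tendsto_log_sub_log (ε y y' : ℝ) {l : Filter ℝ} (σ : ℝ) (hσ : σ = 1 ∨ σ = -1)
    (hl : ∀ᶠ x in l, 0 < σ * x) (hl' : Tendsto (fun x : ℝ => (σ * x)⁻¹) l (nhds 0)) (hε : 0 < ε) :
    Tendsto (fun x : ℝ => Complex.log ((ε : ℂ) - 2 * Real.pi * (y - x) * Complex.I) -
      Complex.log ((ε : ℂ) - 2 * Real.pi * (x - y') * Complex.I)) l
      (nhds (σ * Real.pi * Complex.I)) := by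
  have hpi := Real.pi_pos
  have hσ2 : σ * σ = 1 := by rcases hσ with rfl | rfl <;> norm_num
  have key : ∀ w : ℝ, ∀ τ : ℝ, (τ = 1 ∨ τ = -1) →
      Tendsto (fun x : ℝ => Complex.log (((σ * x)⁻¹ : ℝ) * (ε + 2 * Real.pi * w * τ * Complex.I) +
        2 * Real.pi * (σ * τ) * Complex.I)) l (nhds (Complex.log (2 * Real.pi * (σ * τ) * Complex.I))) := by
    intro w τ hτ
    have h1 : Tendsto (fun x : ℝ => (((σ * x)⁻¹ : ℝ) : ℂ) * (ε + 2 * Real.pi * w * τ * Complex.I) +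
        2 * Real.pi * (σ * τ) * Complex.I) l (nhds (((0 : ℝ) : ℂ) * (ε + 2 * Real.pi * w * τ * Complex.I) +
        2 * Real.pi * (σ * τ) * Complex.I)) :=
      ((Complex.continuous_ofReal.tendsto _ |>.comp hl').mul_const _).add_const _
    rw [Complex.ofReal_zero, zero_mul, zero_add] at h1
    refine (continuousAt_clog ?_).tendsto.comp h1
    right
    rcases hσ with rfl | rfl <;> rcases hτ with rfl | rfl <;> simp [hpi.ne']
  have h2 := (key (-y) 1 (Or.inl rfl)).sub (key (-y') (-1) (Or.inr rfl))
  have h3 : Complex.log (2 * Real.pi * (σ * (1 : ℝ)) * Complex.I) -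
      Complex.log (2 * Real.pi * (σ * (-1 : ℝ)) * Complex.I) = σ * Real.pi * Complex.I := by
    have e1 : Complex.log (2 * Real.pi * Complex.I) =
        Real.log (2 * Real.pi) + Real.pi / 2 * Complex.I := by
      have := Complex.log_ofReal_mul (r := 2 * Real.pi) (by positivity) Complex.I_ne_zero
      rw [Complex.log_I] at this
      rw [← this]; push_cast; ring_nf
    have e2 : Complex.log (2 * Real.pi * (-Complex.I)) =
        Real.log (2 * Real.pi) - Real.pi / 2 * Complex.I := by
      have := Complex.log_ofReal_mul (r := 2 * Real.pi) (by positivity)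
        (neg_ne_zero.2 Complex.I_ne_zero)
      rw [Complex.log_neg_I] at this
      push_cast at this
      rw [this]; ring
    rcases hσ with rfl | rfl
    · have a1 : (2 * Real.pi * ((1 : ℝ) * (1 : ℝ)) * Complex.I : ℂ) = 2 * Real.pi * Complex.I := by
        push_cast; ring
      have a2 : (2 * Real.pi * ((1 : ℝ) * (-1 : ℝ)) * Complex.I : ℂ) =
        2 * Real.pi * (-Complex.I) := by push_cast; ring
      rw [a1, a2, e1, e2]; push_cast; ring
    · have a1 : (2 * Real.pi * ((-1 : ℝ) * (1 : ℝ)) * Complex.I : ℂ) =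
        2 * Real.pi * (-Complex.I) := by push_cast; ring
      have a2 : (2 * Real.pi * ((-1 : ℝ) * (-1 : ℝ)) * Complex.I : ℂ) =
        2 * Real.pi * Complex.I := by push_cast; ring
      rw [a1, a2, e1, e2]; push_cast; ring
  rw [h3] at h2
  refine h2.congr' ?_
  filter_upwards [hl] with x hx
  have hmul : ∀ A : ℂ, A.re ≠ 0 → Complex.log A =
      Real.log (σ * x) + Complex.log (((σ * x)⁻¹ : ℝ) * A) := by
    intro A hA
    rw [Complex.log_ofReal_mul (inv_pos.2 hx) (fun h => hA (by simp [h])), Real.log_inv]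
    push_cast; ring
  have hx0 : (x : ℂ) ≠ 0 := by
    intro h
    rw [Complex.ofReal_eq_zero] at h
    simp [h] at hx
  have hσ0 : (σ : ℂ) ≠ 0 := by
    rcases hσ with rfl | rfl <;> simp
  rw [hmul ((ε : ℂ) - 2 * Real.pi * (y - x) * Complex.I) (by simp [hε.ne']),
    hmul ((ε : ℂ) - 2 * Real.pi * (x - y') * Complex.I) (by simp [hε.ne'])]
  have hσC : (σ : ℂ) * σ = 1 := by exact_mod_cast hσ2
  have hinv : (((σ * x)⁻¹ : ℝ) : ℂ) * x = σ := by
    push_cast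
    field_simp
    rw [sq]; exact hσC.symm
  rw [add_sub_add_left_eq_sub]
  congr 2
  · push_cast at hinv ⊢
    linear_combination (-2 * Real.pi * Complex.I) * hinv
  · push_cast at hinv ⊢
    linear_combination (2 * Real.pi * Complex.I) * hinv

/-- The composition law for the kernels. -/
lemma integral_conj_mul_cauchyK {ε : ℝ} (hε : 0 < ε) (y y' : ℝ) :
    ∫ x, (starRingEnd ℂ) (cauchyK ε (x - y)) * cauchyK ε (x - y') = cauchyK (2 * ε) (y - y') := by
  have hpi := Real.pi_pos
  have hpiC : (Real.pi : ℂ) ≠ 0 := by exact_mod_cast hpi.ne'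
  set A : ℝ → ℂ := fun x => cauchyK (2 * ε) (y - y') * ((2 * Real.pi * Complex.I)⁻¹ *
    (Complex.log ((ε : ℂ) - 2 * Real.pi * (y - x) * Complex.I) -
      Complex.log ((ε : ℂ) - 2 * Real.pi * (x - y') * Complex.I)))
  have hderiv : ∀ x, HasDerivAt A
      ((starRingEnd ℂ) (cauchyK ε (x - y)) * cauchyK ε (x - y')) x := by
    intro x
    have hs1 : (ε : ℂ) - 2 * Real.pi * (y - x) * Complex.I ∈ Complex.slitPlane := by
      left; simpa using hε
    have hs2 : (ε : ℂ) - 2 * Real.pi * (x - y') * Complex.I ∈ Complex.slitPlane := by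
      left; simpa using hε
    have hx : HasDerivAt (fun x : ℝ => (x : ℂ)) 1 x := Complex.ofRealCLM.hasDerivAt
    have d1 := ((((hx.const_sub (y : ℂ)).const_mul (2 * Real.pi : ℂ)).mul_const
      Complex.I).const_sub (ε : ℂ)).clog_real hs1
    have d2 := ((((hx.sub_const (y' : ℂ)).const_mul (2 * Real.pi : ℂ)).mul_const
      Complex.I).const_sub (ε : ℂ)).clog_real hs2
    have d := ((d1.sub d2).const_mul (2 * Real.pi * Complex.I)⁻¹).const_mul
      (cauchyK (2 * ε) (y - y'))
    refine d.congr_deriv ?_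
    have n1 := sub_mul_I_ne_zero hε (y - x)
    have n2 := sub_mul_I_ne_zero hε (x - y')
    have n3 := sub_mul_I_ne_zero (mul_pos two_pos hε) (y - y')
    rw [conj_cauchyK, neg_sub]
    simp only [cauchyK]
    push_cast at n1 n2 n3 ⊢
    have hI := Complex.I_ne_zero
    have e : (2 * ε : ℂ) - 2 * Real.pi * (y - y') * Complex.I =
      (ε - 2 * Real.pi * (y - x) * Complex.I) + (ε - 2 * Real.pi * (x - y') * Complex.I) := by ring
    rw [e] at n3 ⊢
    generalize (ε : ℂ) - 2 * Real.pi * (y - x) * Complex.I = A1 at *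
    generalize (ε : ℂ) - 2 * Real.pi * (x - y') * Complex.I = A2 at *
    field_simp
    ring
  have hb := tendsto_log_sub_log ε y y' (l := atBot) (-1) (Or.inr rfl)
    (by filter_upwards [eventually_lt_atBot 0] with x hx; linarith)
    (by simpa using (tendsto_inv_atBot_zero (𝕜 := ℝ)).neg) hε
  have ht := tendsto_log_sub_log ε y y' (l := atTop) 1 (Or.inl rfl)
    (by filter_upwards [eventually_gt_atTop 0] with x hx; linarith)
    (by simpa using tendsto_inv_atTop_zero (𝕜 := ℝ)) hε
  rw [integral_of_hasDerivAt_of_tendsto hderiv (integrable_conj_mul_cauchyK hε y y')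
    ((hb.const_mul _).const_mul _) ((ht.const_mul _).const_mul _)]
  have hI := Complex.I_ne_zero
  push_cast
  field_simp
  ring

end

section

open scoped NNReal

variable {H : Type*} [NormedAddCommGroup H] [InnerProductSpace ℂ H]

/-- Convolution with the kernel `cauchyK ε`. -/
def cauchyT (ε : ℝ) (F : ℝ → H) (x : ℝ) : H := ∫ y, cauchyK ε (x - y) • F y

lemma integrable_cauchyK_smul {ε : ℝ} (hε : 0 < ε) {F : ℝ → H} (hF : Integrable F) (x : ℝ) :
    Integrable fun y => cauchyK ε (x - y) • F y :=
  hF.bdd_smul ε⁻¹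
    ((continuous_cauchyK hε).comp (continuous_const.sub continuous_id)).aestronglyMeasurable
    (ae_of_all _ fun _ => norm_cauchyK_le hε _)

lemma norm_cauchyT_le {ε : ℝ} (hε : 0 < ε) {F : ℝ → H} (hF : Integrable F) (x : ℝ) :
    ‖cauchyT ε F x‖ ≤ ε⁻¹ * ∫ y, ‖F y‖ := by
  rw [← integral_const_mul]
  refine norm_integral_le_of_norm_le (hF.norm.const_mul _) (ae_of_all _ fun y => ?_)
  rw [norm_smul]
  gcongr
  exact norm_cauchyK_le hε _

lemma continuous_cauchyT {ε : ℝ} (hε : 0 < ε) {F : ℝ → H} (hF : Integrable F) :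
    Continuous (cauchyT ε F) := by
  have hc := continuous_cauchyK hε
  refine continuous_of_dominated (bound := fun y => ε⁻¹ * ‖F y‖) (fun x =>
    (integrable_cauchyK_smul hε hF x).aestronglyMeasurable) (fun x => ae_of_all _ fun y => ?_)
    (hF.norm.const_mul _) (ae_of_all _ fun y => ?_)
  · rw [norm_smul]
    gcongr
    exact norm_cauchyK_le hε _
  · fun_prop

lemma cauchyT_add {ε : ℝ} (hε : 0 < ε) {F G : ℝ → H} (hF : Integrable F) (hG : Integrable G)
    (x : ℝ) : cauchyT ε (fun y => F y + G y) x = cauchyT ε F x + cauchyT ε G x := by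
  simp only [cauchyT, smul_add]
  exact integral_add (integrable_cauchyK_smul hε hF x) (integrable_cauchyK_smul hε hG x)

/-- The integrand of the double integral that represents `∫ ‖cauchyT ε F x‖ ^ 2`. -/
def cauchyQ (ε : ℝ) (F : ℝ → H) (z : ℝ × ℝ × ℝ) : ℂ :=
  inner ℂ (cauchyK ε (z.1 - z.2.1) • F z.2.1) (cauchyK ε (z.1 - z.2.2) • F z.2.2)

lemma cauchyQ_eq (ε : ℝ) (F : ℝ → H) (x y y' : ℝ) : cauchyQ ε F (x, y, y') =
    ((starRingEnd ℂ) (cauchyK ε (x - y)) * cauchyK ε (x - y')) * inner ℂ (F y) (F y') := by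
  simp only [cauchyQ, inner_smul_left, inner_smul_right]
  ring

lemma integral_norm_cauchyQ_le {ε : ℝ} (hε : 0 < ε) (F : ℝ → H) (y y' : ℝ) :
    ∫ x, ‖cauchyQ ε F (x, y, y')‖ ≤ (∫ z, ‖cauchyK ε z‖ ^ 2) * (‖F y‖ * ‖F y'‖) := by
  have h1 := (integrable_norm_cauchyK_sq hε).comp_sub_right y
  have h2 := (integrable_norm_cauchyK_sq hε).comp_sub_right y'
  have h3 : ∫ x, (‖cauchyK ε (x - y)‖ ^ 2 + ‖cauchyK ε (x - y')‖ ^ 2) / 2 =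
      ∫ z, ‖cauchyK ε z‖ ^ 2 := by
    rw [integral_div, integral_add h1 h2, integral_sub_right_eq_self (fun x => ‖cauchyK ε x‖ ^ 2),
      integral_sub_right_eq_self (fun x => ‖cauchyK ε x‖ ^ 2)]
    ring
  rw [← h3, ← integral_mul_const]
  refine integral_mono_of_nonneg (ae_of_all _ fun _ => norm_nonneg _)
    (((h1.add h2).div_const 2).mul_const _) (ae_of_all _ fun x => ?_)
  simp only [cauchyQ_eq, norm_mul, RCLike.norm_conj]
  gcongr
  · nlinarith [sq_nonneg (‖cauchyK ε (x - y)‖ - ‖cauchyK ε (x - y')‖)]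
  · exact norm_inner_le_norm _ _

lemma integrable_cauchyQ {ε : ℝ} (hε : 0 < ε) {F : ℝ → H} (hF : Integrable F) :
    Integrable (cauchyQ ε F) (volume.prod (volume.prod volume)) := by
  have hc := continuous_cauchyK hε
  have hm : AEStronglyMeasurable (cauchyQ ε F) (volume.prod (volume.prod volume)) := by
    have e1 : AEStronglyMeasurable (fun z : ℝ × ℝ × ℝ => F z.2.1)
        (volume.prod (volume.prod volume)) := hF.1.comp_fst.comp_snd
    have e2 : AEStronglyMeasurable (fun z : ℝ × ℝ × ℝ => F z.2.2)
        (volume.prod (volume.prod volume)) :=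
      (hF.1.comp_snd (μ := (volume : Measure ℝ))).comp_snd (μ := (volume : Measure ℝ))
    have e3 : Continuous fun z : ℝ × ℝ × ℝ => cauchyK ε (z.1 - z.2.1) := by fun_prop
    have e4 : Continuous fun z : ℝ × ℝ × ℝ => cauchyK ε (z.1 - z.2.2) := by fun_prop
    exact (e3.aestronglyMeasurable.smul e1).inner (e4.aestronglyMeasurable.smul e2)
  rw [integrable_prod_iff' hm]
  constructor
  · refine ae_of_all _ fun y => ?_
    have : (fun x => cauchyQ ε F (x, y)) = fun x => ((starRingEnd ℂ) (cauchyK ε (x - y.1)) *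
        cauchyK ε (x - y.2)) * inner ℂ (F y.1) (F y.2) := funext fun x => cauchyQ_eq ε F x y.1 y.2
    rw [this]
    exact (integrable_conj_mul_cauchyK hε y.1 y.2).mul_const _
  · refine ((hF.norm.mul_prod hF.norm).const_mul (∫ z, ‖cauchyK ε z‖ ^ 2)).mono'
      hm.norm.prod_swap.integral_prod_right' (ae_of_all _ fun y => ?_)
    rw [Real.norm_of_nonneg (integral_nonneg fun _ => norm_nonneg _)]
    exact integral_norm_cauchyQ_le hε F y.1 y.2

variable [CompleteSpace H]

lemma integral_cauchyQ {ε : ℝ} (hε : 0 < ε) {F : ℝ → H} (hF : Integrable F) :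
    ∀ᵐ x, ∫ y, cauchyQ ε F (x, y) ∂(volume.prod volume) = ((‖cauchyT ε F x‖ ^ 2 : ℝ) : ℂ) := by
  filter_upwards [(integrable_cauchyQ hε hF).prod_right_ae] with x hx
  rw [integral_prod _ hx]
  simp only [cauchyQ]
  have hi := integrable_cauchyK_smul hε hF x
  have h1 : ∀ y, ∫ y', inner ℂ (cauchyK ε (x - y) • F y) (cauchyK ε (x - y') • F y') =
      inner ℂ (cauchyK ε (x - y) • F y) (cauchyT ε F x) := fun y => integral_inner hi _
  simp only [h1]
  have h2 : ∫ y, inner ℂ (cauchyK ε (x - y) • F y) (cauchyT ε F x) =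
      (starRingEnd ℂ) (∫ y, inner ℂ (cauchyT ε F x) (cauchyK ε (x - y) • F y)) := by
    rw [← integral_conj]
    simp only [inner_conj_symm]
  rw [h2, integral_inner hi, inner_conj_symm]
  change inner ℂ (cauchyT ε F x) (cauchyT ε F x) = _
  rw [inner_self_eq_norm_sq_to_K]
  push_cast
  rfl

lemma integrable_norm_cauchyT_sq {ε : ℝ} (hε : 0 < ε) {F : ℝ → H} (hF : Integrable F) :
    Integrable fun x => ‖cauchyT ε F x‖ ^ 2 := by
  have h := ((integrable_cauchyQ hε hF).integral_prod_left).congr (integral_cauchyQ hε hF)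
  exact h.re

lemma integral_norm_cauchyT_sq {ε : ℝ} (hε : 0 < ε) {F : ℝ → H} (hF : Integrable F) :
    ((∫ x, ‖cauchyT ε F x‖ ^ 2 : ℝ) : ℂ) =
      ∫ y, ∫ x, cauchyQ ε F (x, y) ∂volume ∂(volume.prod volume) := by
  rw [← integral_prod_symm _ (integrable_cauchyQ hε hF), integral_prod _ (integrable_cauchyQ hε hF),
    ← integral_complex_ofReal]
  exact integral_congr_ae ((integral_cauchyQ hε hF).mono fun x hx => hx.symm)

lemma integral_norm_cauchyT_sq_le {ε : ℝ} (hε : 0 < ε) {F : ℝ → H} (hF : Integrable F) :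
    ∫ x, ‖cauchyT ε F x‖ ^ 2 ≤ (∫ z, ‖cauchyK ε z‖ ^ 2) * (∫ y, ‖F y‖) ^ 2 := by
  have h0 : 0 ≤ ∫ x, ‖cauchyT ε F x‖ ^ 2 := integral_nonneg fun _ => by positivity
  rw [← Complex.norm_of_nonneg h0, integral_norm_cauchyT_sq hε hF, sq, ← integral_prod_mul,
    ← integral_const_mul]
  refine norm_integral_le_of_norm_le ((hF.norm.mul_prod hF.norm).const_mul _)
    (ae_of_all _ fun y => ?_)
  exact (norm_integral_le_integral_norm _).trans (integral_norm_cauchyQ_le hε F y.1 y.2)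

lemma integral_norm_cauchyT_sq_le_half {ε : ℝ} (hε : 0 < ε) {F : ℝ → H} (hF : Integrable F)
    (hF2 : Integrable fun y => ‖F y‖ ^ 2) :
    ∫ x, ‖cauchyT ε F x‖ ^ 2 ≤
      ((∫ x, ‖F x‖ ^ 2) + ∫ x, ‖cauchyT (2 * ε) F x‖ ^ 2) / 2 := by
  have hε2 : 0 < 2 * ε := by positivity
  have h0 : 0 ≤ ∫ x, ‖cauchyT ε F x‖ ^ 2 := integral_nonneg fun _ => by positivity
  have hT := integrable_norm_cauchyT_sq hε2 hF
  have h1 : ∀ y : ℝ × ℝ, ∫ x, cauchyQ ε F (x, y) =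
      inner ℂ (F y.1) (cauchyK (2 * ε) (y.1 - y.2) • F y.2) := by
    rintro ⟨y, y'⟩
    simp only [cauchyQ_eq]
    rw [integral_mul_const, integral_conj_mul_cauchyK hε, inner_smul_right]
  have h2 := integral_norm_cauchyT_sq hε hF
  have h3 := (integrable_cauchyQ hε hF).integral_prod_right
  rw [integral_prod _ h3] at h2
  have h4 : ∀ y, ∫ y', inner ℂ (F y) (cauchyK (2 * ε) (y - y') • F y') =
      inner ℂ (F y) (cauchyT (2 * ε) F y) :=
    fun y => integral_inner (integrable_cauchyK_smul hε2 hF y) _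
  have h2 := h2.trans (integral_congr_ae (ae_of_all _ fun y => (integral_congr_ae
    (ae_of_all _ fun y' => h1 (y, y'))).trans (h4 y)))
  rw [← integral_add hF2 hT, ← integral_div, ← Complex.norm_of_nonneg h0, h2]
  refine norm_integral_le_of_norm_le ((hF2.add hT).div_const 2) (ae_of_all _ fun y => ?_)
  refine (norm_inner_le_norm _ _).trans ?_
  change _ ≤ (‖F y‖ ^ 2 + ‖cauchyT (2 * ε) F y‖ ^ 2) / 2
  nlinarith [sq_nonneg (‖F y‖ - ‖cauchyT (2 * ε) F y‖)]

/-- The `L²` bound, uniform in `ε`. -/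
lemma integral_norm_cauchyT_sq_le_integral {ε : ℝ} (hε : 0 < ε) {F : ℝ → H} (hF : Integrable F)
    (hF2 : Integrable fun y => ‖F y‖ ^ 2) :
    ∫ x, ‖cauchyT ε F x‖ ^ 2 ≤ ∫ x, ‖F x‖ ^ 2 := by
  set B := ∫ x, ‖F x‖ ^ 2
  have hB : 0 ≤ B := integral_nonneg fun _ => by positivity
  set M := (∫ z, ‖cauchyK ε z‖ ^ 2) * (∫ y, ‖F y‖) ^ 2
  have h1 : ∀ (n : ℕ) (δ : ℝ), ε ≤ δ → ∫ x, ‖cauchyT δ F x‖ ^ 2 ≤ B + M * (1 / 2) ^ n := by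
    intro n
    induction n with
    | zero =>
      intro δ hδ
      have : ∫ z, ‖cauchyK δ z‖ ^ 2 ≤ ∫ z, ‖cauchyK ε z‖ ^ 2 :=
        integral_mono (integrable_norm_cauchyK_sq (hε.trans_le hδ))
          (integrable_norm_cauchyK_sq hε) fun z => by
            have := norm_cauchyK_anti hε hδ z
            simp only
            gcongr
      have h2 := integral_norm_cauchyT_sq_le (hε.trans_le hδ) hF
      have h3 : (∫ z, ‖cauchyK δ z‖ ^ 2) * (∫ y, ‖F y‖) ^ 2 ≤ M := by
        simp only [M]; gcongr
      simp only [pow_zero, mul_one]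
      linarith
    | succ n ih =>
      intro δ hδ
      have h2 := integral_norm_cauchyT_sq_le_half (hε.trans_le hδ) hF hF2
      have h3 := ih (2 * δ) (by linarith)
      rw [pow_succ]
      change _ ≤ (B + _) / 2 at h2
      linarith
  have h2 : Tendsto (fun n : ℕ => B + M * (1 / 2) ^ n) atTop (nhds (B + M * 0)) :=
    ((_root_.tendsto_pow_atTop_nhds_zero_of_lt_one (by norm_num) (by norm_num)).const_mul M).const_add B
  rw [mul_zero, add_zero] at h2
  exact ge_of_tendsto' h2 fun n => h1 n ε le_rfl

end

section

open scoped NNReal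

lemma norm_cauchyK_sub_le_of_le {ε : ℝ} (hε : 0 < ε) {z z' : ℝ} (hz' : z' ≠ 0)
    (h : 3 * |z - z'| ≤ |z'|) :
    ‖cauchyK ε z - cauchyK ε z'‖ ≤ 3 / 2 * |z - z'| / z' ^ 2 := by
  have h1 : 0 < |z'| := abs_pos.2 hz'
  have h2 : 2 / 3 * |z'| ≤ |z| := by
    have := abs_sub_abs_le_abs_sub z' z
    rw [abs_sub_comm] at this
    linarith
  have hz : 0 < |z| := by linarith
  refine (norm_cauchyK_sub_le hε (abs_pos.1 hz) hz').trans ?_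
  rw [← sq_abs z', div_le_div_iff₀ (by positivity) (by positivity)]
  have h3 := abs_nonneg (z - z')
  have : |z'| ^ 2 ≤ 3 / 2 * (|z| * |z'|) := by nlinarith
  calc |z - z'| * |z'| ^ 2 ≤ |z - z'| * (3 / 2 * (|z| * |z'|)) := by gcongr
    _ = _ := by ring

lemma lintegral_poisson (c : ℝ) {r : ℝ} (hr : 0 < r) :
    ∫⁻ x, ENNReal.ofReal (r / (r ^ 2 + (x - c) ^ 2)) = ENNReal.ofReal Real.pi := by
  rw [lintegral_sub_right_eq_self (fun x : ℝ => ENNReal.ofReal (r / (r ^ 2 + x ^ 2)))]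
  have h1 : ∀ x : ℝ, r / (r ^ 2 + x ^ 2) = r⁻¹ * (1 + (r⁻¹ * x) ^ 2)⁻¹ := by
    intro x
    field_simp
  simp only [h1]
  rw [← ofReal_integral_eq_lintegral_ofReal, integral_const_mul,
    Measure.integral_comp_mul_left (fun x : ℝ => (1 + x ^ 2)⁻¹), integral_univ_inv_one_add_sq]
  · rw [inv_inv, abs_of_pos hr, smul_eq_mul, ← mul_assoc, inv_mul_cancel₀ hr.ne', one_mul]
  · exact (integrable_inv_one_add_sq.comp_mul_left' (inv_ne_zero hr.ne')).const_mul _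
  · exact ae_of_all _ fun x => by positivity

/-- Hörmander's condition for the kernel. -/
lemma lintegral_cauchyK_sub_le {ε : ℝ} (hε : 0 < ε) {c r y : ℝ} (hr : 0 < r) (hy : |y - c| ≤ r) :
    ∫⁻ x in {x | 3 * r ≤ |x - c|}, ‖cauchyK ε (x - y) - cauchyK ε (x - c)‖ₑ ≤ 7 := by
  have hm : MeasurableSet {x : ℝ | 3 * r ≤ |x - c|} :=
    measurableSet_le measurable_const (by fun_prop)
  have hpt : ∀ x : ℝ, 3 * r ≤ |x - c| → ‖cauchyK ε (x - y) - cauchyK ε (x - c)‖ₑ ≤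
      ENNReal.ofReal 2 * ENNReal.ofReal (r / (r ^ 2 + (x - c) ^ 2)) := by
    intro x hx
    rw [← ofReal_norm, ← ENNReal.ofReal_mul (by norm_num)]
    refine ENNReal.ofReal_le_ofReal ?_
    have hxc : 0 < |x - c| := by linarith
    have e : x - y - (x - c) = -(y - c) := by ring
    refine (norm_cauchyK_sub_le_of_le hε (abs_pos.1 hxc) (by rw [e, abs_neg]; linarith)).trans ?_
    rw [e, abs_neg]
    have h2 : 9 * r ^ 2 ≤ (x - c) ^ 2 := by rw [← sq_abs (x - c)]; nlinarith
    have h3 : 0 < r ^ 2 := by positivity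
    have h4 : 0 < (x - c) ^ 2 := by linarith
    rw [← mul_div_assoc, div_le_div_iff₀ h4 (by positivity)]
    calc 3 / 2 * |y - c| * (r ^ 2 + (x - c) ^ 2) ≤ 3 / 2 * r * (r ^ 2 + (x - c) ^ 2) := by gcongr
      _ ≤ _ := by nlinarith
  calc _ ≤ ∫⁻ x in {x | 3 * r ≤ |x - c|},
        ENNReal.ofReal 2 * ENNReal.ofReal (r / (r ^ 2 + (x - c) ^ 2)) :=
      setLIntegral_mono' hm fun x hx => hpt x hx
    _ ≤ ∫⁻ x, ENNReal.ofReal 2 * ENNReal.ofReal (r / (r ^ 2 + (x - c) ^ 2)) :=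
      setLIntegral_le_lintegral _ _
    _ = ENNReal.ofReal (2 * Real.pi) := by
      rw [lintegral_const_mul' _ _ ENNReal.ofReal_ne_top, lintegral_poisson c hr,
        ← ENNReal.ofReal_mul (by norm_num)]
    _ ≤ ENNReal.ofReal 7 := ENNReal.ofReal_le_ofReal (by linarith [Real.pi_lt_d2])
    _ = 7 := by norm_num

variable {H : Type*} [NormedAddCommGroup H]

lemma lintegral_enorm_sq_eq {F : ℝ → H} (hF : Integrable fun y => ‖F y‖ ^ 2) :
    ∫⁻ y, ‖F y‖ₑ ^ 2 = ENNReal.ofReal (∫ y, ‖F y‖ ^ 2) := by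
  rw [ofReal_integral_eq_lintegral_ofReal hF (ae_of_all _ fun _ => by positivity)]
  refine lintegral_congr fun y => ?_
  rw [ENNReal.ofReal_pow (norm_nonneg _), ofReal_norm]

variable [InnerProductSpace ℂ H]

lemma lintegral_enorm_cauchyT_sq_le [CompleteSpace H] {ε : ℝ} (hε : 0 < ε) {F : ℝ → H}
    (hF : Integrable F) (hF2 : Integrable fun y => ‖F y‖ ^ 2) :
    ∫⁻ x, ‖cauchyT ε F x‖ₑ ^ 2 ≤ ∫⁻ x, ‖F x‖ₑ ^ 2 := by
  rw [lintegral_enorm_sq_eq hF2, lintegral_enorm_sq_eq (integrable_norm_cauchyT_sq hε hF)]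
  exact ENNReal.ofReal_le_ofReal (integral_norm_cauchyT_sq_le_integral hε hF hF2)

/-- Estimate for an atom away from its support. -/
lemma lintegral_atom_le [CompleteSpace H] {ε : ℝ} (hε : 0 < ε) {F : ℝ → H} (hF : Integrable F) {a b : ℝ}
    (hab : a < b) (h0 : ∫ y in Ioo a b, F y = 0) :
    ∫⁻ x in {x | 3 * ((b - a) / 2) ≤ |x - (a + b) / 2|},
      ‖∫ y in Ioo a b, cauchyK ε (x - y) • F y‖ₑ ≤ 7 * ∫⁻ y in Ioo a b, ‖F y‖ₑ := by
  set c := (a + b) / 2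
  set r := (b - a) / 2
  have hr : 0 < r := by simp only [r]; linarith
  have hc := continuous_cauchyK hε
  have hpt : ∀ x, ‖∫ y in Ioo a b, cauchyK ε (x - y) • F y‖ₑ ≤
      ∫⁻ y in Ioo a b, ‖cauchyK ε (x - y) - cauchyK ε (x - c)‖ₑ * ‖F y‖ₑ := by
    intro x
    have h1 : ∫ y in Ioo a b, cauchyK ε (x - y) • F y =
        ∫ y in Ioo a b, (cauchyK ε (x - y) - cauchyK ε (x - c)) • F y := by
      simp only [sub_smul]
      rw [integral_sub (integrable_cauchyK_smul hε hF x).integrableOn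
        (show Integrable (fun y => cauchyK ε (x - c) • F y) (volume.restrict (Ioo a b)) from
          hF.integrableOn.smul _), integral_smul, h0, smul_zero, sub_zero]
    rw [h1]
    refine (enorm_integral_le_lintegral_enorm _).trans (lintegral_mono fun y => ?_)
    rw [enorm_smul]
  calc _ ≤ ∫⁻ x in {x | 3 * r ≤ |x - c|},
        ∫⁻ y in Ioo a b, ‖cauchyK ε (x - y) - cauchyK ε (x - c)‖ₑ * ‖F y‖ₑ :=
      lintegral_mono hpt
    _ = ∫⁻ y in Ioo a b, ∫⁻ x in {x | 3 * r ≤ |x - c|},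
        ‖cauchyK ε (x - y) - cauchyK ε (x - c)‖ₑ * ‖F y‖ₑ := by
      have e1 : Continuous fun z : ℝ × ℝ => ‖cauchyK ε (z.1 - z.2) - cauchyK ε (z.1 - c)‖ₑ := by
        fun_prop
      exact lintegral_lintegral_swap (e1.aemeasurable.mul hF.1.restrict.enorm.comp_snd)
    _ ≤ ∫⁻ y in Ioo a b, 7 * ‖F y‖ₑ := by
      refine setLIntegral_mono' measurableSet_Ioo fun y hy => ?_
      have hm : Measurable fun x => ‖cauchyK ε (x - y) - cauchyK ε (x - c)‖ₑ :=
        (by fun_prop : Continuous fun x =>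
          ‖cauchyK ε (x - y) - cauchyK ε (x - c)‖ₑ).measurable
      rw [lintegral_mul_const _ hm]
      gcongr
      refine lintegral_cauchyK_sub_le hε hr (abs_le.2 ⟨?_, ?_⟩)
      · have := hy.1; simp only [r, c]; linarith
      · have := hy.2; simp only [r, c]; linarith
    _ = _ := lintegral_const_mul' _ _ (by norm_num)

open Classical in
/-- `F` with its values on the components of `O` replaced by the averages. -/
def avgOn (O : Set ℝ) (F : ℝ → H) (x : ℝ) : H :=
  if h : ∃ p ∈ comps O, x ∈ Ioo p.1 p.2 then ⨍ y in Ioo h.choose.1 h.choose.2, F y else F x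

lemma avgOn_of_mem {O : Set ℝ} (F : ℝ → H) {p : ℝ × ℝ} (hp : p ∈ comps O) {x : ℝ}
    (hx : x ∈ Ioo p.1 p.2) : avgOn O F x = ⨍ y in Ioo p.1 p.2, F y := by
  have h : ∃ p ∈ comps O, x ∈ Ioo p.1 p.2 := ⟨p, hp, hx⟩
  have e : h.choose = p := by
    by_contra hne
    exact Set.disjoint_left.1 (pairwiseDisjoint_comps O h.choose_spec.1 hp hne) h.choose_spec.2 hx
  rw [avgOn, dif_pos h, e]

lemma avgOn_of_notMem {O : Set ℝ} (F : ℝ → H) {x : ℝ} (hx : x ∉ O) : avgOn O F x = F x := by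
  rw [avgOn, dif_neg]
  rintro ⟨p, hp, hxp⟩
  exact hx (hp.2.1 hxp)

lemma enorm_setAverage_le (F : ℝ → H) {a b : ℝ} (hab : a < b) :
    ENNReal.ofReal (b - a) * ‖⨍ y in Ioo a b, F y‖ₑ ≤ ∫⁻ y in Ioo a b, ‖F y‖ₑ := by
  have h : 0 < b - a := sub_pos.2 hab
  rw [setAverage_eq, enorm_smul, measureReal_def, Real.volume_Ioo, ENNReal.toReal_ofReal h.le,
    Real.enorm_eq_ofReal (inv_nonneg.2 h.le), ENNReal.ofReal_inv_of_pos h, ← mul_assoc,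
    ENNReal.mul_inv_cancel (by simpa using hab) ENNReal.ofReal_ne_top, one_mul]
  exact enorm_integral_le_lintegral_enorm _

lemma setLIntegral_eq_tsum_comps {O : Set ℝ} (hO : IsOpen O) {α β : ℝ} (hb : O ⊆ Ioo α β)
    (g : ℝ → ℝ≥0∞) :
    ∫⁻ x in O, g x = ∑' p : comps O, ∫⁻ x in Ioo p.1.1 p.1.2, g x := by
  have h := lintegral_biUnion (μ := volume) (countable_comps O)
    (fun _ _ => measurableSet_Ioo) (pairwiseDisjoint_comps O) g
  rwa [iUnion_comps hO hb] at h

lemma aestronglyMeasurable_avgOn {O : Set ℝ} (hO : IsOpen O) {α β : ℝ} (hb : O ⊆ Ioo α β)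
    {F : ℝ → H} (hF : Integrable F) : AEStronglyMeasurable (avgOn O F) := by
  classical
  have h1 : ContinuousOn (avgOn O F) O := by
    intro x hx
    have hx' := hx
    rw [← iUnion_comps hO hb, mem_iUnion₂] at hx'
    obtain ⟨p, hp, hxp⟩ := hx'
    refine ContinuousAt.continuousWithinAt ?_
    refine (continuousAt_const (y := ⨍ y in Ioo p.1 p.2, F y)).congr ?_
    filter_upwards [isOpen_Ioo.mem_nhds hxp] with y hy
    exact (avgOn_of_mem F hp hy).symm
  have h2 := (h1.aestronglyMeasurable hO.measurableSet (μ := volume)).piecewise hO.measurableSet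
    (hF.1.restrict (s := Oᶜ))
  refine h2.congr (ae_of_all _ fun x => ?_)
  by_cases hx : x ∈ O
  · rw [Set.piecewise_eq_of_mem _ _ _ hx]
  · rw [Set.piecewise_eq_of_notMem _ _ _ hx, avgOn_of_notMem F hx]

lemma lintegral_avgOn_le {O : Set ℝ} (hO : IsOpen O) {α β : ℝ} (hb : O ⊆ Ioo α β)
    {F : ℝ → H} : ∫⁻ x, ‖avgOn O F x‖ₑ ≤ ∫⁻ x, ‖F x‖ₑ := by
  rw [← lintegral_add_compl _ hO.measurableSet, ← lintegral_add_compl (fun x => ‖F x‖ₑ)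
    hO.measurableSet]
  refine add_le_add ?_ ?_
  · rw [setLIntegral_eq_tsum_comps hO hb, setLIntegral_eq_tsum_comps hO hb]
    refine ENNReal.tsum_le_tsum fun p => ?_
    rw [setLIntegral_congr_fun (g := fun _ => ‖⨍ y in Ioo p.1.1 p.1.2, F y‖ₑ) measurableSet_Ioo
      fun x hx => by simp only [avgOn_of_mem F p.2 hx], setLIntegral_const, Real.volume_Ioo,
      mul_comm]
    exact enorm_setAverage_le F p.2.1
  · refine (setLIntegral_congr_fun hO.measurableSet.compl fun x hx => ?_).le
    simp only [avgOn_of_notMem F hx]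

lemma integrable_avgOn {O : Set ℝ} (hO : IsOpen O) {α β : ℝ} (hb : O ⊆ Ioo α β)
    {F : ℝ → H} (hF : Integrable F) : Integrable (avgOn O F) :=
  ⟨aestronglyMeasurable_avgOn hO hb hF, (lintegral_avgOn_le hO hb).trans_lt hF.2⟩

lemma setIntegral_sub_avgOn [CompleteSpace H] {O : Set ℝ} {F : ℝ → H} (hF : Integrable F)
    {p : ℝ × ℝ} (hp : p ∈ comps O) :
    ∫ y in Ioo p.1 p.2, (F y - avgOn O F y) = 0 := by
  have h : 0 < p.2 - p.1 := sub_pos.2 hp.1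
  rw [setIntegral_congr_fun (g := fun y => F y - ⨍ y in Ioo p.1 p.2, F y) measurableSet_Ioo
    fun x hx => by simp only [avgOn_of_mem F hp hx], integral_sub hF.integrableOn
    (integrableOn_const (by simp)), setIntegral_const, measureReal_def, setAverage_eq,
    measureReal_def, Real.volume_Ioo, ENNReal.toReal_ofReal h.le, smul_smul,
    mul_inv_cancel₀ h.ne', one_smul, sub_self]

end

section

open scoped NNReal

variable {H : Type*} [NormedAddCommGroup H] [InnerProductSpace ℂ H] [CompleteSpace H]

/-- Chebyshev's inequality combined with the `L²` bound. -/
lemma mul_volume_enorm_cauchyT_le_of_le {ε : ℝ} (hε : 0 < ε) {G : ℝ → H} (hG : Integrable G)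
    {s : ℝ≥0∞} (hs : s ≠ 0) (hs' : s ≠ ∞) (h : ∀ᵐ x, ‖G x‖ₑ ≤ s) :
    s * volume {x | s < ‖cauchyT ε G x‖ₑ} ≤ ∫⁻ x, ‖G x‖ₑ := by
  have h1 : ∫⁻ x, ‖G x‖ₑ ^ 2 ≤ s * ∫⁻ x, ‖G x‖ₑ := by
    rw [← lintegral_const_mul' _ _ hs']
    refine lintegral_mono_ae (h.mono fun x hx => ?_)
    rw [sq]
    gcongr
  have h2 : Integrable fun x => ‖G x‖ ^ 2 := by
    refine ⟨hG.1.norm.pow 2, lt_of_le_of_lt (lintegral_mono fun x => ?_)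
      (h1.trans_lt (ENNReal.mul_lt_top hs'.lt_top hG.2))⟩
    rw [enorm_pow, enorm_norm]
  refine (ENNReal.mul_le_mul_iff_right hs hs').1 ?_
  calc s * (s * volume {x | s < ‖cauchyT ε G x‖ₑ})
      = s ^ 2 * volume {x | s < ‖cauchyT ε G x‖ₑ} := by ring
    _ ≤ s ^ 2 * volume {x | s ^ 2 ≤ ‖cauchyT ε G x‖ₑ ^ 2} := by
      refine mul_le_mul_right (measure_mono fun x hx => ?_) _
      have hx' : s < ‖cauchyT ε G x‖ₑ := hx
      show s ^ 2 ≤ ‖cauchyT ε G x‖ₑ ^ 2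
      gcongr
    _ ≤ ∫⁻ x, ‖cauchyT ε G x‖ₑ ^ 2 := by
      refine mul_meas_ge_le_lintegral ?_ _
      exact (continuous_cauchyT hε hG).enorm.measurable.pow_const 2
    _ ≤ ∫⁻ x, ‖G x‖ₑ ^ 2 := lintegral_enorm_cauchyT_sq_le hε hG h2
    _ ≤ _ := h1

/-- The neighbourhood of an open set in which its components are tripled. -/
def triple (O : Set ℝ) : Set ℝ :=
  ⋃ p ∈ comps O, Ioo ((p.1 + p.2) / 2 - 3 * ((p.2 - p.1) / 2)) ((p.1 + p.2) / 2 + 3 * ((p.2 - p.1) / 2))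

lemma measurableSet_triple (O : Set ℝ) : MeasurableSet (triple O) :=
  (isOpen_biUnion fun _ _ => isOpen_Ioo).measurableSet

lemma volume_triple_le {O : Set ℝ} (hO : IsOpen O) {α β : ℝ} (hb : O ⊆ Ioo α β) :
    volume (triple O) ≤ 3 * volume O := by
  have h := measure_inter_eq_tsum_comps hO hb volume MeasurableSet.univ
  simp only [inter_univ] at h
  rw [h, ← ENNReal.tsum_mul_left]
  refine (measure_biUnion_le _ (countable_comps O) _).trans (ENNReal.tsum_le_tsum fun p => ?_)
  have : (3 : ℝ≥0∞) = ENNReal.ofReal 3 := by norm_num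
  rw [Real.volume_Ioo, Real.volume_Ioo, this, ← ENNReal.ofReal_mul (by norm_num)]
  refine ENNReal.ofReal_le_ofReal (le_of_eq ?_)
  ring

lemma lintegral_bad_le {ε : ℝ} (hε : 0 < ε) {O : Set ℝ} (hO : IsOpen O) {α β : ℝ}
    (hb : O ⊆ Ioo α β) {B : ℝ → H} (hB : Integrable B) (h0 : ∀ x, x ∉ O → B x = 0)
    (hp : ∀ p ∈ comps O, ∫ y in Ioo p.1 p.2, B y = 0) :
    ∫⁻ x in (triple O)ᶜ, ‖cauchyT ε B x‖ₑ ≤ 7 * ∫⁻ x, ‖B x‖ₑ := by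
  have : Countable (comps O) := (countable_comps O).to_subtype
  have hT : ∀ x, ‖cauchyT ε B x‖ₑ ≤
      ∑' p : comps O, ‖∫ y in Ioo p.1.1 p.1.2, cauchyK ε (x - y) • B y‖ₑ := by
    intro x
    have h1 : cauchyT ε B x = ∫ y in O, cauchyK ε (x - y) • B y :=
      (setIntegral_eq_integral_of_forall_compl_eq_zero fun y hy => by rw [h0 y hy, smul_zero]).symm
    have h2 : ⋃ p : comps O, Ioo p.1.1 p.1.2 = O := by
      conv_rhs => rw [← iUnion_comps hO hb]
      exact (biUnion_eq_iUnion (comps O) fun p _ => Ioo p.1 p.2).symm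
    have h3 : ∫ y in O, cauchyK ε (x - y) • B y =
        ∑' p : comps O, ∫ y in Ioo p.1.1 p.1.2, cauchyK ε (x - y) • B y := by
      conv_lhs => rw [← h2]
      exact integral_iUnion (ι := comps O) (fun _ => measurableSet_Ioo)
        (fun p q hpq => pairwiseDisjoint_comps O p.2 q.2 (Subtype.coe_ne_coe.2 hpq))
        (integrable_cauchyK_smul hε hB x).integrableOn
    rw [h1, h3]
    exact enorm_tsum_le_tsum_enorm
  calc _ ≤ ∫⁻ x in (triple O)ᶜ,
        ∑' p : comps O, ‖∫ y in Ioo p.1.1 p.1.2, cauchyK ε (x - y) • B y‖ₑ := lintegral_mono hT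
    _ = ∑' p : comps O, ∫⁻ x in (triple O)ᶜ,
        ‖∫ y in Ioo p.1.1 p.1.2, cauchyK ε (x - y) • B y‖ₑ := by
      refine lintegral_tsum fun p => ?_
      have h1 : (fun x => ‖∫ y in Ioo p.1.1 p.1.2, cauchyK ε (x - y) • B y‖ₑ) =
          fun x => ‖cauchyT ε ((Ioo p.1.1 p.1.2).indicator B) x‖ₑ := by
        ext x
        rw [cauchyT, ← integral_indicator measurableSet_Ioo]
        simp only [indicator_smul_apply]
      rw [h1]
      exact (continuous_cauchyT hε (hB.indicator measurableSet_Ioo)).enorm.aemeasurable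
    _ ≤ ∑' p : comps O, 7 * ∫⁻ y in Ioo p.1.1 p.1.2, ‖B y‖ₑ := by
      refine ENNReal.tsum_le_tsum fun p => ?_
      refine (lintegral_mono_set fun x hx => ?_).trans (lintegral_atom_le hε hB p.2.1 (hp p p.2))
      by_contra hx'
      have hx2 : |x - (p.1.1 + p.1.2) / 2| < 3 * ((p.1.2 - p.1.1) / 2) := not_le.1 hx'
      rw [abs_lt] at hx2
      exact hx (mem_biUnion p.2 ⟨by linarith, by linarith⟩)
    _ = 7 * ∫⁻ y in O, ‖B y‖ₑ := by
      rw [ENNReal.tsum_mul_left, setLIntegral_eq_tsum_comps hO hb]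
    _ ≤ _ := by
      gcongr
      exact Measure.restrict_le_self

lemma exists_Ioo_large {α β : ℝ} {s M : ℝ≥0∞} (hs : s ≠ 0) (hM : M ≠ ∞) :
    ∃ R : ℝ, 0 < R ∧ Ioo α β ⊆ Ioo (-R) R ∧ M ≤ s * ENNReal.ofReal (R - -R) := by
  obtain ⟨n, hn⟩ := ENNReal.exists_nat_mul_gt hs hM
  refine ⟨max (max |α| |β|) n + 1, by positivity, Ioo_subset_Ioo ?_ ?_, hn.le.trans ?_⟩
  · have := neg_abs_le α
    have h1 : |α| ≤ max (max |α| |β|) n := (le_max_left _ _).trans (le_max_left _ _)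
    linarith
  · have := le_abs_self β
    have h1 : |β| ≤ max (max |α| |β|) n := (le_max_right _ _).trans (le_max_left _ _)
    linarith
  · rw [mul_comm, ← ENNReal.ofReal_natCast]
    gcongr
    have h1 : (n : ℝ) ≤ max (max |α| |β|) n := le_max_right _ _
    have h2 : (0 : ℝ) ≤ n := by positivity
    linarith

lemma mul_volume_two_mul_lt_cauchyT_le {ε : ℝ} (hε : 0 < ε) {F : ℝ → H} (hF : Integrable F)
    {α β : ℝ} (h0 : ∀ x, x ∉ Ioo α β → F x = 0) {s : ℝ≥0∞} (hs : s ≠ 0) (hs' : s ≠ ∞) :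
    s * volume {x | 2 * s < ‖cauchyT ε F x‖ₑ} ≤ 33 * ∫⁻ x, ‖F x‖ₑ := by
  obtain ⟨R, hR, hsub, hRM⟩ := exists_Ioo_large (α := α) (β := β) hs hF.2.ne
  set O := lev (-R) R (fun x => ‖F x‖ₑ) s with hOdef
  have hO : IsOpen O := isOpen_lev _ _ _ _
  have hb : O ⊆ Ioo (-R) R := lev_subset _ _ _ _
  have hmean : ∀ p ∈ comps O, ∫⁻ x in Ioo p.1 p.2, ‖F x‖ₑ ≤ s * ENNReal.ofReal (p.2 - p.1) := by
    intro p hp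
    by_cases hpe : p = (-R, R)
    · rw [hpe]
      exact (setLIntegral_le_lintegral _ _).trans hRM
    · exact lintegral_comp_lev_le hs' hp hpe
  set G := avgOn O F
  have hG : Integrable G := integrable_avgOn hO hb hF
  have hGF : ∫⁻ x, ‖G x‖ₑ ≤ ∫⁻ x, ‖F x‖ₑ := lintegral_avgOn_le hO hb
  have hGs : ∀ᵐ x, ‖G x‖ₑ ≤ s := by
    filter_upwards [ae_le_of_notMem_lev hF.1.enorm (α := -R) (β := R)
      ((setLIntegral_le_lintegral _ _).trans_lt hF.2).ne s] with x hx
    by_cases hxO : x ∈ O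
    · rw [← iUnion_comps hO hb, mem_iUnion₂] at hxO
      obtain ⟨p, hp, hxp⟩ := hxO
      have hpos : ENNReal.ofReal (p.2 - p.1) ≠ 0 := by simpa using hp.1
      refine (ENNReal.mul_le_mul_iff_right hpos ENNReal.ofReal_ne_top).1 ?_
      simp only [G, avgOn_of_mem F hp hxp]
      rw [mul_comm _ s]
      exact (enorm_setAverage_le F hp.1).trans (hmean p hp)
    · simp only [G, avgOn_of_notMem F hxO]
      by_cases hxI : x ∈ Ioo (-R) R
      · exact hx hxI hxO
      · rw [h0 x fun h => hxI (hsub h)]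
        simp
  set B : ℝ → H := fun x => F x - G x
  have hB : Integrable B := hF.sub hG
  have hBF : ∫⁻ x, ‖B x‖ₑ ≤ 2 * ∫⁻ x, ‖F x‖ₑ := by
    calc ∫⁻ x, ‖B x‖ₑ ≤ ∫⁻ x, (‖F x‖ₑ + ‖G x‖ₑ) := lintegral_mono fun x => enorm_sub_le
      _ = (∫⁻ x, ‖F x‖ₑ) + ∫⁻ x, ‖G x‖ₑ := lintegral_add_left' hF.1.enorm _
      _ ≤ _ := by rw [two_mul]; gcongr
  have hbad := lintegral_bad_le hε hO hb hB
    (fun x hx => by simp only [B, G, avgOn_of_notMem F hx, sub_self])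
    fun p hp => setIntegral_sub_avgOn hF hp
  have hT : ∀ x, cauchyT ε F x = cauchyT ε G x + cauchyT ε B x := by
    intro x
    rw [← cauchyT_add hε hG hB]
    congr 1
    ext y
    simp [B]
  have hcov : {x | 2 * s < ‖cauchyT ε F x‖ₑ} ⊆ {x | s < ‖cauchyT ε G x‖ₑ} ∪ triple O ∪
      {x | s ≤ ‖cauchyT ε B x‖ₑ} ∩ (triple O)ᶜ := by
    intro x hx
    have hx' : 2 * s < ‖cauchyT ε F x‖ₑ := hx
    by_cases h1 : s < ‖cauchyT ε G x‖ₑ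
    · exact Or.inl (Or.inl h1)
    by_cases h2 : x ∈ triple O
    · exact Or.inl (Or.inr h2)
    refine Or.inr ⟨?_, h2⟩
    show s ≤ ‖cauchyT ε B x‖ₑ
    by_contra! h3
    refine absurd hx' (not_lt.2 ?_)
    rw [hT, two_mul]
    exact (enorm_add_le _ _).trans (add_le_add (not_lt.1 h1) h3.le)
  have e1 := mul_volume_enorm_cauchyT_le_of_le hε hG hs hs' hGs
  have e2 : s * volume (triple O) ≤ 18 * ∫⁻ x, ‖F x‖ₑ := by
    calc s * volume (triple O) ≤ s * (3 * volume O) := by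
          gcongr; exact volume_triple_le hO hb
      _ = 3 * (s * volume O) := by ring
      _ ≤ 3 * (6 * ∫⁻ x in Ioo (-R) R, ‖F x‖ₑ) := by
          exact mul_le_mul_right (mul_volume_lev_le _ _ _ hs hs') _
      _ ≤ 3 * (6 * ∫⁻ x, ‖F x‖ₑ) := by gcongr; exact Measure.restrict_le_self
      _ = _ := by ring
  have e3 : s * volume ({x | s ≤ ‖cauchyT ε B x‖ₑ} ∩ (triple O)ᶜ) ≤ 14 * ∫⁻ x, ‖F x‖ₑ := by
    rw [← Measure.restrict_apply' (measurableSet_triple O).compl]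
    refine (mul_meas_ge_le_lintegral (continuous_cauchyT hε hB).enorm.measurable _).trans ?_
    refine hbad.trans ?_
    calc 7 * ∫⁻ x, ‖B x‖ₑ ≤ 7 * (2 * ∫⁻ x, ‖F x‖ₑ) := by gcongr
      _ = _ := by ring
  calc s * volume {x | 2 * s < ‖cauchyT ε F x‖ₑ}
      ≤ s * (volume {x | s < ‖cauchyT ε G x‖ₑ} + volume (triple O) +
        volume ({x | s ≤ ‖cauchyT ε B x‖ₑ} ∩ (triple O)ᶜ)) := by
        gcongr
        refine (measure_mono hcov).trans ((measure_union_le _ _).trans ?_)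
        gcongr
        exact measure_union_le _ _
    _ = s * volume {x | s < ‖cauchyT ε G x‖ₑ} + s * volume (triple O) +
        s * volume ({x | s ≤ ‖cauchyT ε B x‖ₑ} ∩ (triple O)ᶜ) := by ring
    _ ≤ (∫⁻ x, ‖F x‖ₑ) + 18 * (∫⁻ x, ‖F x‖ₑ) + 14 * ∫⁻ x, ‖F x‖ₑ := by
        gcongr
        exact e1.trans hGF
    _ = _ := by ring

/-- Weak type `(1, 1)` of `cauchyT ε`, uniformly in `ε`. -/
lemma mul_volume_lt_cauchyT_le {ε : ℝ} (hε : 0 < ε) {F : ℝ → H} (hF : Integrable F)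
    {α β : ℝ} (h0 : ∀ x, x ∉ Ioo α β → F x = 0) {s : ℝ≥0∞} (hs : s ≠ 0) (hs' : s ≠ ∞) :
    s * volume {x | s < ‖cauchyT ε F x‖ₑ} ≤ 66 * ∫⁻ x, ‖F x‖ₑ := by
  have h := mul_volume_two_mul_lt_cauchyT_le hε hF h0 (s := s / 2) (by simpa using hs)
    (ENNReal.div_ne_top hs' (by norm_num))
  rw [ENNReal.mul_div_cancel (by norm_num) (by norm_num)] at h
  calc s * volume {x | s < ‖cauchyT ε F x‖ₑ}
      = 2 * (s / 2 * volume {x | s < ‖cauchyT ε F x‖ₑ}) := by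
        rw [← mul_assoc, ENNReal.mul_div_cancel (by norm_num) (by norm_num)]
    _ ≤ 2 * (33 * ∫⁻ x, ‖F x‖ₑ) := by gcongr
    _ = _ := by ring

end

section

open scoped NNReal

/-- The square root on `ℝ≥0∞`. -/
def rt (x : ℝ≥0∞) : ℝ≥0∞ := x ^ (1 / 2 : ℝ)

lemma rt_mono {x y : ℝ≥0∞} (h : x ≤ y) : rt x ≤ rt y := ENNReal.rpow_le_rpow h (by norm_num)

lemma rt_sq (x : ℝ≥0∞) : rt (x ^ 2) = x := by
  rw [rt, ← ENNReal.rpow_natCast, ← ENNReal.rpow_mul]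
  norm_num

lemma sq_rt (x : ℝ≥0∞) : rt x ^ 2 = x := by
  rw [rt, ← ENNReal.rpow_natCast, ← ENNReal.rpow_mul]
  norm_num

lemma rt_add_le (x y : ℝ≥0∞) : rt (x + y) ≤ rt x + rt y :=
  ENNReal.rpow_add_le_add_rpow x y (by norm_num) (by norm_num)

lemma rt_ne_top {x : ℝ≥0∞} (h : x ≠ ∞) : rt x ≠ ∞ :=
  ENNReal.rpow_ne_top_of_nonneg (by norm_num) h

lemma continuous_rt : Continuous rt := ENNReal.continuous_rpow_const

lemma sq_lt_of_lt_rt {s x : ℝ≥0∞} (h : s < rt x) : s ^ 2 < x := by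
  rw [← sq_rt x]
  exact ENNReal.pow_lt_pow_left two_ne_zero h

lemma tsum_half_pow : ∑' k : ℕ, (2⁻¹ : ℝ≥0∞) ^ k = 2 := by
  rw [ENNReal.tsum_geometric, ENNReal.one_sub_inv_two, inv_inv]

lemma le_add_tsum_dyadic {t y : ℝ≥0∞} (ht : t ≠ 0) (hy : y ≠ ∞) :
    y ≤ t + ∑' k : ℕ, (Ioi (2 ^ k * t)).indicator (fun _ => 2 ^ (k + 1) * t) y := by
  rcases le_or_gt y t with h | h
  · exact h.trans le_self_add
  have hex : ∃ k : ℕ, y ≤ 2 ^ k * t := by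
    obtain ⟨n, hn⟩ := ENNReal.exists_nat_mul_gt ht hy
    refine ⟨n, hn.le.trans ?_⟩
    gcongr
    exact_mod_cast Nat.lt_two_pow_self.le
  classical
  obtain ⟨hk, hmin⟩ := Nat.find_spec hex, fun m => Nat.find_min (H := hex) (m := m)
  rcases hn : Nat.find hex with _ | k
  · rw [hn] at hk
    simp only [pow_zero, one_mul] at hk
    exact absurd h (not_lt.2 hk)
  · rw [hn] at hk hmin
    have h2 := hmin k (Nat.lt_succ_self k)
    calc y ≤ 2 ^ (k + 1) * t := hk
      _ = (Ioi (2 ^ k * t)).indicator (fun _ => 2 ^ (k + 1) * t) y :=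
        by rw [indicator_of_mem (show y ∈ Ioi (2 ^ k * t) from not_le.1 h2)]
      _ ≤ ∑' k : ℕ, (Ioi (2 ^ k * t)).indicator (fun _ => 2 ^ (k + 1) * t) y :=
        ENNReal.le_tsum (f := fun k : ℕ => (Ioi (2 ^ k * t)).indicator (fun _ => 2 ^ (k + 1) * t) y) k
      _ ≤ _ := le_add_self

/-- Kolmogorov's inequality: weak type `(1, 1)` bounds control averages of square roots. -/
lemma mul_lintegral_rt_le {h : ℝ → ℝ≥0∞} (hm : Measurable h) (hfin : ∀ x, h x ≠ ∞) {M : ℝ≥0∞}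
    (hM : ∀ s : ℝ≥0∞, s ≠ 0 → s ≠ ∞ → s * volume {x | s < h x} ≤ M) {t : ℝ≥0∞} (ht : t ≠ 0)
    (ht' : t ≠ ∞) (J : Set ℝ) :
    t * ∫⁻ x in J, rt (h x) ≤ t ^ 2 * volume J + 4 * M := by
  have h1 : ∫⁻ x in J, rt (h x) ≤ t * volume J +
      ∑' k : ℕ, 2 ^ (k + 1) * t * volume {x | 2 ^ k * t < rt (h x)} := by
    calc ∫⁻ x in J, rt (h x) ≤ ∫⁻ x in J, (t +
          ∑' k : ℕ, (Ioi (2 ^ k * t)).indicator (fun _ => 2 ^ (k + 1) * t) (rt (h x))) :=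
        lintegral_mono fun x => le_add_tsum_dyadic ht (rt_ne_top (hfin x))
      _ = t * volume J + ∫⁻ x in J,
          ∑' k : ℕ, (Ioi (2 ^ k * t)).indicator (fun _ => 2 ^ (k + 1) * t) (rt (h x)) := by
        rw [lintegral_add_left measurable_const, setLIntegral_const]
      _ ≤ t * volume J + ∫⁻ x,
          ∑' k : ℕ, (Ioi (2 ^ k * t)).indicator (fun _ => 2 ^ (k + 1) * t) (rt (h x)) := by
        gcongr
        exact Measure.restrict_le_self
      _ = _ := by
        have hrt : Measurable fun x => rt (h x) := continuous_rt.measurable.comp hm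
        have hmeas : ∀ k : ℕ, AEMeasurable fun x =>
            (Ioi (2 ^ k * t)).indicator (fun _ => 2 ^ (k + 1) * t) (rt (h x)) := fun k =>
          ((measurable_const.indicator measurableSet_Ioi).comp hrt).aemeasurable
        rw [lintegral_tsum hmeas]
        congr 2
        ext k
        have e : (fun x => (Ioi (2 ^ k * t)).indicator (fun _ => 2 ^ (k + 1) * t) (rt (h x))) =
            ({x | 2 ^ k * t < rt (h x)}).indicator fun _ => 2 ^ (k + 1) * t := by
          ext x
          by_cases hx : 2 ^ k * t < rt (h x)
          · rw [indicator_of_mem (show rt (h x) ∈ Ioi (2 ^ k * t) from hx),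
              indicator_of_mem (show x ∈ {x | 2 ^ k * t < rt (h x)} from hx)]
          · rw [indicator_of_notMem (show rt (h x) ∉ Ioi (2 ^ k * t) from hx),
              indicator_of_notMem (show x ∉ {x | 2 ^ k * t < rt (h x)} from hx)]
        rw [e, lintegral_indicator_const (measurableSet_lt measurable_const hrt)]
  have h2 : ∀ k : ℕ, t * (2 ^ (k + 1) * t * volume {x | 2 ^ k * t < rt (h x)}) ≤
      2 * M * 2⁻¹ ^ k := by
    intro k
    have hs0 : (2 ^ k * t) ^ 2 ≠ 0 := pow_ne_zero _ (mul_ne_zero (by simp) ht)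
    have hs1 : (2 ^ k * t) ^ 2 ≠ ∞ := ENNReal.pow_ne_top (ENNReal.mul_ne_top (by simp) ht')
    have hinv : (2 : ℝ≥0∞) ^ k * 2⁻¹ ^ k = 1 := by
      rw [← mul_pow, ENNReal.mul_inv_cancel (by norm_num) (by norm_num), one_pow]
    calc t * (2 ^ (k + 1) * t * volume {x | 2 ^ k * t < rt (h x)})
        ≤ t * (2 ^ (k + 1) * t * volume {x | (2 ^ k * t) ^ 2 < h x}) :=
          mul_le_mul_right (mul_le_mul_right (measure_mono fun x hx => sq_lt_of_lt_rt hx) _) _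
      _ = (2 ^ k * 2⁻¹ ^ k) * (t * (2 ^ (k + 1) * t * volume {x | (2 ^ k * t) ^ 2 < h x})) := by
          rw [hinv, one_mul]
      _ = 2 * ((2 ^ k * t) ^ 2 * volume {x | (2 ^ k * t) ^ 2 < h x}) * 2⁻¹ ^ k := by ring
      _ ≤ 2 * M * 2⁻¹ ^ k := by
          gcongr
          exact hM _ hs0 hs1
  calc t * ∫⁻ x in J, rt (h x) ≤ t * (t * volume J +
      ∑' k : ℕ, 2 ^ (k + 1) * t * volume {x | 2 ^ k * t < rt (h x)}) := by gcongr
    _ = t ^ 2 * volume J +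
      ∑' k : ℕ, t * (2 ^ (k + 1) * t * volume {x | 2 ^ k * t < rt (h x)}) := by
      rw [mul_add, ENNReal.tsum_mul_left]; ring
    _ ≤ t ^ 2 * volume J + ∑' k : ℕ, 2 * M * 2⁻¹ ^ k := by
      exact add_le_add le_rfl (ENNReal.tsum_le_tsum h2)
    _ = _ := by
      rw [ENNReal.tsum_mul_left, tsum_half_pow]; ring

/-- The part of the convolution that comes from far away oscillates little. -/
lemma lintegral_tail_le {f : ℝ → ℝ≥0∞} (hf : AEMeasurable f) {c r x₀ : ℝ} (hr : 0 < r) (hx₀ : |x₀ - c| < r)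
    {m : ℝ≥0∞} (hm : ∀ a b, x₀ ∈ Ioo a b → ∫⁻ y in Ioo a b, f y ≤ m * ENNReal.ofReal (b - a)) :
    ∫⁻ y in {y | 3 * r ≤ |y - c|}, ENNReal.ofReal (3 / 2 * r / (c - y) ^ 2) * f y ≤ 12 * m := by
  have hms : MeasurableSet {y : ℝ | 3 * r ≤ |y - c|} :=
    measurableSet_le measurable_const (by fun_prop)
  have hpt : ∀ y : ℝ, 3 * r ≤ |y - c| → ENNReal.ofReal (3 / 2 * r / (c - y) ^ 2) * f y ≤
      ∑' k : ℕ, ENNReal.ofReal (3 / 2 * r⁻¹ * (4 ^ k)⁻¹) *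
        (Ioo (c - 2 ^ (k + 1) * r) (c + 2 ^ (k + 1) * r)).indicator f y := by
    intro y hy
    have hv : 1 ≤ |y - c| / r := by rw [le_div_iff₀ hr]; linarith
    obtain ⟨k, hk1, hk2⟩ := exists_nat_pow_near hv (one_lt_two)
    rw [le_div_iff₀ hr] at hk1
    rw [div_lt_iff₀ hr] at hk2
    refine le_trans ?_ (ENNReal.le_tsum k)
    have hmem : y ∈ Ioo (c - 2 ^ (k + 1) * r) (c + 2 ^ (k + 1) * r) := by
      have := abs_lt.1 hk2
      exact ⟨by linarith, by linarith⟩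
    rw [indicator_of_mem hmem]
    gcongr
    have h4 : (4 : ℝ) ^ k * r ^ 2 ≤ (c - y) ^ 2 := by
      have e1 : (4 : ℝ) ^ k = (2 ^ k) ^ 2 := by rw [← pow_mul, mul_comm k 2, pow_mul]; norm_num
      rw [← sq_abs (c - y), abs_sub_comm c y, e1, ← mul_pow]
      gcongr
    calc 3 / 2 * r / (c - y) ^ 2 ≤ 3 / 2 * r / (4 ^ k * r ^ 2) := by gcongr
      _ = _ := by field_simp
  calc _ ≤ ∫⁻ y in {y | 3 * r ≤ |y - c|}, ∑' k : ℕ, ENNReal.ofReal (3 / 2 * r⁻¹ * (4 ^ k)⁻¹) *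
        (Ioo (c - 2 ^ (k + 1) * r) (c + 2 ^ (k + 1) * r)).indicator f y :=
      setLIntegral_mono' hms hpt
    _ ≤ ∫⁻ y, ∑' k : ℕ, ENNReal.ofReal (3 / 2 * r⁻¹ * (4 ^ k)⁻¹) *
        (Ioo (c - 2 ^ (k + 1) * r) (c + 2 ^ (k + 1) * r)).indicator f y :=
      setLIntegral_le_lintegral _ _
    _ = ∑' k : ℕ, ENNReal.ofReal (3 / 2 * r⁻¹ * (4 ^ k)⁻¹) *
        ∫⁻ y in Ioo (c - 2 ^ (k + 1) * r) (c + 2 ^ (k + 1) * r), f y := by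
      rw [lintegral_tsum fun k => (hf.indicator measurableSet_Ioo).const_mul _]
      congr 1
      ext k
      rw [lintegral_const_mul' _ _ ENNReal.ofReal_ne_top, lintegral_indicator measurableSet_Ioo]
    _ ≤ ∑' k : ℕ, 6 * m * 2⁻¹ ^ k := by
      refine ENNReal.tsum_le_tsum fun k => ?_
      have h1 : (1 : ℝ) ≤ 2 ^ (k + 1) := one_le_pow₀ (by norm_num)
      have h2 : r ≤ 2 ^ (k + 1) * r := by nlinarith
      have h3 := abs_lt.1 hx₀
      calc _ ≤ ENNReal.ofReal (3 / 2 * r⁻¹ * (4 ^ k)⁻¹) *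
            (m * ENNReal.ofReal (c + 2 ^ (k + 1) * r - (c - 2 ^ (k + 1) * r))) := by
            gcongr
            exact hm _ _ ⟨by linarith, by linarith⟩
        _ = (ENNReal.ofReal (3 / 2 * r⁻¹ * (4 ^ k)⁻¹) *
            ENNReal.ofReal (c + 2 ^ (k + 1) * r - (c - 2 ^ (k + 1) * r))) * m := by ring
        _ = ENNReal.ofReal (6 * 2⁻¹ ^ k) * m := by
            rw [← ENNReal.ofReal_mul (by positivity)]
            congr 2
            have e1 : (4 : ℝ) ^ k = 2 ^ k * 2 ^ k := by rw [← mul_pow]; norm_num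
            rw [e1, inv_pow]
            field_simp
            ring
        _ = _ := by
            rw [ENNReal.ofReal_mul (by norm_num), ENNReal.ofReal_pow (by norm_num),
              ENNReal.ofReal_inv_of_pos (by norm_num)]
            norm_num
            ring
    _ = _ := by
      rw [ENNReal.tsum_mul_left, tsum_half_pow]; ring

end

section

open scoped NNReal

variable {H : Type*} [NormedAddCommGroup H] [InnerProductSpace ℂ H]

lemma setLIntegral_le_of_notMem_lev {f : ℝ → ℝ≥0∞} {α β x₀ a b : ℝ} {m : ℝ≥0∞}
    (h0 : ∀ x, x ∉ Ioo α β → f x = 0) (hx₀ : x₀ ∈ Ioo α β) (hn : x₀ ∉ lev α β f m)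
    (hab : x₀ ∈ Ioo a b) : ∫⁻ y in Ioo a b, f y ≤ m * ENNReal.ofReal (b - a) := by
  have hind : (Ioo α β).indicator f = f :=
    indicator_eq_self.2 fun x hx => by_contra fun h => hx (h0 x h)
  have h1 : ∫⁻ y in Ioo a b, f y = ∫⁻ y in Ioo (a ⊔ α) (b ⊓ β), f y := by
    conv_lhs => rw [← hind]
    rw [setLIntegral_indicator measurableSet_Ioo, inter_comm, Ioo_inter_Ioo]
  have hlt : a ⊔ α < b ⊓ β := (max_lt hab.1 hx₀.1).trans (lt_min hab.2 hx₀.2)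
  rw [h1]
  calc ∫⁻ y in Ioo (a ⊔ α) (b ⊓ β), f y ≤ m * ENNReal.ofReal (b ⊓ β - a ⊔ α) := by
        refine not_lt.1 fun h => hn (Ioo_subset_lev le_sup_right hlt inf_le_right h
          ⟨max_lt hab.1 hx₀.1, lt_min hab.2 hx₀.2⟩)
    _ ≤ m * ENNReal.ofReal (b - a) :=
        mul_le_mul_right (ENNReal.ofReal_le_ofReal (sub_le_sub inf_le_left le_sup_left)) _

lemma enorm_cauchyT_sub_le {ε : ℝ} (hε : 0 < ε) {F : ℝ → H} (hF : Integrable F) {c r x : ℝ}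
    (hr : 0 < r) (hx : |x - c| ≤ r) (h0 : ∀ y, |y - c| < 3 * r → F y = 0) :
    ‖cauchyT ε F x - cauchyT ε F c‖ₑ ≤
      ∫⁻ y in {y | 3 * r ≤ |y - c|}, ENNReal.ofReal (3 / 2 * r / (c - y) ^ 2) * ‖F y‖ₑ := by
  have hms : MeasurableSet {y : ℝ | 3 * r ≤ |y - c|} :=
    measurableSet_le measurable_const (by fun_prop)
  rw [cauchyT, cauchyT, ← integral_sub (integrable_cauchyK_smul hε hF x)
    (integrable_cauchyK_smul hε hF c), ← lintegral_indicator hms]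
  refine (enorm_integral_le_lintegral_enorm _).trans (lintegral_mono fun y => ?_)
  by_cases hy : 3 * r ≤ |y - c|
  · rw [indicator_of_mem (show y ∈ {y : ℝ | 3 * r ≤ |y - c|} from hy), ← sub_smul, enorm_smul]
    refine mul_le_mul_left ?_ _
    rw [← ofReal_norm]
    refine ENNReal.ofReal_le_ofReal ?_
    have hcy : 3 * r ≤ |c - y| := by rwa [abs_sub_comm]
    have e : x - y - (c - y) = x - c := by ring
    have h1 := norm_cauchyK_sub_le_of_le hε (z := x - y) (z' := c - y)
      (abs_pos.1 (by linarith)) (by rw [e]; linarith)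
    rw [e] at h1
    refine h1.trans ?_
    gcongr
  · rw [h0 y (not_le.1 hy)]
    simp

/-- The good-`λ` inequality for `cauchyT ε`, formulated for averages of square roots. -/
theorem volume_inter_lev_cauchyT_le [CompleteSpace H] {ε : ℝ} (hε : 0 < ε) {F : ℝ → H}
    (hF : Integrable F)
    {α β : ℝ} (h0 : ∀ x, x ∉ Ioo α β → F x = 0) {δ l : ℝ≥0∞} (hδ : δ ≠ 0) (hδ' : δ ≤ 1000⁻¹)
    (hl : l ≠ 0) (hl' : l ≠ ∞) {p : ℝ × ℝ}
    (hp : p ∈ comps (lev α β (fun x => rt ‖cauchyT ε F x‖ₑ) l)) {x₀ : ℝ} (hx₀ : x₀ ∈ Ioo p.1 p.2)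
    (hn : x₀ ∉ lev α β (fun x => ‖F x‖ₑ) ((δ * l) ^ 2)) :
    volume (Ioo p.1 p.2 ∩ lev α β (fun x => rt ‖cauchyT ε F x‖ₑ) (16 * l)) ≤
      4758 * δ * ENNReal.ofReal (p.2 - p.1) := by
  set t := δ * l with ht_def
  have hδt : δ ≠ ∞ := ne_top_of_le_ne_top (by simp) hδ'
  have ht : t ≠ 0 := mul_ne_zero hδ hl
  have ht' : t ≠ ∞ := ENNReal.mul_ne_top hδt hl'
  have htl : 1000 * t ≤ l := by
    calc 1000 * t = 1000 * δ * l := by rw [ht_def, mul_assoc]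
      _ ≤ 1000 * 1000⁻¹ * l := by gcongr
      _ = l := by rw [ENNReal.mul_inv_cancel (by norm_num) (by norm_num), one_mul]
  have hpp : p.1 < p.2 := hp.1
  have hends := endpoints_of_mem_comps_lev hp
  have hx₀I : x₀ ∈ Ioo α β := Ioo_subset_Ioo hends.1 hends.2 hx₀
  have h0' : ∀ x, x ∉ Ioo α β → ‖F x‖ₑ = 0 := fun x hx => by rw [h0 x hx, enorm_zero]
  have hm : ∀ a b, x₀ ∈ Ioo a b → ∫⁻ y in Ioo a b, ‖F y‖ₑ ≤ t ^ 2 * ENNReal.ofReal (b - a) :=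
    fun a b hab => setLIntegral_le_of_notMem_lev h0' hx₀I hn hab
  set V := ENNReal.ofReal (p.2 - p.1) with hV
  have hV0 : V ≠ 0 := by simpa [hV] using hpp
  have hVt : V ≠ ∞ := ENNReal.ofReal_ne_top
  have hvol : volume (Ioo p.1 p.2) = V := Real.volume_Ioo
  have hgm : ∀ {G : ℝ → H}, Integrable G → Measurable fun x => ‖cauchyT ε G x‖ₑ :=
    fun hG => (continuous_cauchyT hε hG).enorm.measurable
  -- the mean over the component
  have hmean : ∫⁻ x in Ioo p.1 p.2, rt ‖cauchyT ε F x‖ₑ ≤ l * V := by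
    by_cases hne : p = (α, β)
    · have h1 := mul_lintegral_rt_le (hgm hF) (fun x => enorm_ne_top)
        (fun s hs hs' => mul_volume_lt_cauchyT_le hε hF h0 hs hs') ht ht' (Ioo p.1 p.2)
      have h2 : ∫⁻ x, ‖F x‖ₑ ≤ t ^ 2 * V := by
        have h3 := hm p.1 p.2 hx₀
        have hI : Ioo p.1 p.2 = Ioo α β := by rw [hne]
        rw [hI] at h3
        have hind : (Ioo α β).indicator (fun x => ‖F x‖ₑ) = fun x => ‖F x‖ₑ :=
          indicator_eq_self.2 fun x hx => by_contra fun h => hx (h0' x h)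
        rw [← hind, lintegral_indicator measurableSet_Ioo]
        exact h3
      rw [hvol] at h1
      have h4 : t * ∫⁻ x in Ioo p.1 p.2, rt ‖cauchyT ε F x‖ₑ ≤ t * (l * V) := by
        calc _ ≤ t ^ 2 * V + 4 * (66 * (t ^ 2 * V)) := h1.trans (by gcongr)
          _ = t * (265 * t * V) := by ring
          _ ≤ t * (1000 * t * V) := by gcongr; norm_num
          _ ≤ _ := by gcongr
      exact (ENNReal.mul_le_mul_iff_right ht ht').1 h4
    · exact lintegral_comp_lev_le hl' hp hne
  -- the decomposition into a near and a far part
  set c := (p.1 + p.2) / 2 with hc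
  set r := (p.2 - p.1) / 2 with hr_def
  have hr : 0 < r := by rw [hr_def]; linarith
  have hJ : ∀ {x}, x ∈ Ioo p.1 p.2 → |x - c| < r := by
    intro x hx
    rw [abs_lt]
    constructor <;> rw [hc, hr_def] <;> linarith [hx.1, hx.2]
  set F1 := (Ioo (c - 3 * r) (c + 3 * r)).indicator F with hF1_def
  set F2 := (Ioo (c - 3 * r) (c + 3 * r))ᶜ.indicator F with hF2_def
  have hF1 : Integrable F1 := hF.indicator measurableSet_Ioo
  have hF2 : Integrable F2 := hF.indicator measurableSet_Ioo.compl
  have hsum : ∀ x, cauchyT ε F x = cauchyT ε F1 x + cauchyT ε F2 x := by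
    intro x
    rw [← cauchyT_add hε hF1 hF2]
    congr 1
    exact (indicator_self_add_compl _ _).symm
  have hM1 : ∫⁻ x, ‖F1 x‖ₑ ≤ 3 * (t ^ 2 * V) := by
    have hxm : x₀ ∈ Ioo (c - 3 * r) (c + 3 * r) := by
      have := abs_lt.1 (hJ hx₀)
      exact ⟨by linarith, by linarith⟩
    have e1 : (fun x => ‖F1 x‖ₑ) = (Ioo (c - 3 * r) (c + 3 * r)).indicator fun x => ‖F x‖ₑ := by
      ext x
      rw [hF1_def, enorm_indicator_eq_indicator_enorm]
    have e2 : c + 3 * r - (c - 3 * r) = 3 * (p.2 - p.1) := by rw [hr_def]; ring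
    rw [e1, lintegral_indicator measurableSet_Ioo]
    refine (hm _ _ hxm).trans_eq ?_
    rw [e2, ENNReal.ofReal_mul (by norm_num), ← hV]
    norm_num
    ring
  have hh : ∫⁻ x in Ioo p.1 p.2, rt ‖cauchyT ε F1 x‖ₑ ≤ 793 * t * V := by
    have h1 := mul_lintegral_rt_le (hgm hF1) (fun x => enorm_ne_top)
      (fun s hs hs' => mul_volume_lt_cauchyT_le (α := c - 3 * r) (β := c + 3 * r) hε hF1
        (fun x hx => indicator_of_notMem hx _) hs hs') ht ht' (Ioo p.1 p.2)
    rw [hvol] at h1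
    refine (ENNReal.mul_le_mul_iff_right ht ht').1 ?_
    calc _ ≤ t ^ 2 * V + 4 * (66 * (3 * (t ^ 2 * V))) := h1.trans (by gcongr)
      _ = t * (793 * t * V) := by ring
  have hosc : ∀ x ∈ Ioo p.1 p.2, rt ‖cauchyT ε F2 x - cauchyT ε F2 c‖ₑ ≤ 4 * t := by
    intro x hx
    have h1 := enorm_cauchyT_sub_le hε hF2 hr (hJ hx).le (fun y hy => by
      refine indicator_of_notMem (notMem_compl_iff.2 ?_) _
      have := abs_lt.1 hy
      exact ⟨by linarith, by linarith⟩)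
    have h2 := lintegral_tail_le (f := fun y => ‖F y‖ₑ) hF.1.enorm hr (hJ hx₀) hm
    have h3 : ‖cauchyT ε F2 x - cauchyT ε F2 c‖ₑ ≤ 12 * t ^ 2 := by
      refine h1.trans (le_trans (lintegral_mono fun y => ?_) h2)
      refine mul_le_mul_right ?_ _
      rw [hF2_def, enorm_indicator_eq_indicator_enorm]
      exact indicator_le_self _ _ _
    have h4 : 12 * t ^ 2 ≤ (4 * t) ^ 2 := by
      calc 12 * t ^ 2 ≤ 16 * t ^ 2 := by gcongr; norm_num
        _ = _ := by ring
    calc _ ≤ rt ((4 * t) ^ 2) := rt_mono (h3.trans h4)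
      _ = _ := rt_sq _
  set c₀ := rt ‖cauchyT ε F2 c‖ₑ with hc₀
  have hc₀l : c₀ ≤ 2 * l := by
    have h1 : c₀ * V ≤ (2 * l) * V := by
      calc c₀ * V = ∫⁻ x in Ioo p.1 p.2, c₀ := by rw [setLIntegral_const, hvol]
        _ ≤ ∫⁻ x in Ioo p.1 p.2, (4 * t + rt ‖cauchyT ε F x‖ₑ) + rt ‖cauchyT ε F1 x‖ₑ := by
          refine setLIntegral_mono' measurableSet_Ioo fun x hx => ?_
          have e : cauchyT ε F2 c = (cauchyT ε F2 c - cauchyT ε F2 x) + cauchyT ε F x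
              - cauchyT ε F1 x := by rw [hsum x]; abel
          have h2 := hosc x hx
          rw [← enorm_neg, neg_sub] at h2
          calc c₀ ≤ rt (‖cauchyT ε F2 c - cauchyT ε F2 x‖ₑ + ‖cauchyT ε F x‖ₑ
                + ‖cauchyT ε F1 x‖ₑ) := by
                refine rt_mono ?_
                conv_lhs => rw [e]
                exact (enorm_sub_le).trans (add_le_add (enorm_add_le _ _) le_rfl)
            _ ≤ _ := (rt_add_le _ _).trans (add_le_add ((rt_add_le _ _).trans
                (add_le_add h2 le_rfl)) le_rfl)
        _ = 4 * t * V + (∫⁻ x in Ioo p.1 p.2, rt ‖cauchyT ε F x‖ₑ) +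
            ∫⁻ x in Ioo p.1 p.2, rt ‖cauchyT ε F1 x‖ₑ := by
          have hms : Measurable fun x => rt ‖cauchyT ε F1 x‖ₑ :=
            continuous_rt.measurable.comp (hgm hF1)
          rw [lintegral_add_right _ hms,
            lintegral_add_left measurable_const, setLIntegral_const, hvol]
        _ ≤ 4 * t * V + l * V + 793 * t * V := by gcongr
        _ = (797 * t + l) * V := by ring
        _ ≤ (1000 * t + l) * V := by gcongr; norm_num
        _ ≤ (l + l) * V := by gcongr
        _ = _ := by rw [two_mul]
    exact (ENNReal.mul_le_mul_iff_left hV0 hVt).1 h1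
  have hg : ∀ x ∈ Ioo p.1 p.2, rt ‖cauchyT ε F x‖ₑ ≤ 3 * l + rt ‖cauchyT ε F1 x‖ₑ := by
    intro x hx
    have e : cauchyT ε F x = (cauchyT ε F2 x - cauchyT ε F2 c) + cauchyT ε F2 c
        + cauchyT ε F1 x := by rw [hsum x]; abel
    calc rt ‖cauchyT ε F x‖ₑ ≤ rt (‖cauchyT ε F2 x - cauchyT ε F2 c‖ₑ + ‖cauchyT ε F2 c‖ₑ
          + ‖cauchyT ε F1 x‖ₑ) := by
          refine rt_mono ?_
          conv_lhs => rw [e]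
          exact (enorm_add_le _ _).trans (add_le_add (enorm_add_le _ _) le_rfl)
      _ ≤ 4 * t + c₀ + rt ‖cauchyT ε F1 x‖ₑ := (rt_add_le _ _).trans (add_le_add
          ((rt_add_le _ _).trans (add_le_add (hosc x hx) le_rfl)) le_rfl)
      _ ≤ 1000 * t + 2 * l + rt ‖cauchyT ε F1 x‖ₑ := by gcongr; norm_num
      _ ≤ l + 2 * l + rt ‖cauchyT ε F1 x‖ₑ := by gcongr
      _ = _ := by ring
  have hsub : Ioo p.1 p.2 ∩ lev α β (fun x => rt ‖cauchyT ε F x‖ₑ) (16 * l) ⊆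
      lev p.1 p.2 (fun x => rt ‖cauchyT ε F1 x‖ₑ) l := by
    intro x hx
    have hl16 : l ≤ 16 * l := le_mul_of_one_le_left' (by norm_num)
    obtain ⟨a, b, h1, h2, h3, h4, h5⟩ := mem_lev.1 (lev_inter_comp_subset hl16 hp ⟨hx.2, hx.1⟩)
    refine mem_lev.2 ⟨a, b, h1, h2, h3, ?_, h5⟩
    by_contra! hle
    refine absurd h4 (not_lt.2 ?_)
    calc ∫⁻ x in Ioo a b, rt ‖cauchyT ε F x‖ₑ
        ≤ ∫⁻ x in Ioo a b, (3 * l + rt ‖cauchyT ε F1 x‖ₑ) :=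
          setLIntegral_mono' measurableSet_Ioo fun x hx => hg x (Ioo_subset_Ioo h1 h3 hx)
      _ = 3 * l * ENNReal.ofReal (b - a) + ∫⁻ x in Ioo a b, rt ‖cauchyT ε F1 x‖ₑ := by
          rw [lintegral_add_left measurable_const, setLIntegral_const, Real.volume_Ioo]
      _ ≤ 3 * l * ENNReal.ofReal (b - a) + l * ENNReal.ofReal (b - a) := by gcongr
      _ = 4 * (l * ENNReal.ofReal (b - a)) := by ring
      _ ≤ 16 * (l * ENNReal.ofReal (b - a)) := by gcongr; norm_num
      _ = _ := by ring
  refine (measure_mono hsub).trans ?_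
  refine (ENNReal.mul_le_mul_iff_right hl hl').1 ?_
  calc _ ≤ 6 * ∫⁻ x in Ioo p.1 p.2, rt ‖cauchyT ε F1 x‖ₑ := mul_volume_lev_le _ _ _ hl hl'
    _ ≤ 6 * (793 * t * V) := by gcongr
    _ = l * (4758 * δ * V) := by rw [ht_def]; ring

end

section

open scoped NNReal

/-- Integral powers of `16`, the square roots of `pz`. -/
def sz (n : ℤ) : ℝ≥0∞ := 16 ^ n

lemma sz_add (m n : ℤ) : sz (m + n) = sz m * sz n :=
  ENNReal.zpow_add (by norm_num) (by norm_num) m n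

lemma sz_ne_zero (n : ℤ) : sz n ≠ 0 := (ENNReal.zpow_pos (by norm_num) (by norm_num) n).ne'

lemma sz_ne_top (n : ℤ) : sz n ≠ ∞ := (ENNReal.zpow_lt_top (by norm_num) (by norm_num) n).ne

lemma sz_mono {m n : ℤ} (h : m ≤ n) : sz m ≤ sz n := ENNReal.zpow_le_of_le (by norm_num) h

lemma sz_one : sz 1 = 16 := zpow_one _

lemma sz_neg_natCast (n : ℕ) : sz (-n) = 16⁻¹ ^ n := by
  rw [sz, ENNReal.zpow_neg, zpow_natCast, ENNReal.inv_pow]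

lemma sz_sq (n : ℤ) : sz n ^ 2 = pz n := by
  have h : ∀ m : ℕ, sz m ^ 2 = pz m := fun m => by
    rw [sz, pz, zpow_natCast, zpow_natCast, ← pow_mul, mul_comm, pow_mul]; norm_num
  obtain ⟨m, rfl | rfl⟩ := n.eq_nat_or_neg
  · exact h m
  · have h1 : sz (-m) = (sz m)⁻¹ := ENNReal.zpow_neg _ _
    have h2 : pz (-m) = (pz m)⁻¹ := ENNReal.zpow_neg _ _
    rw [h1, h2, ← h, ENNReal.inv_pow]

lemma exists_natCast_le_sz {c : ℝ≥0∞} (hc : c ≠ ∞) : ∃ a : ℕ, c ≤ sz a := by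
  obtain ⟨n, hn⟩ := ENNReal.exists_nat_gt hc
  refine ⟨n, hn.le.trans ?_⟩
  rw [sz, zpow_natCast]
  exact_mod_cast (Nat.lt_pow_self (by norm_num : 1 < 16)).le

lemma exists_mul_inv_pow_le {c e : ℝ≥0∞} (hc : c ≠ ∞) (he : 0 < e) {q : ℝ≥0∞} (hq : q < 1) :
    ∃ n : ℕ, c * q ^ n ≤ e := by
  have h : Tendsto (fun n : ℕ => c * q ^ n) atTop (nhds (c * 0)) :=
    ENNReal.Tendsto.const_mul (ENNReal.tendsto_pow_atTop_nhds_zero_of_lt_one hq) (Or.inr hc)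
  rw [mul_zero] at h
  obtain ⟨n, hn⟩ := (h.eventually (gt_mem_nhds he)).exists
  exact ⟨n, hn.le⟩

lemma measure_le_of_eventually_mem {X : Type*} [MeasurableSpace X] {ν : Measure X}
    {A : ℕ → Set X} {S : Set X} {B : ℝ≥0∞} (h : ∀ x ∈ S, ∀ᶠ m in atTop, x ∈ A m)
    (hB : ∀ᶠ m in atTop, ν (A m) ≤ B) : ν S ≤ B := by
  have hmono : Monotone fun n : ℕ => ⋂ m ≥ n, A m := fun i j hij =>
    biInter_subset_biInter_left fun m hm => le_trans hij hm
  calc ν S ≤ ν (⋃ n : ℕ, ⋂ m ≥ n, A m) := measure_mono fun x hx => by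
        obtain ⟨n, hn⟩ := eventually_atTop.1 (h x hx)
        exact mem_iUnion.2 ⟨n, mem_iInter₂.2 hn⟩
    _ = ⨆ n : ℕ, ν (⋂ m ≥ n, A m) := hmono.measure_iUnion
    _ ≤ B := by
      refine iSup_le fun n => ?_
      obtain ⟨m, hm, hnm⟩ := (hB.and (eventually_ge_atTop n)).exists
      exact (measure_mono (biInter_subset_of_mem hnm)).trans hm

lemma exists_cauchyT_bound {H : Type*} [NormedAddCommGroup H] [InnerProductSpace ℂ H]
    {ε : ℝ} (hε : 0 < ε) {F : ℝ → H} (hF : Integrable F) :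
    ∃ k : ℤ, ∀ x, rt ‖cauchyT ε F x‖ₑ ≤ sz k := by
  obtain ⟨a, ha⟩ := exists_natCast_le_sz (c := rt (ENNReal.ofReal (ε⁻¹ * ∫ y, ‖F y‖)))
    (rt_ne_top ENNReal.ofReal_ne_top)
  refine ⟨a, fun x => (rt_mono ?_).trans ha⟩
  rw [← ofReal_norm]
  exact ENNReal.ofReal_le_ofReal (norm_cauchyT_le hε hF x)

/-- Mixed weak type inequality for `cauchyT ε`, in stratified form. -/
theorem exists_lay_cauchyT_le {Cu Cn : ℝ≥0} (hCu : 1 ≤ Cu) (hCn : 1 ≤ Cn) :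
    ∃ C : ℝ≥0∞, C ≠ ∞ ∧ ∀ (H : Type) [NormedAddCommGroup H] [InnerProductSpace ℂ H]
      [CompleteSpace H] (U N : ℝ → ℝ≥0∞) (F : ℝ → H), IsA1 Cu U → IsA1 Cn N → Integrable F →
      ∀ (ε α β : ℝ) (k₀ : ℤ), 0 < ε → (∀ x, ‖F x‖ₑ ≤ pz k₀) → (∀ x, x ∉ Ioo α β → F x = 0) →
      ∀ n, pz n * dens N (lay U N (fun k => lev α β (fun x => rt ‖cauchyT ε F x‖ₑ) (sz k)) n) ≤
        C * ∫⁻ x, ‖F x‖ₑ * U x := by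
  obtain ⟨L, ω, hω, h⟩ := exists_stratified_good_lambda hCu Cn
  obtain ⟨CM, hCM, hM⟩ := exists_lay_maximal_le hCu Cn
  have hω2 : 0 < ω / 2 := ENNReal.div_pos hω.ne' (by norm_num)
  obtain ⟨j, hj⟩ := exists_mul_inv_pow_le (c := 1) (by norm_num) hω2
    (q := contr Cn) (by exact_mod_cast contr_lt_one hCn)
  rw [one_mul] at hj
  obtain ⟨s, hs⟩ := exists_mul_inv_pow_le (c := 16 ^ j * 4758 + 1000)
    (by exact ENNReal.add_ne_top.2 ⟨ENNReal.mul_ne_top (by simp) (by simp), by simp⟩)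
    (lt_min hω2 one_pos) (q := 16⁻¹) (ENNReal.inv_lt_one.2 (by norm_num))
  rw [← sz_neg_natCast] at hs
  have hs1 : 16 ^ j * (4758 * sz (-s)) ≤ ω / 2 := by
    refine le_trans ?_ (hs.trans (min_le_left _ _))
    rw [← mul_assoc]
    exact mul_le_mul_left le_self_add _
  have hs2 : sz (-s) ≤ 1000⁻¹ := by
    rw [ENNReal.le_inv_iff_mul_le, mul_comm]
    refine le_trans ?_ (hs.trans (min_le_right _ _))
    exact mul_le_mul_left le_add_self _
  refine ⟨2 * (pz (s + 1) * CM), ENNReal.mul_ne_top (by simp)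
    (ENNReal.mul_ne_top (pz_ne_top _) hCM), ?_⟩
  intro H _ _ _ U N F hU hN hF ε α β k₀ hε hFb hF0 n
  set g : ℝ → ℝ≥0∞ := fun x => rt ‖cauchyT ε F x‖ₑ with hg
  set f : ℝ → ℝ≥0∞ := fun x => ‖F x‖ₑ with hf
  obtain ⟨k₁, hk₁⟩ := exists_cauchyT_bound hε hF
  set Z : ℤ → Set ℝ := fun n => lay U N (fun k => lev α β f (pz k)) (n - s - 1) with hZ
  refine (h U N hU hN α β (fun k => lev α β g (sz k)) Z k₁
    (fun k => isOpen_lev _ _ _ _) (fun k => lev_subset _ _ _ _)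
    (fun i j hij => lev_anti (sz_mono hij))
    (fun k hk => lev_eq_empty fun x => (hk₁ x).trans (sz_mono hk))
    (fun n => measurableSet_lay hU hN (fun k => isOpen_lev _ _ _ _) _) ?_
    (pz (s + 1) * CM * ∫⁻ x, f x * U x) ?_ n).trans (le_of_eq (by ring))
  · intro n k p hp _
    set E := (strat U N (k + 1) ∩ lev α β g (sz (k + 1 + n))) \ Z n with hE
    rcases (Ioo p.1 p.2 ∩ E).eq_empty_or_nonempty with he | ⟨x₀, hx₀p, ⟨hx₀s, -⟩, hx₀Z⟩
    · rw [he, measure_empty]; exact zero_le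
    have hl : sz (k + 1 + n) = 16 * sz (k + n) := by
      rw [← sz_one, ← sz_add]; congr 1; ring
    have hn : x₀ ∉ lev α β f ((sz (-s) * sz (k + n)) ^ 2) := by
      intro hx
      refine hx₀Z (mem_iUnion.2 ⟨k + 1, hx₀s, ?_⟩)
      rw [← sz_add, sz_sq] at hx
      have e : k + 1 + (n - s - 1) = -s + (k + n) := by ring
      show x₀ ∈ lev α β f (pz (k + 1 + (n - s - 1)))
      rwa [e]
    have hgl := volume_inter_lev_cauchyT_le hε hF hF0 (sz_ne_zero (-s)) hs2 (sz_ne_zero (k + n))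
      (sz_ne_top _) hp hx₀p hn
    rw [← hl] at hgl
    calc dens N (Ioo p.1 p.2 ∩ E)
        ≤ dens N (Ioo p.1 p.2 ∩ lev α β g (sz (k + 1 + n))) :=
          measure_mono fun x hx => ⟨hx.1, hx.2.1.2⟩
      _ ≤ ((contr Cn : ℝ≥0∞) ^ j + 16 ^ j * (4758 * sz (-s))) * dens N (Ioo p.1 p.2) :=
          hN.dens_inter_le_of_volume_le hp.1 (isOpen_lev _ _ _ _).measurableSet hgl j
      _ ≤ (ω / 2 + ω / 2) * dens N (Ioo p.1 p.2) := mul_le_mul_left (add_le_add hj hs1) _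
      _ = _ := by rw [ENNReal.add_halves]
  · intro n
    have e : n = (s + 1) + (n - s - 1) := by ring
    calc pz n * dens N (Z n) = pz (s + 1) * (pz (n - s - 1) * dens N (Z n)) := by
          rw [← mul_assoc, ← pz_add, ← e]
      _ ≤ pz (s + 1) * (CM * ∫⁻ x in Ioo α β, f x * U x) :=
          mul_le_mul_right (hM U N f hU hN α β k₀ hFb _) _
      _ ≤ pz (s + 1) * (CM * ∫⁻ x, f x * U x) :=
          mul_le_mul_right (mul_le_mul_right (setLIntegral_le_lintegral _ _) _) _
      _ = _ := by ring

/-- Mixed weak type inequality for `cauchyT ε`. -/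
theorem exists_dens_cauchyT_le {Cu Cn : ℝ≥0} (hCu : 1 ≤ Cu) (hCn : 1 ≤ Cn) :
    ∃ C : ℝ≥0∞, C ≠ ∞ ∧ ∀ (H : Type) [NormedAddCommGroup H] [InnerProductSpace ℂ H]
      [CompleteSpace H] (U N : ℝ → ℝ≥0∞) (F : ℝ → H), IsA1 Cu U → IsA1 Cn N → Integrable F →
      StronglyMeasurable F → ∀ (ε : ℝ) (τ : ℝ≥0∞), 0 < ε → τ ≠ 0 → τ ≠ ∞ →
      τ * dens N {x | τ * N x < U x * ‖cauchyT ε F x‖ₑ} ≤ C * ∫⁻ x, ‖F x‖ₑ * U x := by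
  obtain ⟨C, hC, h⟩ := exists_lay_cauchyT_le hCu hCn
  refine ⟨256 * C, ENNReal.mul_ne_top (by simp) hC, ?_⟩
  intro H _ _ _ U N F hU hN hF hFm ε τ hε hτ hτ'
  obtain ⟨n, hn1, hn2⟩ := exists_pz_mul hτ hτ' one_ne_zero ENNReal.one_ne_top
  rw [mul_one] at hn1 hn2
  have hn3 : τ ≤ 256 * pz n := by
    rw [pz_add] at hn2
    refine hn2.trans_eq ?_
    rw [mul_comm]
    congr 1
    exact zpow_one _
  have hN' : dens N ≪ volume := withDensity_absolutelyContinuous _ _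
  set S : (ℝ → H) → Set ℝ := fun G => {x | pz n * N x < U x * ‖cauchyT ε G x‖ₑ} with hS
  -- bounded functions with bounded support
  have hb : ∀ G : ℝ → H, Integrable G → ∀ (α β : ℝ) (k₀ : ℤ), (∀ x, ‖G x‖ₑ ≤ pz k₀) →
      (∀ x, x ∉ Ioo α β → G x = 0) →
      dens N (S G ∩ Ioo α β) ≤ pz (-n) * (C * ∫⁻ x, ‖G x‖ₑ * U x) := by
    intro G hG α β k₀ hGb hG0
    have h1 := h H U N G hU hN hG ε α β k₀ hε hGb hG0 n
    set g : ℝ → ℝ≥0∞ := fun x => rt ‖cauchyT ε G x‖ₑ with hg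
    have hgm : AEMeasurable g :=
      (continuous_rt.comp (continuous_cauchyT hε hG).enorm).measurable.aemeasurable
    obtain ⟨k₁, hk₁⟩ := exists_cauchyT_bound hε hG
    have hfin : ∫⁻ x in Ioo α β, g x ≠ ∞ := by
      refine ne_top_of_le_ne_top ?_ (lintegral_mono fun x => hk₁ x)
      rw [setLIntegral_const, Real.volume_Ioo]
      exact ENNReal.mul_ne_top (sz_ne_top _) ENNReal.ofReal_ne_top
    have hae : ∀ᵐ x, ∀ k : ℤ, x ∈ Ioo α β → x ∉ lev α β g (sz k) → g x ≤ sz k :=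
      ae_all_iff.2 fun k => ae_le_of_notMem_lev hgm hfin (sz k)
    have h2 : dens N (S G ∩ Ioo α β) ≤ dens N (lay U N (fun k => lev α β g (sz k)) n) := by
      refine measure_mono_ae ?_
      filter_upwards [hN'.ae_le hae] with x hx
      rintro ⟨hxS, hxI⟩
      have hxS' : pz n * N x < U x * ‖cauchyT ε G x‖ₑ := hxS
      obtain ⟨k, hk⟩ := exists_mem_strat hU hN x
      have hk1 : pz k * U x < N x := hk.1
      refine mem_iUnion.2 ⟨k, hk, ?_⟩
      by_contra hnot
      have h3 : g x ≤ sz (k + n) := hx _ hxI hnot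
      have h4 : ‖cauchyT ε G x‖ₑ ≤ pz (k + n) := by
        rw [← sz_sq, ← sq_rt ‖cauchyT ε G x‖ₑ]
        exact pow_le_pow_left₀ zero_le h3 2
      refine absurd hxS' (not_lt.2 ?_)
      calc U x * ‖cauchyT ε G x‖ₑ ≤ U x * pz (k + n) := mul_le_mul_right h4 _
        _ = pz n * (pz k * U x) := by rw [pz_add]; ring
        _ ≤ pz n * N x := mul_le_mul_right hk1.le _
    calc dens N (S G ∩ Ioo α β) ≤ dens N (lay U N (fun k => lev α β g (sz k)) n) := h2
      _ = pz (-n) * (pz n * dens N (lay U N (fun k => lev α β g (sz k)) n)) := by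
        rw [← mul_assoc, mul_comm (pz (-n)), pz_mul_pz_neg, one_mul]
      _ ≤ _ := mul_le_mul_right h1 _
  -- truncation
  set G : ℕ → ℝ → H := fun m => (Ioo (-m : ℝ) m ∩ {x | ‖F x‖ ≤ m}).indicator F with hGdef
  have hms : ∀ m : ℕ, MeasurableSet (Ioo (-m : ℝ) m ∩ {x | ‖F x‖ ≤ m}) := fun m =>
    measurableSet_Ioo.inter (measurableSet_le hFm.norm.measurable measurable_const)
  have hGi : ∀ m, Integrable (G m) := fun m => hF.indicator (hms m)
  have hev : ∀ x, ∀ᶠ m : ℕ in atTop, x ∈ Ioo (-m : ℝ) m ∩ {x | ‖F x‖ ≤ m} := by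
    intro x
    filter_upwards [tendsto_natCast_atTop_atTop.eventually (eventually_gt_atTop |x|),
      tendsto_natCast_atTop_atTop.eventually (eventually_ge_atTop ‖F x‖)] with m h1 h2
    exact ⟨abs_lt.1 h1, h2⟩
  have hlim : ∀ x, Tendsto (fun m => cauchyT ε (G m) x) atTop (nhds (cauchyT ε F x)) := by
    intro x
    refine tendsto_integral_of_dominated_convergence (fun y => ‖cauchyK ε (x - y) • F y‖)
      (fun m => (integrable_cauchyK_smul hε (hGi m) x).1)
      (integrable_cauchyK_smul hε hF x).norm (fun m => ae_of_all _ fun y => ?_)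
      (ae_of_all _ fun y => ?_)
    · rw [norm_smul, norm_smul]
      exact mul_le_mul_of_nonneg_left (norm_indicator_le_norm_self _ _) (norm_nonneg _)
    · refine tendsto_const_nhds.congr' ?_
      filter_upwards [hev y] with m hm
      rw [hGdef]
      simp only [indicator_of_mem hm]
  have key : dens N (S F) ≤ pz (-n) * (C * ∫⁻ x, ‖F x‖ₑ * U x) := by
    refine measure_le_of_eventually_mem (A := fun m : ℕ => S (G m) ∩ Ioo (-m : ℝ) m) ?_ ?_
    · intro x hx
      have hx' : pz n * N x < U x * ‖cauchyT ε F x‖ₑ := hx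
      have h1 : Tendsto (fun m => U x * ‖cauchyT ε (G m) x‖ₑ) atTop
          (nhds (U x * ‖cauchyT ε F x‖ₑ)) :=
        ENNReal.Tendsto.const_mul (hlim x).enorm (Or.inr (hU.ne_top x))
      filter_upwards [h1.eventually (lt_mem_nhds hx'), hev x] with m h2 h3
      exact ⟨h2, h3.1⟩
    · refine Eventually.of_forall fun m => ?_
      obtain ⟨k₀, hk₀⟩ := exists_natCast_le_pz (c := (m : ℝ≥0∞)) (by simp)
      refine (hb (G m) (hGi m) (-m) m k₀ (fun x => ?_) (fun x hx => ?_)).trans ?_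
      · by_cases hx : x ∈ Ioo (-m : ℝ) m ∩ {x | ‖F x‖ ≤ m}
        · rw [hGdef]
          simp only [indicator_of_mem hx]
          refine le_trans ?_ hk₀
          rw [← ofReal_norm, ← ENNReal.ofReal_natCast]
          exact ENNReal.ofReal_le_ofReal hx.2
        · rw [hGdef]
          simp only [indicator_of_notMem hx, enorm_zero]
          exact zero_le
      · exact indicator_of_notMem (fun h => hx h.1) _
      · refine mul_le_mul_right (mul_le_mul_right (lintegral_mono fun x => mul_le_mul_left ?_ _) _) _
        rw [hGdef]
        simp only [enorm_indicator_eq_indicator_enorm]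
        exact indicator_le_self _ _ _
  calc τ * dens N {x | τ * N x < U x * ‖cauchyT ε F x‖ₑ} ≤ τ * dens N (S F) := by
        refine mul_le_mul_right (measure_mono fun x hx => ?_) _
        exact lt_of_le_of_lt (mul_le_mul_left hn1.le _) hx
    _ ≤ 256 * pz n * (pz (-n) * (C * ∫⁻ x, ‖F x‖ₑ * U x)) := mul_le_mul' hn3 key
    _ = (pz n * pz (-n)) * (256 * C * ∫⁻ x, ‖F x‖ₑ * U x) := by ring
    _ = _ := by rw [pz_mul_pz_neg, one_mul]

end

section

open scoped NNReal

lemma IsA1.mono {C D : ℝ≥0} {U : ℝ → ℝ≥0∞} (hU : IsA1 C U) (h : C ≤ D) : IsA1 D U where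
  one_le := hU.one_le.trans h
  measurable := hU.measurable
  ne_zero := hU.ne_zero
  ne_top := hU.ne_top
  le a b hab := by
    filter_upwards [hU.le a b hab] with x hx hxI
    refine (hx hxI).trans ?_
    gcongr

lemma rt_mul (x y : ℝ≥0∞) : rt (x * y) = rt x * rt y :=
  ENNReal.mul_rpow_of_nonneg x y (by norm_num)

lemma rt_mul_self (x : ℝ≥0∞) : rt x * rt x = x := by rw [← sq, sq_rt]

lemma rt_ne_zero {x : ℝ≥0∞} (h : x ≠ 0) : rt x ≠ 0 := fun h0 => h (by rw [← sq_rt x, h0]; simp)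

lemma lintegral_rt_mul_rt_le {μ : Measure ℝ} {f g : ℝ → ℝ≥0∞} (hf : Measurable f)
    (hg : Measurable g) : ∫⁻ x, rt (f x) * rt (g x) ∂μ ≤ rt (∫⁻ x, f x ∂μ) * rt (∫⁻ x, g x ∂μ) := by
  have h := ENNReal.lintegral_mul_le_Lp_mul_Lq μ Real.HolderConjugate.two_two
    (continuous_rt.measurable.comp hf).aemeasurable (continuous_rt.measurable.comp hg).aemeasurable
  have e : ∀ x : ℝ≥0∞, rt x ^ (2 : ℝ) = x := fun x => by
    rw [ENNReal.rpow_two, sq_rt]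
  simp only [Function.comp_apply, Pi.mul_apply, e] at h
  exact h

/-- The geometric mean of two `A₁` weights is an `A₁` weight. -/
lemma IsA1.rt_mul_rt {C : ℝ≥0} {U V : ℝ → ℝ≥0∞} (hU : IsA1 C U) (hV : IsA1 C V) :
    IsA1 C fun x => rt (U x) * rt (V x) where
  one_le := hU.one_le
  measurable := (continuous_rt.measurable.comp hU.measurable).mul
    (continuous_rt.measurable.comp hV.measurable)
  ne_zero x := mul_ne_zero (rt_ne_zero (hU.ne_zero x)) (rt_ne_zero (hV.ne_zero x))
  ne_top x := ENNReal.mul_ne_top (rt_ne_top (hU.ne_top x)) (rt_ne_top (hV.ne_top x))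
  le a b hab := by
    filter_upwards [hU.le a b hab, hV.le a b hab] with x hx hx' hxI
    calc ∫⁻ y in Ioo a b, rt (U y) * rt (V y)
        ≤ rt (∫⁻ y in Ioo a b, U y) * rt (∫⁻ y in Ioo a b, V y) :=
          lintegral_rt_mul_rt_le hU.measurable hV.measurable
      _ ≤ rt (C * ENNReal.ofReal (b - a) * U x) * rt (C * ENNReal.ofReal (b - a) * V x) :=
          mul_le_mul' (rt_mono (hx hxI)) (rt_mono (hx' hxI))
      _ = (rt (C * ENNReal.ofReal (b - a)) * rt (C * ENNReal.ofReal (b - a))) *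
          (rt (U x) * rt (V x)) := by rw [rt_mul _ (U x), rt_mul _ (V x)]; ring
      _ = _ := by rw [rt_mul_self]

/-- Every `A₁` weight agrees almost everywhere with one that is measurable and takes values in
`(0, ∞)` everywhere. -/
lemma MemA1R.exists_isA1 {w : ℝ → ℝ} (hw : MemA1R w) :
    ∃ (C : ℝ≥0) (U : ℝ → ℝ≥0∞), IsA1 C U ∧ (fun x => ENNReal.ofReal (w x)) =ᵐ[volume] U := by
  obtain ⟨⟨hloc, hpos⟩, hA⟩ := hw
  obtain ⟨c, hc, hct⟩ := sInf_lt_iff.1 hA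
  have hc' : ∀ᵐ x : ℝ, maxOpR w x ≤ c * ENNReal.ofReal (w x) := hc
  have hm := hloc.aestronglyMeasurable.aemeasurable
  set w' := hm.mk w with hw'
  have hUm : Measurable fun x => if 0 < w' x then ENNReal.ofReal (w' x) else 1 :=
    Measurable.ite (measurableSet_lt measurable_const hm.measurable_mk)
      hm.measurable_mk.ennreal_ofReal measurable_const
  have hae : (fun x => ENNReal.ofReal (w x)) =ᵐ[volume]
      fun x => if 0 < w' x then ENNReal.ofReal (w' x) else 1 := by
    filter_upwards [hm.ae_eq_mk, hpos] with x hx hx0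
    rw [if_pos (by rw [hw', ← hx]; exact hx0), hx]
  refine ⟨max 1 c.toNNReal, _, ⟨le_max_left _ _, hUm, fun x => ?_, fun x => ?_, ?_⟩, hae⟩
  · split_ifs with h
    · simpa using h
    · exact one_ne_zero
  · split_ifs
    · exact ENNReal.ofReal_ne_top
    · exact ENNReal.one_ne_top
  intro a b hab
  filter_upwards [hc', hae] with x hx hxU hxI
  have hxU' : ENNReal.ofReal (w x) = if 0 < w' x then ENNReal.ofReal (w' x) else 1 := hxU
  rw [← hxU']
  have h1 : (∫⁻ y in Icc a b, ENNReal.ofReal |w y|) / volume (Icc a b) ≤ maxOpR w x :=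
    le_iSup_of_le a (le_iSup_of_le b (le_iSup_of_le hab
      (le_iSup_of_le (Ioo_subset_Icc_self hxI) le_rfl)))
  have hV0 : ENNReal.ofReal (b - a) ≠ 0 := by simpa using hab
  rw [Real.volume_Icc] at h1
  have h2 := (ENNReal.div_le_iff hV0 ENNReal.ofReal_ne_top).1 (h1.trans hx)
  calc _ = ∫⁻ y in Ioo a b, ENNReal.ofReal (w y) :=
        lintegral_congr_ae (ae_restrict_of_ae (hae.mono fun y hy => hy.symm))
    _ ≤ ∫⁻ y in Icc a b, ENNReal.ofReal |w y| :=
        lintegral_mono' (Measure.restrict_mono Ioo_subset_Icc_self le_rfl)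
          fun y => ENNReal.ofReal_le_ofReal (le_abs_self _)
    _ ≤ c * ENNReal.ofReal (w x) * ENNReal.ofReal (b - a) := h2
    _ = c * ENNReal.ofReal (b - a) * ENNReal.ofReal (w x) := by ring
    _ ≤ _ := by
      refine mul_le_mul_left (mul_le_mul_left ?_ _) _
      rw [← ENNReal.coe_toNNReal hct.ne]
      exact_mod_cast le_max_right _ _

/-- Balancing the two terms in a weak type estimate for a product. -/
lemma le_rt_of_forall {X Y τ v : ℝ≥0∞} (hX : X ≠ 0) (hX' : X ≠ ∞) (hY : Y ≠ 0) (hY' : Y ≠ ∞)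
    (hτ : τ ≠ 0) (hτ' : τ ≠ ∞)
    (h : ∀ a b : ℝ≥0∞, a ≠ 0 → a ≠ ∞ → b ≠ 0 → b ≠ ∞ → a * b = τ →
      ∃ v₁ v₂, v ≤ v₁ + v₂ ∧ a * v₁ ≤ X ∧ b * v₂ ≤ Y) : v ≤ rt (4 * (X * Y) / τ) := by
  have key : ∀ {X Y u : ℝ≥0∞}, X ≠ 0 → X ≠ ∞ → Y ≠ 0 → Y ≠ ∞ → rt (τ * (X / Y)) * u ≤ X →
      2 * u ≤ rt (4 * (X * Y) / τ) := by
    intro X Y u hX hX' hY hY' hu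
    have h1 := pow_le_pow_left₀ zero_le hu 2
    rw [mul_pow, sq_rt] at h1
    rw [← rt_sq (2 * u)]
    refine rt_mono ((ENNReal.le_div_iff_mul_le (Or.inl hτ) (Or.inl hτ')).2 ?_)
    refine (ENNReal.mul_le_mul_iff_right hX hX').1 ?_
    calc X * ((2 * u) ^ 2 * τ) = (X / Y * Y) * ((2 * u) ^ 2 * τ) := by
          rw [ENNReal.div_mul_cancel hY hY']
      _ = 4 * Y * (τ * (X / Y) * u ^ 2) := by ring
      _ ≤ 4 * Y * X ^ 2 := mul_le_mul_right h1 _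
      _ = _ := by ring
  have hXY : X / Y ≠ 0 := ENNReal.div_ne_zero.2 ⟨hX, hY'⟩
  have hYX : Y / X ≠ 0 := ENNReal.div_ne_zero.2 ⟨hY, hX'⟩
  have hXY' : X / Y ≠ ∞ := ENNReal.div_ne_top hX' hY
  have hYX' : Y / X ≠ ∞ := ENNReal.div_ne_top hY' hX
  obtain ⟨v₁, v₂, hv, h1, h2⟩ := h (rt (τ * (X / Y))) (rt (τ * (Y / X)))
    (rt_ne_zero (mul_ne_zero hτ hXY)) (rt_ne_top (ENNReal.mul_ne_top hτ' hXY'))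
    (rt_ne_zero (mul_ne_zero hτ hYX)) (rt_ne_top (ENNReal.mul_ne_top hτ' hYX')) (by
      have e : τ * (X / Y) * (τ * (Y / X)) = τ ^ 2 * ((X * X⁻¹) * (Y * Y⁻¹)) := by
        rw [div_eq_mul_inv, div_eq_mul_inv]; ring
      rw [← rt_mul, e, ENNReal.mul_inv_cancel hX hX', ENNReal.mul_inv_cancel hY hY', mul_one,
        mul_one, rt_sq])
  have k1 := key hX hX' hY hY' h1
  have k2 := key hY hY' hX hX' h2
  rw [mul_comm Y X] at k2
  rcases le_total v₁ v₂ with hle | hle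
  · exact (hv.trans (add_le_add hle le_rfl)).trans (by rwa [← two_mul])
  · exact (hv.trans (add_le_add le_rfl hle)).trans (by rwa [← two_mul])

end

section

open scoped NNReal

lemma eTerm_add (a b : ℝ) : eTerm (a + b) = eTerm a * eTerm b := by
  simp [eTerm, mul_add, Complex.exp_add]

lemma norm_eTerm (a : ℝ) : ‖eTerm a‖ = 1 := by
  rw [eTerm, mul_comm]
  exact Complex.norm_exp_ofReal_mul_I a

lemma continuous_eTerm : Continuous eTerm := by
  unfold eTerm
  fun_prop

section Character

variable {X : Type*} [MeasurableSpace X] {μ : Measure X} [IsFiniteMeasure μ] {φ : X → ℝ}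

lemma measurable_eTerm_mul (hφ : Measurable φ) (y : ℝ) :
    Measurable fun p => eTerm (-(2 * Real.pi * y * φ p)) :=
  continuous_eTerm.measurable.comp (by fun_prop)

lemma memLp_eTerm_mul (hφ : Measurable φ) (y : ℝ) :
    MemLp (fun p => eTerm (-(2 * Real.pi * y * φ p))) 2 μ :=
  MemLp.of_bound (measurable_eTerm_mul hφ y).aestronglyMeasurable 1
    (ae_of_all _ fun _ => (norm_eTerm _).le)

/-- The character `p ↦ exp (-2πiy φ(p))` as an element of `L²`. -/
def charLp (μ : Measure X) [IsFiniteMeasure μ] (hφ : Measurable φ) (y : ℝ) : Lp ℂ 2 μ :=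
  (memLp_eTerm_mul hφ y).toLp _

lemma eLpNorm_two_eq {X : Type*} [MeasurableSpace X] {μ : Measure X} (h : X → ℂ) : eLpNorm h 2 μ = rt (∫⁻ p, ‖h p‖ₑ ^ 2 ∂μ) := by
  rw [eLpNorm_eq_lintegral_rpow_enorm_toReal (by norm_num) (by norm_num), rt]
  norm_num

lemma enorm_charLp (hφ : Measurable φ) (y : ℝ) : ‖charLp μ hφ y‖ₑ = rt (μ univ) := by
  rw [charLp, Lp.enorm_toLp, eLpNorm_two_eq]
  congr 1
  have : ∀ p, ‖eTerm (-(2 * Real.pi * y * φ p))‖ₑ = 1 := fun p => by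
    rw [← ofReal_norm, norm_eTerm, ENNReal.ofReal_one]
  simp [this]

lemma continuous_charLp (hφ : Measurable φ) : Continuous (charLp μ hφ) := by
  refine continuous_iff_continuousAt.2 fun y => tendsto_nhds_iff_seq_tendsto.2 fun s hs => ?_
  refine (Lp.tendsto_Lp_iff_tendsto_eLpNorm'' (fun n p => eTerm (-(2 * Real.pi * s n * φ p)))
    (fun n => memLp_eTerm_mul hφ (s n)) _ (memLp_eTerm_mul hφ y)).2 ?_
  simp only [eLpNorm_two_eq, Pi.sub_apply]
  have h0 : rt (∫⁻ _p : X, 0 ∂μ) = 0 := by simp [rt]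
  rw [← h0]
  refine (continuous_rt.tendsto _).comp ?_
  refine tendsto_lintegral_of_dominated_convergence (fun _ => 4)
    (fun n => ((measurable_eTerm_mul hφ _).sub (measurable_eTerm_mul hφ _)).enorm.pow_const 2)
    (fun n => ae_of_all _ fun p => ?_) (by simp [ENNReal.mul_eq_top]) (ae_of_all _ fun p => ?_)
  · have h1 : ‖eTerm (-(2 * Real.pi * s n * φ p)) - eTerm (-(2 * Real.pi * y * φ p))‖ₑ ≤ 2 := by
      rw [← ofReal_norm]
      refine (ENNReal.ofReal_le_ofReal ((norm_sub_le _ _).trans ?_)).trans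
        (ENNReal.ofReal_ofNat 2).le
      rw [norm_eTerm, norm_eTerm]
      norm_num
    calc _ ≤ (2 : ℝ≥0∞) ^ 2 := pow_le_pow_left₀ zero_le h1 2
      _ = _ := by norm_num
  · have hc : Continuous fun z : ℝ =>
        ‖eTerm (-(2 * Real.pi * z * φ p)) - eTerm (-(2 * Real.pi * y * φ p))‖ₑ ^ 2 := by
      have h1 := continuous_eTerm
      have h2 : Continuous fun z : ℝ =>
        eTerm (-(2 * Real.pi * z * φ p)) - eTerm (-(2 * Real.pi * y * φ p)) := by fun_prop
      exact (ENNReal.continuous_pow 2).comp h2.enorm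
    have := (hc.tendsto y).comp hs
    simpa [Function.comp_def] using this

/-- The function `f` modulated by all the characters simultaneously. -/
def modulate (μ : Measure X) [IsFiniteMeasure μ] (hφ : Measurable φ) (f : ℝ → ℂ) (y : ℝ) :
    Lp ℂ 2 μ :=
  f y • charLp μ hφ y

lemma enorm_modulate (hφ : Measurable φ) (f : ℝ → ℂ) (y : ℝ) :
    ‖modulate μ hφ f y‖ₑ = ‖f y‖ₑ * rt (μ univ) := by
  rw [modulate, enorm_smul, enorm_charLp]

lemma stronglyMeasurable_modulate (hφ : Measurable φ) {f : ℝ → ℂ} (hf : Measurable f) :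
    StronglyMeasurable (modulate μ hφ f) :=
  hf.stronglyMeasurable.smul (continuous_charLp hφ).stronglyMeasurable

lemma integrable_modulate (hφ : Measurable φ) {f : ℝ → ℂ} (hf : Measurable f)
    (hfi : Integrable f) : Integrable (modulate μ hφ f) := by
  refine ⟨(stronglyMeasurable_modulate hφ hf).aestronglyMeasurable, ?_⟩
  rw [hasFiniteIntegral_iff_enorm]
  simp only [enorm_modulate]
  rw [lintegral_mul_const' _ _ (rt_ne_top (measure_ne_top _ _))]
  exact ENNReal.mul_lt_top hfi.2 (rt_ne_top (measure_ne_top _ _)).lt_top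

lemma cauchyT_modulate_ae_eq (hφ : Measurable φ) {f : ℝ → ℂ} (hf : Measurable f)
    (hfi : Integrable f) {ε : ℝ} (hε : 0 < ε) (x : ℝ) :
    ((cauchyT ε (modulate μ hφ f) x : Lp ℂ 2 μ) : X → ℂ) =ᵐ[μ] fun p =>
      ∫ y, cauchyK ε (x - y) * (f y * eTerm (-(2 * Real.pi * y * φ p))) := by
  have hK := (continuous_cauchyK hε).measurable
  have hE := continuous_eTerm.measurable
  set A : X → ℂ := fun p => ∫ y, cauchyK ε (x - y) * (f y * eTerm (-(2 * Real.pi * y * φ p)))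
    with hA
  have hm : Measurable fun z : X × ℝ =>
      cauchyK ε (x - z.2) * (f z.2 * eTerm (-(2 * Real.pi * z.2 * φ z.1))) := by
    have h1 : Measurable fun z : X × ℝ => φ z.1 := hφ.comp measurable_fst
    fun_prop
  have hAm : StronglyMeasurable A := by
    have h : StronglyMeasurable (Function.uncurry fun (p : X) (y : ℝ) =>
      cauchyK ε (x - y) * (f y * eTerm (-(2 * Real.pi * y * φ p)))) := hm.stronglyMeasurable
    exact h.integral_prod_right
  have hKf : Integrable fun y => cauchyK ε (x - y) * f y := by
    simpa only [smul_eq_mul] using integrable_cauchyK_smul hε hfi x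
  have hAb : ∀ p, ‖A p‖ ≤ ∫ y, ‖cauchyK ε (x - y) * f y‖ := fun p => by
    refine norm_integral_le_of_norm_le hKf.norm (ae_of_all _ fun y => ?_)
    rw [← mul_assoc, norm_mul _ (eTerm _), norm_eTerm, mul_one]
  have hAL : MemLp A 2 μ := MemLp.of_bound hAm.aestronglyMeasurable _ (ae_of_all _ hAb)
  have key : cauchyT ε (modulate μ hφ f) x = hAL.toLp A := by
    refine ext_inner_left ℂ fun v => ?_
    have hv : Integrable v μ := (Lp.memLp v).integrable (by norm_num)
    have hi := integral_inner (𝕜 := ℂ)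
      (integrable_cauchyK_smul hε (integrable_modulate (μ := μ) hφ hf hfi) x) v
    refine hi.symm.trans ?_
    rw [L2.inner_def]
    have e1 : ∀ y, inner ℂ v (cauchyK ε (x - y) • modulate μ hφ f y) =
        ∫ p, starRingEnd ℂ (v p) * (cauchyK ε (x - y) *
          (f y * eTerm (-(2 * Real.pi * y * φ p)))) ∂μ := fun y => by
      rw [modulate, inner_smul_right, inner_smul_right, L2.inner_def, ← integral_const_mul,
        ← integral_const_mul]
      refine integral_congr_ae ?_
      filter_upwards [(memLp_eTerm_mul (μ := μ) hφ y).coeFn_toLp] with p hp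
      rw [charLp, hp, RCLike.inner_apply]
      ring
    simp only [e1]
    rw [integral_integral_swap]
    · refine integral_congr_ae ?_
      filter_upwards [hAL.coeFn_toLp] with p hp
      rw [hp, RCLike.inner_apply, hA, integral_const_mul, mul_comm]
    · have hb : Integrable (fun z : ℝ × X => (cauchyK ε (x - z.1) * f z.1) *
          starRingEnd ℂ (v z.2)) (volume.prod μ) := by
        have hcv : Integrable (fun p => starRingEnd ℂ (v p)) μ :=
          Complex.conjCLE.toContinuousLinearMap.integrable_comp hv
        exact hKf.mul_prod hcv
      have hph : Measurable fun z : ℝ × X => eTerm (-(2 * Real.pi * z.1 * φ z.2)) := by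
        have h1 : Measurable fun z : ℝ × X => φ z.2 := hφ.comp measurable_snd
        fun_prop
      refine (hb.bdd_smul (1 : ℝ) hph.aestronglyMeasurable
        (ae_of_all _ fun z => (norm_eTerm _).le)).congr (ae_of_all _ fun z => ?_)
      simp only [Function.uncurry, smul_eq_mul, Pi.mul_apply]
      ring
  rw [key]
  exact hAL.coeFn_toLp

end Character

end

section

open scoped NNReal

/-- The one-sided exponential `u ↦ exp (-εu)` on `u > 0`. -/
def expK (ε u : ℝ) : ℂ := (Ioi (0 : ℝ)).indicator (fun u => (Real.exp (-(ε * u)) : ℂ)) u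

lemma measurable_expK (ε : ℝ) : Measurable (expK ε) := by
  have h : Measurable fun u : ℝ => (Real.exp (-(ε * u)) : ℂ) := by fun_prop
  exact h.indicator measurableSet_Ioi

lemma integrable_expK {ε : ℝ} (hε : 0 < ε) : Integrable (expK ε) := by
  have h := (exp_neg_integrableOn_Ioi 0 hε).ofReal (𝕜 := ℂ)
  refine ((integrable_indicator_iff measurableSet_Ioi).2 h).congr (ae_of_all _ fun u => ?_)
  simp [expK]

lemma norm_expK_le {ε : ℝ} (hε : 0 < ε) (u : ℝ) :
    ‖expK ε u‖ ≤ (Ioi (0 : ℝ)).indicator (fun _ => (1 : ℝ)) u := by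
  rw [expK]
  by_cases hu : u ∈ Ioi (0 : ℝ)
  · rw [indicator_of_mem hu, indicator_of_mem hu, Complex.norm_real, Real.norm_eq_abs,
      Real.abs_exp]
    have hu' : 0 < u := hu
    exact Real.exp_le_one_iff.2 (neg_nonpos.2 (by positivity))
  · simp [indicator_of_notMem hu]

lemma norm_expK_le_one {ε : ℝ} (hε : 0 < ε) (u : ℝ) : ‖expK ε u‖ ≤ 1 :=
  (norm_expK_le hε u).trans (indicator_le_self' (fun _ _ => zero_le_one) u)

lemma tendsto_expK {ε : ℕ → ℝ} (hε : Tendsto ε atTop (nhds 0)) (u : ℝ) :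
    Tendsto (fun n => expK (ε n) u) atTop
      (nhds ((Ioi (0 : ℝ)).indicator (fun _ => (1 : ℂ)) u)) := by
  simp only [expK]
  by_cases hu : u ∈ Ioi (0 : ℝ)
  · simp only [indicator_of_mem hu]
    have hc : Continuous fun e : ℝ => (Real.exp (-(e * u)) : ℂ) := by fun_prop
    have := (hc.tendsto 0).comp hε
    simpa [Function.comp_def] using this
  · simp only [indicator_of_notMem hu]
    exact tendsto_const_nhds

lemma integral_expK_mul_eTerm {ε : ℝ} (hε : 0 < ε) (z t : ℝ) :
    ∫ ξ, expK ε (ξ - t) * eTerm (2 * Real.pi * z * ξ) =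
      eTerm (2 * Real.pi * z * t) * cauchyK ε z := by
  have h1 := integral_sub_right_eq_self (μ := (volume : Measure ℝ))
    (fun u => expK ε u * eTerm (2 * Real.pi * z * (u + t))) t
  simp only [sub_add_cancel] at h1
  rw [h1]
  have hre : (-(ε : ℂ) + 2 * Real.pi * z * Complex.I).re < 0 := by simpa using hε
  have h2 : ∀ u, expK ε u * eTerm (2 * Real.pi * z * (u + t)) =
      eTerm (2 * Real.pi * z * t) * (Ioi (0 : ℝ)).indicator
        (fun u : ℝ => Complex.exp ((-(ε : ℂ) + 2 * Real.pi * z * Complex.I) * u)) u := by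
    intro u
    rw [expK]
    by_cases hu : u ∈ Ioi (0 : ℝ)
    · rw [indicator_of_mem hu, indicator_of_mem hu, mul_add, eTerm_add, mul_comm (eTerm _) (eTerm _),
        mul_left_comm]
      congr 1
      rw [eTerm, Complex.ofReal_exp, ← Complex.exp_add]
      congr 1
      push_cast
      ring
    · simp [indicator_of_notMem hu]
  simp only [h2]
  rw [integral_const_mul, integral_indicator measurableSet_Ioi, integral_exp_mul_complex_Ioi hre,
    cauchyK]
  congr 1
  rw [Complex.ofReal_zero, mul_zero, Complex.exp_zero, neg_div, ← div_neg, one_div]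
  congr 1
  ring

lemma norm_FT_le (f : ℝ → ℂ) (ξ : ℝ) : ‖FT f ξ‖ ≤ ∫ x, ‖f x‖ := by
  refine (norm_integral_le_integral_norm _).trans (le_of_eq ?_)
  simp [norm_eTerm]

lemma measurable_FT {f : ℝ → ℂ} (hf : Measurable f) : Measurable (FT f) := by
  have hE := continuous_eTerm.measurable
  have h : Measurable (Function.uncurry fun ξ x : ℝ => eTerm (-(2 * Real.pi * x * ξ)) * f x) := by
    unfold Function.uncurry
    fun_prop
  exact (h.stronglyMeasurable.integral_prod_right).measurable

lemma FT_eq_zero_of_not_integrable {f : ℝ → ℂ} (hf : ¬Integrable f) : FT f = 0 := by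
  ext ξ
  refine integral_undef fun h => hf ?_
  have hE := continuous_eTerm
  have hc : Continuous fun x : ℝ => eTerm (2 * Real.pi * x * ξ) := by fun_prop
  refine (h.bdd_smul (1 : ℝ) hc.aestronglyMeasurable
    (ae_of_all _ fun _ => (norm_eTerm _).le)).congr (ae_of_all _ fun x => ?_)
  simp only [Pi.smul_apply', smul_eq_mul]
  rw [← mul_assoc, ← eTerm_add, add_neg_cancel]
  simp [eTerm]

lemma FT_eq_zero_of_ae {f : ℝ → ℂ} (hf : f =ᵐ[volume] 0) : FT f = 0 := by
  ext ξ
  refine integral_eq_zero_of_ae ?_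
  filter_upwards [hf] with x hx
  simp [hx]

lemma integral_expK_mul_FT {ε : ℝ} (hε : 0 < ε) {f : ℝ → ℂ} (hfi : Integrable f) (x t : ℝ) :
    ∫ ξ, expK ε (ξ - t) * (FT f ξ * eTerm (2 * Real.pi * x * ξ)) =
      eTerm (2 * Real.pi * x * t) *
        ∫ y, cauchyK ε (x - y) * (f y * eTerm (-(2 * Real.pi * y * t))) := by
  have hE := continuous_eTerm.measurable
  have e1 : ∀ ξ, expK ε (ξ - t) * (FT f ξ * eTerm (2 * Real.pi * x * ξ)) =
      ∫ y, expK ε (ξ - t) * f y * eTerm (2 * Real.pi * (x - y) * ξ) := fun ξ => by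
    rw [FT, ← integral_mul_const, ← integral_const_mul]
    congr 1
    ext y
    rw [show 2 * Real.pi * (x - y) * ξ = -(2 * Real.pi * y * ξ) + 2 * Real.pi * x * ξ by ring,
      eTerm_add]
    ring
  simp only [e1]
  rw [integral_integral_swap, ← integral_const_mul]
  · congr 1
    ext y
    have e2 : ∀ ξ, expK ε (ξ - t) * f y * eTerm (2 * Real.pi * (x - y) * ξ) =
        f y * (expK ε (ξ - t) * eTerm (2 * Real.pi * (x - y) * ξ)) := fun ξ => by ring
    simp only [e2]
    rw [integral_const_mul, integral_expK_mul_eTerm hε,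
      show 2 * Real.pi * (x - y) * t = 2 * Real.pi * x * t + -(2 * Real.pi * y * t) by ring,
      eTerm_add]
    ring
  · have hb : Integrable (fun z : ℝ × ℝ => expK ε (z.1 - t) * f z.2) (volume.prod volume) :=
      ((integrable_expK hε).comp_sub_right t).mul_prod hfi
    have hph : Measurable fun z : ℝ × ℝ => eTerm (2 * Real.pi * (x - z.2) * z.1) := by fun_prop
    refine (hb.bdd_smul (1 : ℝ) hph.aestronglyMeasurable
      (ae_of_all _ fun z => (norm_eTerm _).le)).congr (ae_of_all _ fun z => ?_)
    simp only [Function.uncurry, smul_eq_mul, Pi.mul_apply]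
    ring

/-- The regularized symbol. -/
def mSymbReg (μ : Measure (ℝ × ℝ)) (ε : ℝ) (p : ℝ × ℝ) : ℂ :=
  ∫ q, expK ε (p.1 - q.1) * expK ε (p.2 - q.2) ∂μ

/-- The bilinear multiplier operator with the regularized symbol. -/
def BmReg (μ : Measure (ℝ × ℝ)) (ε : ℝ) (f g : ℝ → ℂ) (x : ℝ) : ℂ :=
  ∫ p : ℝ × ℝ, mSymbReg μ ε p * FT f p.1 * FT g p.2 * eTerm (2 * Real.pi * x * (p.1 + p.2))

lemma mSymb_eq_integral (μ : Measure (ℝ × ℝ)) (p : ℝ × ℝ) : (mSymb μ p.1 p.2 : ℂ) =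
    ∫ q, (Ioi (0 : ℝ)).indicator (fun _ => (1 : ℂ)) (p.1 - q.1) *
      (Ioi (0 : ℝ)).indicator (fun _ => (1 : ℂ)) (p.2 - q.2) ∂μ := by
  have h : ∀ q : ℝ × ℝ, (Ioi (0 : ℝ)).indicator (fun _ => (1 : ℂ)) (p.1 - q.1) *
      (Ioi (0 : ℝ)).indicator (fun _ => (1 : ℂ)) (p.2 - q.2) =
      (Iio p.1 ×ˢ Iio p.2).indicator (fun _ => (1 : ℂ)) q := by
    intro q
    simp only [indicator_apply, mem_Ioi, sub_pos, mem_prod, mem_Iio]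
    split_ifs <;> simp_all
  simp only [h]
  rw [integral_indicator (measurableSet_Iio.prod measurableSet_Iio)]
  simp [mSymb, Measure.real]

section Regularization

variable {μ : Measure (ℝ × ℝ)} [IsFiniteMeasure μ]

lemma measurable_expK_mul_expK (ε : ℝ) : Measurable fun z : (ℝ × ℝ) × (ℝ × ℝ) =>
    expK ε (z.1.1 - z.2.1) * expK ε (z.1.2 - z.2.2) := by
  have := measurable_expK ε
  fun_prop

lemma measurable_mSymbReg (ε : ℝ) : Measurable (mSymbReg μ ε) := by
  have h : StronglyMeasurable (Function.uncurry fun p q : ℝ × ℝ =>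
      expK ε (p.1 - q.1) * expK ε (p.2 - q.2)) := (measurable_expK_mul_expK ε).stronglyMeasurable
  exact h.integral_prod_right.measurable

lemma tendsto_mSymbReg {ε : ℕ → ℝ} (hε : Tendsto ε atTop (nhds 0)) (hε0 : ∀ n, 0 < ε n)
    (p : ℝ × ℝ) : Tendsto (fun n => mSymbReg μ (ε n) p) atTop (nhds (mSymb μ p.1 p.2 : ℂ)) := by
  rw [mSymb_eq_integral]
  refine tendsto_integral_of_dominated_convergence (fun _ => (1 : ℝ)) (fun n => ?_)
    (integrable_const _) (fun n => ae_of_all _ fun q => ?_) (ae_of_all _ fun q => ?_)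
  · exact ((measurable_expK_mul_expK (ε n)).comp (by fun_prop :
      Measurable fun q : ℝ × ℝ => (p, q))).aestronglyMeasurable
  · rw [norm_mul]
    exact mul_le_one₀ (norm_expK_le_one (hε0 n) _) (norm_nonneg _) (norm_expK_le_one (hε0 n) _)
  · exact (tendsto_expK hε _).mul (tendsto_expK hε _)

lemma norm_mSymbReg_le {ε : ℝ} (hε : 0 < ε) (p : ℝ × ℝ) :
    ‖mSymbReg μ ε p‖ ≤ ‖(mSymb μ p.1 p.2 : ℂ)‖ := by
  have h0 : 0 ≤ mSymb μ p.1 p.2 := ENNReal.toReal_nonneg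
  rw [Complex.norm_real, Real.norm_of_nonneg h0]
  have h1 : mSymb μ p.1 p.2 = ∫ q, (Iio p.1 ×ˢ Iio p.2).indicator (fun _ => (1 : ℝ)) q ∂μ := by
    rw [integral_indicator (measurableSet_Iio.prod measurableSet_Iio)]
    simp [mSymb, Measure.real]
  rw [h1]
  refine norm_integral_le_of_norm_le ((integrable_const (1 : ℝ)).indicator
    (measurableSet_Iio.prod measurableSet_Iio)) (ae_of_all _ fun q => ?_)
  rw [norm_mul]
  refine (mul_le_mul (norm_expK_le hε _) (norm_expK_le hε _) (norm_nonneg _)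
    (indicator_nonneg (fun _ _ => zero_le_one) _)).trans (le_of_eq ?_)
  simp only [indicator_apply, mem_Ioi, sub_pos, mem_prod, mem_Iio]
  split_ifs <;> simp_all

lemma tendsto_BmReg {f g : ℝ → ℂ} (hf : Measurable f) (hg : Measurable g) {x : ℝ}
    (hi : Integrable fun p : ℝ × ℝ => (mSymb μ p.1 p.2 : ℂ) * FT f p.1 * FT g p.2 *
      eTerm (2 * Real.pi * x * (p.1 + p.2))) {ε : ℕ → ℝ} (hε : Tendsto ε atTop (nhds 0))
    (hε0 : ∀ n, 0 < ε n) :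
    Tendsto (fun n => BmReg μ (ε n) f g x) atTop (nhds (Bm μ f g x)) := by
  have hE := continuous_eTerm.measurable
  have hF := measurable_FT hf
  have hG := measurable_FT hg
  refine tendsto_integral_of_dominated_convergence _ (fun n => ?_) hi.norm
    (fun n => ae_of_all _ fun p => ?_) (ae_of_all _ fun p => ?_)
  · have hm := measurable_mSymbReg (μ := μ) (ε n)
    have h : Measurable fun p : ℝ × ℝ => mSymbReg μ (ε n) p * FT f p.1 * FT g p.2 *
      eTerm (2 * Real.pi * x * (p.1 + p.2)) := by fun_prop
    exact h.aestronglyMeasurable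
  · simp only [norm_mul]
    gcongr
    exact norm_mSymbReg_le (hε0 n) p
  · exact (((tendsto_mSymbReg hε hε0 p).mul_const _).mul_const _).mul_const _

lemma integrable_expK_mul_expK {ε : ℝ} (hε : 0 < ε) :
    Integrable (fun z : (ℝ × ℝ) × (ℝ × ℝ) =>
      expK ε (z.1.1 - z.2.1) * expK ε (z.1.2 - z.2.2)) (volume.prod μ) := by
  have hi := integrable_expK hε
  rw [integrable_prod_iff' (measurable_expK_mul_expK ε).aestronglyMeasurable]
  refine ⟨ae_of_all _ fun q => (hi.comp_sub_right q.1).mul_prod (hi.comp_sub_right q.2), ?_⟩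
  have h : ∀ q : ℝ × ℝ, ∫ p : ℝ × ℝ, ‖expK ε (p.1 - q.1) * expK ε (p.2 - q.2)‖ =
      (∫ u, ‖expK ε u‖) * ∫ u, ‖expK ε u‖ := fun q => by
    have h1 := integral_prod_mul (μ := (volume : Measure ℝ)) (ν := (volume : Measure ℝ))
      (fun u => ‖expK ε (u - q.1)‖) (fun u => ‖expK ε (u - q.2)‖)
    rw [integral_sub_right_eq_self (fun u => ‖expK ε u‖) q.1,
      integral_sub_right_eq_self (fun u => ‖expK ε u‖) q.2] at h1
    simp only [norm_mul]
    exact h1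
  simp only [h]
  exact integrable_const _

lemma BmReg_eq {f g : ℝ → ℂ} (hf : Measurable f) (hfi : Integrable f) (hg : Measurable g)
    (hgi : Integrable g) {ε : ℝ} (hε : 0 < ε) (x : ℝ) :
    BmReg μ ε f g x = ∫ q : ℝ × ℝ,
      (eTerm (2 * Real.pi * x * q.1) *
        ∫ y, cauchyK ε (x - y) * (f y * eTerm (-(2 * Real.pi * y * q.1)))) *
      (eTerm (2 * Real.pi * x * q.2) *
        ∫ y, cauchyK ε (x - y) * (g y * eTerm (-(2 * Real.pi * y * q.2)))) ∂μ := by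
  have hE := continuous_eTerm.measurable
  have hF := measurable_FT hf
  have hG := measurable_FT hg
  simp only [← integral_expK_mul_FT hε hfi, ← integral_expK_mul_FT hε hgi]
  have e1 : ∀ p : ℝ × ℝ, mSymbReg μ ε p * FT f p.1 * FT g p.2 *
      eTerm (2 * Real.pi * x * (p.1 + p.2)) =
      ∫ q : ℝ × ℝ, (expK ε (p.1 - q.1) * (FT f p.1 * eTerm (2 * Real.pi * x * p.1))) *
        (expK ε (p.2 - q.2) * (FT g p.2 * eTerm (2 * Real.pi * x * p.2))) ∂μ := fun p => by
    rw [mSymbReg, ← integral_mul_const, ← integral_mul_const, ← integral_mul_const]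
    congr 1
    ext q
    rw [mul_add, eTerm_add]
    ring
  rw [BmReg]
  simp only [e1]
  rw [integral_integral_swap]
  · congr 1
    ext q
    exact integral_prod_mul
      (fun ξ => expK ε (ξ - q.1) * (FT f ξ * eTerm (2 * Real.pi * x * ξ)))
      (fun ξ => expK ε (ξ - q.2) * (FT g ξ * eTerm (2 * Real.pi * x * ξ)))
  · have hph : Measurable fun z : (ℝ × ℝ) × (ℝ × ℝ) => FT f z.1.1 *
        eTerm (2 * Real.pi * x * z.1.1) * (FT g z.1.2 * eTerm (2 * Real.pi * x * z.1.2)) := by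
      fun_prop
    refine ((integrable_expK_mul_expK (μ := μ) hε).bdd_smul
      ((∫ y, ‖f y‖) * ∫ y, ‖g y‖ : ℝ) hph.aestronglyMeasurable
      (ae_of_all _ fun z => ?_)).congr (ae_of_all _ fun z => ?_)
    · simp only [norm_mul, norm_eTerm, mul_one]
      exact mul_le_mul (norm_FT_le f _) (norm_FT_le g _) (norm_nonneg _)
        (integral_nonneg fun _ => norm_nonneg _)
    · simp only [Function.uncurry, smul_eq_mul, Pi.smul_apply']
      ring

lemma enorm_BmReg_le {f g : ℝ → ℂ} (hf : Measurable f) (hfi : Integrable f) (hg : Measurable g)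
    (hgi : Integrable g) {ε : ℝ} (hε : 0 < ε) (x : ℝ) :
    ‖BmReg μ ε f g x‖ₑ ≤ ‖cauchyT ε (modulate μ measurable_fst f) x‖ₑ *
      ‖cauchyT ε (modulate μ measurable_snd g) x‖ₑ := by
  have hA := cauchyT_modulate_ae_eq (μ := μ) measurable_fst hf hfi hε x
  have hD := cauchyT_modulate_ae_eq (μ := μ) measurable_snd hg hgi hε x
  set a := cauchyT ε (modulate μ measurable_fst f) x
  set d := cauchyT ε (modulate μ measurable_snd g) x
  have ha : ‖a‖ₑ = rt (∫⁻ q, ‖a q‖ₑ ^ 2 ∂μ) := by rw [Lp.enorm_def, eLpNorm_two_eq]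
  have hd : ‖d‖ₑ = rt (∫⁻ q, ‖d q‖ₑ ^ 2 ∂μ) := by rw [Lp.enorm_def, eLpNorm_two_eq]
  have hE : ∀ r, ‖eTerm r‖ₑ = 1 := fun r => by
    rw [← ofReal_norm, norm_eTerm, ENNReal.ofReal_one]
  rw [BmReg_eq hf hfi hg hgi hε]
  calc _ ≤ ∫⁻ q, ‖a q‖ₑ * ‖d q‖ₑ ∂μ := by
        refine (enorm_integral_le_lintegral_enorm _).trans (le_of_eq (lintegral_congr_ae ?_))
        filter_upwards [hA, hD] with q h1 h2
        rw [h1, h2, enorm_mul, enorm_mul, enorm_mul, hE, hE, one_mul, one_mul]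
    _ ≤ (∫⁻ q, ‖a q‖ₑ ^ (2 : ℝ) ∂μ) ^ (1 / 2 : ℝ) * (∫⁻ q, ‖d q‖ₑ ^ (2 : ℝ) ∂μ) ^ (1 / 2 : ℝ) :=
        ENNReal.lintegral_mul_le_Lp_mul_Lq μ Real.HolderConjugate.two_two
          (Lp.aestronglyMeasurable a).enorm (Lp.aestronglyMeasurable d).enorm
    _ = _ := by
        rw [ha, hd]
        simp only [ENNReal.rpow_two]
        rfl

end Regularization

end

section

open scoped NNReal

lemma dens_Bm_le {μ : Measure (ℝ × ℝ)} [IsFiniteMeasure μ] {U V : ℝ → ℝ≥0∞} {D : ℝ≥0}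
    (hU : IsA1 D U) (hV : IsA1 D V) {K I J : ℝ≥0∞} (hK : K ≠ 0) (hK' : K ≠ ∞)
    (hT : ∀ (W : ℝ → ℝ≥0∞) (F : ℝ → Lp ℂ 2 μ), IsA1 D W → Integrable F → StronglyMeasurable F →
      ∀ (ε : ℝ) (τ : ℝ≥0∞), 0 < ε → τ ≠ 0 → τ ≠ ∞ →
      τ * dens (fun x => rt (U x) * rt (V x))
        {x | τ * (rt (U x) * rt (V x)) < W x * ‖cauchyT ε F x‖ₑ} ≤ K * ∫⁻ x, ‖F x‖ₑ * W x)
    {f g : ℝ → ℂ} (hf : Measurable f) (hfi : Integrable f) (hg : Measurable g)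
    (hgi : Integrable g) (hI : ∫⁻ x, ‖modulate μ measurable_fst f x‖ₑ * U x ≤ I)
    (hJ : ∫⁻ x, ‖modulate μ measurable_snd g x‖ₑ * V x ≤ J) (hI0 : I ≠ 0) (hI' : I ≠ ∞)
    (hJ0 : J ≠ 0) (hJ' : J ≠ ∞) {t : ℝ} (ht : 0 < t) :
    dens (fun x => rt (U x) * rt (V x)) {x | t < ‖Bm μ f g x‖} ≤
      rt (4 * (K * I * (K * J)) / ENNReal.ofReal t) := by
  have ht0 : ENNReal.ofReal t ≠ 0 := by simpa using ht
  set ε : ℕ → ℝ := fun m => 1 / ((m : ℝ) + 1) with hεdef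
  have hε0 : ∀ m, 0 < ε m := fun m => Nat.one_div_pos_of_nat
  have hε : Tendsto ε atTop (nhds 0) := tendsto_one_div_add_atTop_nhds_zero_nat
  refine measure_le_of_eventually_mem (A := fun m => {x | t < ‖BmReg μ (ε m) f g x‖})
    (fun x hx => ?_) (Eventually.of_forall fun m => ?_)
  · have hx' : t < ‖Bm μ f g x‖ := hx
    have hi : Integrable fun p : ℝ × ℝ => (mSymb μ p.1 p.2 : ℂ) * FT f p.1 * FT g p.2 *
        eTerm (2 * Real.pi * x * (p.1 + p.2)) := by
      by_contra hi
      have h0 : Bm μ f g x = 0 := integral_undef hi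
      rw [h0, norm_zero] at hx'
      exact hx'.not_gt ht
    exact (tendsto_BmReg hf hg hi hε hε0).norm.eventually (lt_mem_nhds hx')
  · refine le_rt_of_forall (mul_ne_zero hK hI0) (ENNReal.mul_ne_top hK' hI') (mul_ne_zero hK hJ0)
      (ENNReal.mul_ne_top hK' hJ') ht0 ENNReal.ofReal_ne_top fun a b ha ha' hb hb' hab => ?_
    have h1 := hT U _ hU (integrable_modulate measurable_fst hf hfi)
      (stronglyMeasurable_modulate measurable_fst hf) (ε m) a (hε0 m) ha ha'
    have h2 := hT V _ hV (integrable_modulate measurable_snd hg hgi)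
      (stronglyMeasurable_modulate measurable_snd hg) (ε m) b (hε0 m) hb hb'
    refine ⟨_, _, (measure_mono fun x hx => ?_).trans (measure_union_le _ _),
      h1.trans (mul_le_mul_right hI _), h2.trans (mul_le_mul_right hJ _)⟩
    have hx' : t < ‖BmReg μ (ε m) f g x‖ := hx
    set P := ‖cauchyT (ε m) (modulate μ measurable_fst f) x‖ₑ with hP
    set Q := ‖cauchyT (ε m) (modulate μ measurable_snd g) x‖ₑ with hQ
    have hlt : ENNReal.ofReal t < P * Q := by
      refine lt_of_lt_of_le ?_ (enorm_BmReg_le hf hfi hg hgi (hε0 m) x)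
      rw [← ofReal_norm]
      exact (ENNReal.ofReal_lt_ofReal_iff_of_nonneg ht.le).2 hx'
    by_contra hn
    rw [mem_union, not_or] at hn
    have n1 : U x * P ≤ a * (rt (U x) * rt (V x)) := not_lt.1 hn.1
    have n2 : V x * Q ≤ b * (rt (U x) * rt (V x)) := not_lt.1 hn.2
    have h3 : U x * V x * (P * Q) ≤ U x * V x * ENNReal.ofReal t :=
      calc U x * V x * (P * Q) = U x * P * (V x * Q) := by ring
        _ ≤ a * (rt (U x) * rt (V x)) * (b * (rt (U x) * rt (V x))) := mul_le_mul' n1 n2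
        _ = a * b * ((rt (U x) * rt (U x)) * (rt (V x) * rt (V x))) := by ring
        _ = U x * V x * ENNReal.ofReal t := by rw [rt_mul_self, rt_mul_self, hab, mul_comm]
    exact hlt.not_ge ((ENNReal.mul_le_mul_iff_right
      (mul_ne_zero (hU.ne_zero x) (hV.ne_zero x))
      (ENNReal.mul_ne_top (hU.ne_top x) (hV.ne_top x))).1 h3)

lemma Bm_eq_zero_left {μ : Measure (ℝ × ℝ)} {f g : ℝ → ℂ} (hf : FT f = 0) : Bm μ f g = 0 := by
  ext x
  simp [Bm, hf]

lemma Bm_eq_zero_right {μ : Measure (ℝ × ℝ)} {f g : ℝ → ℂ} (hg : FT g = 0) : Bm μ f g = 0 := by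
  ext x
  simp [Bm, hg]

lemma wMeasure_eq_dens {w : ℝ → ℝ} {U : ℝ → ℝ≥0∞}
    (h : (fun x => ENNReal.ofReal (w x)) =ᵐ[volume] U) : wMeasure w = dens U :=
  withDensity_congr_ae h

lemma wMeasure_sqrt_mul_sqrt_eq_dens {w₁ w₂ : ℝ → ℝ} {U V : ℝ → ℝ≥0∞}
    (h₁ : (fun x => ENNReal.ofReal (w₁ x)) =ᵐ[volume] U)
    (h₂ : (fun x => ENNReal.ofReal (w₂ x)) =ᵐ[volume] V)
    (hw₁ : ∀ᵐ x, 0 < w₁ x) (hw₂ : ∀ᵐ x, 0 < w₂ x) :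
    wMeasure (fun x => w₁ x ^ ((1 : ℝ) / 2) * w₂ x ^ ((1 : ℝ) / 2)) =
      dens fun x => rt (U x) * rt (V x) := by
  refine withDensity_congr_ae ?_
  filter_upwards [h₁, h₂, hw₁, hw₂] with x h1 h2 hx1 hx2
  have h1' : ENNReal.ofReal (w₁ x) = U x := h1
  have h2' : ENNReal.ofReal (w₂ x) = V x := h2
  rw [ENNReal.ofReal_mul (Real.rpow_nonneg hx1.le _), ← ENNReal.ofReal_rpow_of_pos hx1,
    ← ENNReal.ofReal_rpow_of_pos hx2, h1', h2']
  rfl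

lemma IsA1.lintegral_dens {C : ℝ≥0} {U : ℝ → ℝ≥0∞} (hU : IsA1 C U) (f : ℝ → ℂ) :
    ∫⁻ x, ENNReal.ofReal ‖f x‖ ∂dens U = ∫⁻ x, ‖f x‖ₑ * U x := by
  have h := hU.dens_apply (fun x => ‖f x‖ₑ) MeasurableSet.univ
  simpa only [ofReal_norm, Measure.restrict_univ] using h

lemma IsA1.ae_eq_zero {C : ℝ≥0} {U : ℝ → ℝ≥0∞} (hU : IsA1 C U) {f : ℝ → ℂ} (hf : Measurable f)
    (h : ∫⁻ x, ‖f x‖ₑ * U x = 0) : f =ᵐ[volume] 0 := by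
  have hm : Measurable fun x => ‖f x‖ₑ * U x := hf.enorm.mul hU.measurable
  filter_upwards [(lintegral_eq_zero_iff hm).1 h] with x hx
  have hx' : ‖f x‖ₑ * U x = 0 := hx
  simpa [hU.ne_zero x] using hx'

lemma lintegral_enorm_modulate_mul {X : Type*} [MeasurableSpace X] {μ : Measure X}
    [IsFiniteMeasure μ] {φ : X → ℝ} (hφ : Measurable φ) (f : ℝ → ℂ) (W : ℝ → ℝ≥0∞) :
    ∫⁻ x, ‖modulate μ hφ f x‖ₑ * W x = rt (μ univ) * ∫⁻ x, ‖f x‖ₑ * W x := by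
  rw [← lintegral_const_mul' _ _ (rt_ne_top (measure_ne_top _ _))]
  refine lintegral_congr fun x => ?_
  rw [enorm_modulate]
  ring

end

/-- Endpoint estimate for the bounded-variation bilinear multiplier: for all
`w₁, w₂ ∈ A₁`, `B_m : L¹(w₁) × L¹(w₂) → L^{1/2,∞}(w₁^{1/2} w₂^{1/2})`. -/
theorem stmt18 (μ : Measure (ℝ × ℝ)) [IsFiniteMeasure μ]
    (w1 w2 : ℝ → ℝ) (hw1 : MemA1R w1) (hw2 : MemA1R w2) :
    ∃ C : ℝ≥0∞, C < ⊤ ∧ ∀ f g : ℝ → ℂ, Measurable f → Measurable g →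
      wLorentz (1 / 2) (wMeasure fun x => w1 x ^ ((1 : ℝ) / 2) * w2 x ^ ((1 : ℝ) / 2))
          (Bm μ f g) ≤
        C * (∫⁻ x, ENNReal.ofReal ‖f x‖ ∂wMeasure w1) *
          (∫⁻ x, ENNReal.ofReal ‖g x‖ ∂wMeasure w2) := by
  obtain ⟨C₁, U, hU, hwU⟩ := hw1.exists_isA1
  obtain ⟨C₂, V, hV, hwV⟩ := hw2.exists_isA1
  replace hU := hU.mono (le_max_left C₁ C₂)
  replace hV := hV.mono (le_max_right C₁ C₂)
  set D := max C₁ C₂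
  obtain ⟨C, hC, hT⟩ := exists_dens_cauchyT_le hU.one_le hU.one_le
  set K := C + 1 with hKdef
  have hK : K ≠ 0 := by simp [hKdef]
  have hK' : K ≠ ∞ := ENNReal.add_ne_top.2 ⟨hC, ENNReal.one_ne_top⟩
  set L := rt (μ univ) + 1 with hLdef
  have hL : L ≠ 0 := by simp [hLdef]
  have hL' : L ≠ ∞ := ENNReal.add_ne_top.2 ⟨rt_ne_top (measure_ne_top _ _), ENNReal.one_ne_top⟩
  have hKL : 4 * (K * L) ^ 2 ≠ 0 := by simp [hK, hL]
  have hKL' : 4 * (K * L) ^ 2 ≠ ∞ :=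
    ENNReal.mul_ne_top (by norm_num) (ENNReal.pow_ne_top (ENNReal.mul_ne_top hK' hL'))
  refine ⟨4 * (K * L) ^ 2, hKL'.lt_top, fun f g hf hg => ?_⟩
  rw [wMeasure_sqrt_mul_sqrt_eq_dens hwU hwV hw1.1.2 hw2.1.2, wMeasure_eq_dens hwU,
    wMeasure_eq_dens hwV, hU.lintegral_dens, hV.lintegral_dens]
  refine iSup₂_le fun t ht => ?_
  have htriv : Bm μ f g = 0 → ENNReal.ofReal t *
      dens (fun x => rt (U x) * rt (V x)) {x | t < ‖Bm μ f g x‖} ^ (1 / (1 / 2 : ℝ)) = 0 := by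
    intro h0
    simp [h0, ht.not_gt]
  by_cases hfi : Integrable f
  swap
  · rw [htriv (Bm_eq_zero_left (FT_eq_zero_of_not_integrable hfi))]
    exact zero_le
  by_cases hgi : Integrable g
  swap
  · rw [htriv (Bm_eq_zero_right (FT_eq_zero_of_not_integrable hgi))]
    exact zero_le
  by_cases hI0 : ∫⁻ x, ‖f x‖ₑ * U x = 0
  · rw [htriv (Bm_eq_zero_left (FT_eq_zero_of_ae (hU.ae_eq_zero hf hI0)))]
    exact zero_le
  by_cases hJ0 : ∫⁻ x, ‖g x‖ₑ * V x = 0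
  · rw [htriv (Bm_eq_zero_right (FT_eq_zero_of_ae (hV.ae_eq_zero hg hJ0)))]
    exact zero_le
  set I := ∫⁻ x, ‖f x‖ₑ * U x with hI
  set J := ∫⁻ x, ‖g x‖ₑ * V x with hJ
  by_cases hI' : I = ∞
  · rw [hI', ENNReal.mul_top hKL, ENNReal.top_mul hJ0]
    exact le_top
  by_cases hJ' : J = ∞
  · rw [hJ', ENNReal.mul_top (mul_ne_zero hKL hI0)]
    exact le_top
  have hmod : rt (μ univ) ≤ L := le_self_add
  have h := dens_Bm_le (μ := μ) hU hV hK hK' (I := L * I) (J := L * J)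
    (fun W F hW hF hFm ε τ hε hτ hτ' => (hT _ W _ F hW (hU.rt_mul_rt hV) hF hFm ε τ hε hτ hτ').trans
      (mul_le_mul_left le_self_add _)) hf hfi hg hgi
    (by rw [lintegral_enorm_modulate_mul]; exact mul_le_mul_left hmod _)
    (by rw [lintegral_enorm_modulate_mul]; exact mul_le_mul_left hmod _)
    (mul_ne_zero hL hI0) (ENNReal.mul_ne_top hL' hI') (mul_ne_zero hL hJ0)
    (ENNReal.mul_ne_top hL' hJ') ht
  have ht0 : ENNReal.ofReal t ≠ 0 := by simpa using ht
  have h2 := pow_le_pow_left₀ zero_le h 2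
  rw [sq_rt] at h2
  rw [one_div_one_div, ENNReal.rpow_two]
  calc _ ≤ ENNReal.ofReal t * (4 * (K * (L * I) * (K * (L * J))) / ENNReal.ofReal t) :=
        mul_le_mul_right h2 _
    _ = 4 * (K * (L * I) * (K * (L * J))) :=
        ENNReal.mul_div_cancel ht0 ENNReal.ofReal_ne_top
    _ = _ := by ring
end
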